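/- Let 𝒜 = V(ℓ_0 ℓ_1 ⋯ ℓ_n) ⊂ ℂ^d be an essential hyperplane arrangement with complement X. For generic u ∈ ℂ^{n+1}, the scattering equations ∂ℒ_u/∂x_1 = ⋯ = ∂ℒ_u/∂x_d = 0 have only isolated solutions in X, and the number of solutions equals (−1)^d · χ(X), where χ(X) is the topological Euler characteristic of X. Moreover, every solution is a nondegenerate critical point of ℒ_u, i.e. the Hessian determinant det(∂²ℒ_u/∂x_i∂x_j) is nonzero at each solution. -/

import Mathlib

open scoped BigOperators
noncomputable section

namespace ScatteringPaper

open CategoryTheory AlgebraicTopology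

/- ## Topological Euler characteristic via rational singular homology -/

/-- The singular chain complex of a topological space, with rational coefficients. -/
def singularChainComplex (X : Type) [TopologicalSpace X] : ChainComplex (ModuleCat ℚ) ℕ :=
  (alternatingFaceMapComplex (ModuleCat ℚ)).obj
    (((SimplicialObject.whiskering _ _).obj (ModuleCat.free ℚ)).obj (TopCat.toSSet.obj (TopCat.of X)))

/-- The `q`-th (rational) Betti number of a topological space. -/
def betti (X : Type) [TopologicalSpace X] (q : ℕ) : ℕ :=
  Module.finrank ℚ ((singularChainComplex X).homology q)

/-- The topological Euler characteristic, as the alternating sum of Betti numbers. -/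
def eulerChar (X : Type) [TopologicalSpace X] : ℤ :=
  ∑ᶠ q : ℕ, (-1 : ℤ) ^ q * (betti X q : ℤ)

variable {d : ℕ} {ι : Type} [Fintype ι] [DecidableEq ι]

/- ## Hyperplane arrangements: `(ℓ_i(x))_i = (1, x_1, …, x_d) · L` -/

/-- Value of the affine-linear form encoded by column `i` of `L`. -/
def ell (K : Type) [Field K] (L : Matrix (Fin (d+1)) ι K) (x : Fin d → K) (i : ι) : K :=
  L 0 i + ∑ j : Fin d, x j * L j.succ i

/-- The complement `X = ℂ^d ∖ 𝒜` of the arrangement `𝒜 = V(∏ ℓ_i)`. -/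
def complementX (L : Matrix (Fin (d+1)) ι ℂ) : Set (Fin d → ℂ) := {x | ∀ i, ell ℂ L x i ≠ 0}

/-- `x ∈ X` is a solution of the scattering equations
`∂ℒ_u/∂x_k = ∑_i u_i a_{ki}/ℓ_i(x) = 0`, `k = 1, …, d`. -/
def IsSol (L : Matrix (Fin (d+1)) ι ℂ) (u : ι → ℂ) (x : Fin d → ℂ) : Prop :=
  x ∈ complementX L ∧ ∀ k : Fin d, ∑ i : ι, u i * L k.succ i / ell ℂ L x i = 0

/-- An arrangement is essential if some subset of its hyperplanes meets in a single point. -/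
def IsEssential (L : Matrix (Fin (d+1)) ι ℂ) : Prop :=
  ∃ (S : Set ι) (x₀ : Fin d → ℂ), {x : Fin d → ℂ | ∀ i ∈ S, ell ℂ L x i = 0} = {x₀}

/-- `P u` holds for all `u` outside a proper algebraic subset (i.e. for generic `u`). -/
def Generically {σ : Type} [Fintype σ] [DecidableEq σ] (P : (σ → ℂ) → Prop) : Prop :=
  ∃ g : MvPolynomial σ ℂ, g ≠ 0 ∧ ∀ u : σ → ℂ, MvPolynomial.eval u g ≠ 0 → P u

/- ## Matroid data of the columns of `L` -/

/-- Rank of the set `I` of columns of `L` (the matroid rank in `M(L)`). -/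
def rkL (K : Type) [Field K] (L : Matrix (Fin (d+1)) ι K) (I : Set ι) : ℕ :=
  Module.finrank K (Submodule.span K ((fun i => fun r => L r i) '' I))

/-- Rank of the set `I` of columns of `A^⊤` (`L` with its first row deleted). -/
def rkA (K : Type) [Field K] (L : Matrix (Fin (d+1)) ι K) (I : Set ι) : ℕ :=
  Module.finrank K (Submodule.span K ((fun i => fun k : Fin d => L k.succ i) '' I))

/-- `I` is a flat of the matroid `M(L)`. -/
def IsFlat (K : Type) [Field K] (L : Matrix (Fin (d+1)) ι K) (I : Set ι) : Prop :=
  ∀ i ∉ I, rkL K L I < rkL K L (insert i I)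

/-- `C` is a circuit of `M(L)`: a minimal linearly dependent set of columns. -/
def IsCircuit (K : Type) [Field K] (L : Matrix (Fin (d+1)) ι K) (C : Finset ι) : Prop :=
  (¬ LinearIndependent K (fun i : {a // a ∈ C} => fun r => L r i.1)) ∧
  ∀ D : Finset ι, D ⊂ C → LinearIndependent K (fun i : {a // a ∈ D} => fun r => L r i.1)

/-- `M(L)` is connected: there is no separation into two nonempty parts with additive rank. -/
def MatroidConnected (K : Type) [Field K] (L : Matrix (Fin (d+1)) ι K) : Prop :=
  ∀ S : Set ι, S.Nonempty → Sᶜ.Nonempty → rkL K L S + rkL K L Sᶜ ≠ rkL K L Set.univ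

/- ## The reciprocal linear space -/

/-- Zariski closure of a subset of affine space `K^ι`. -/
def zarClosure (K : Type) [Field K] (S : Set (ι → K)) : Set (ι → K) :=
  {v | ∀ f : MvPolynomial ι K, (∀ w ∈ S, MvPolynomial.eval w f = 0) → MvPolynomial.eval v f = 0}

/-- The affine cone over the image of `φ : x ↦ (ℓ_0(x)⁻¹ : ⋯ : ℓ_n(x)⁻¹)`. -/
def coneImage (L : Matrix (Fin (d+1)) ι ℂ) : Set (ι → ℂ) :=
  {v | ∃ (c : ℂ) (x : Fin d → ℂ), x ∈ complementX L ∧ v = fun i => c / ell ℂ L x i}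

/-- The vanishing ideal of a subset of affine space. -/
def vanishingIdeal (K : Type) [Field K] (S : Set (ι → K)) : Ideal (MvPolynomial ι K) where
  carrier := {f | ∀ v ∈ S, MvPolynomial.eval v f = 0}
  add_mem' := by
    intro a b ha hb v hv
    simp [map_add, ha v hv, hb v hv]
  zero_mem' := by intro v hv; simp
  smul_mem' := by
    intro c f hf v hv
    simp [smul_eq_mul, map_mul, hf v hv]

/-- Projective space `ℙ^n = ℙ(ℂ^ι)`. -/
abbrev Pn (ι : Type) [Fintype ι] := Projectivization ℂ (ι → ℂ)

/-- The reciprocal linear space `ℛ_L ⊂ ℙ^n`, the Zariski closure of `im φ`. -/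
def RL (L : Matrix (Fin (d+1)) ι ℂ) : Set (Pn ι) :=
  {p | p.rep ∈ zarClosure ℂ (coneImage L)}

/-- The linear space `𝕃_u = {y : A^⊤ diag(u) y = 0} ⊂ ℙ^n`. -/
def LuSet (L : Matrix (Fin (d+1)) ι ℂ) (u : ι → ℂ) : Set (Pn ι) :=
  {p | ∀ k : Fin d, ∑ i : ι, L k.succ i * u i * p.rep i = 0}

/-- The torus orbit `U_I = {y ∈ ℙ^n : y_i ≠ 0 ⇔ i ∈ I}`. -/
def Ustratum (I : Set ι) : Set (Pn ι) := {p : Pn ι | ∀ i : ι, p.rep i ≠ 0 ↔ i ∈ I}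

/-- `p = φ(x)` for the map `φ : x ↦ (ℓ_0(x)⁻¹ : ⋯ : ℓ_n(x)⁻¹)`. -/
def PhiRel (L : Matrix (Fin (d+1)) ι ℂ) (x : Fin d → ℂ) (p : Pn ι) : Prop :=
  ∃ hv : (fun i => (ell ℂ L x i)⁻¹) ≠ 0, p = Projectivization.mk ℂ (fun i => (ell ℂ L x i)⁻¹) hv

/-- The image of `φ` in `ℙ^n`. -/
def imPhi (L : Matrix (Fin (d+1)) ι ℂ) : Set (Pn ι) :=
  {p | ∃ x ∈ complementX L, PhiRel L x p}

/-- Complement of the subarrangement `𝒜_I`. -/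
def subComplement (L : Matrix (Fin (d+1)) ι ℂ) (I : Set ι) : Set (Fin d → ℂ) :=
  {x | ∀ i ∈ I, ell ℂ L x i ≠ 0}

/-- The affine cone over the image of the reciprocal map of the subarrangement indexed by `I`,
embedded in the coordinate subspace `{y_i = 0, i ∉ I}`. -/
def coneImageSub (L : Matrix (Fin (d+1)) ι ℂ) (I : Set ι) : Set (ι → ℂ) :=
  {v | ∃ (c : ℂ) (x : Fin d → ℂ), x ∈ subComplement L I ∧
      v = I.indicator (fun i => c / ell ℂ L x i)}

/-- The reciprocal linear space `ℛ_{L_I}` of the submatrix `L_I`, embedded in `ℙ^n`. -/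
def RLsub (L : Matrix (Fin (d+1)) ι ℂ) (I : Set ι) : Set (Pn ι) :=
  {p | p.rep ∈ zarClosure ℂ (coneImageSub L I)}

/-- The open stratum `ℛ_{L_I}^∘ = ℛ_{L_I} ∩ U_I`. -/
def RLsubOpen (L : Matrix (Fin (d+1)) ι ℂ) (I : Set ι) : Set (Pn ι) :=
  RLsub L I ∩ Ustratum I

/- ## The very affine variety `X_I = (ℂ^d ∖ 𝒜_I)/K_I` -/

/-- Quotient of `ℂ^d ∖ 𝒜_I` by translation by the left kernel `K_I` of `A_I^⊤`:
two points are identified iff `A_I^⊤` takes the same values on them. -/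
def XIsetoid (L : Matrix (Fin (d+1)) ι ℂ) (I : Set ι) : Setoid ↥(subComplement L I) where
  r x y := ∀ i ∈ I, ∑ k : Fin d, (x : Fin d → ℂ) k * L k.succ i
      = ∑ k : Fin d, (y : Fin d → ℂ) k * L k.succ i
  iseqv := ⟨fun _ _ _ => rfl, fun h i hi => (h i hi).symm, fun h1 h2 i hi => (h1 i hi).trans (h2 i hi)⟩

/-- The very affine variety `X_I = (ℂ^d ∖ 𝒜_I)/K_I`. -/
def XI (L : Matrix (Fin (d+1)) ι ℂ) (I : Set ι) : Type := Quotient (XIsetoid L I)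

instance (L : Matrix (Fin (d+1)) ι ℂ) (I : Set ι) : TopologicalSpace (XI L I) :=
  instTopologicalSpaceQuotient

/-- The complement of the arrangement, over a general field `K`. -/
def complementK (K : Type) [Field K] (L : Matrix (Fin (d+1)) ι K) : Set (Fin d → K) :=
  {x | ∀ i, ell K L x i ≠ 0}

/-- The affine cone over the image of the reciprocal map, over a general field `K`. -/
def coneImageK (K : Type) [Field K] (L : Matrix (Fin (d+1)) ι K) : Set (ι → K) :=
  {v | ∃ (c : K) (x : Fin d → K), x ∈ complementK K L ∧ v = fun i => c / ell K L x i}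

/- ## Hilbert functions, degree, Hilbert regularity -/

/-- The Hilbert function of the graded algebra `K[y]/I`:
`q ↦ dim_K (K[y]/I)_q`. -/
def hilb (K : Type) [Field K] (I : Ideal (MvPolynomial ι K)) (q : ℕ) : ℕ :=
  Module.finrank K ((MvPolynomial.homogeneousSubmodule ι K q).map
    (Ideal.Quotient.mkₐ K I).toLinearMap)

/-- `k` is the degree of the `d`-dimensional projective variety with homogeneous
coordinate ring `K[y]/I`: the Hilbert polynomial has degree `d` and leading
coefficient `k/d!`. -/
def IsProjDegree (K : Type) [Field K] (I : Ideal (MvPolynomial ι K)) (d k : ℕ) : Prop :=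
  ∃ P : Polynomial ℚ, (∃ N : ℕ, ∀ q : ℕ, N ≤ q → Polynomial.eval (q : ℚ) P = hilb K I q) ∧
    P.degree = (d : WithBot ℕ) ∧ P.leadingCoeff = (k : ℚ) / (Nat.factorial d : ℚ)

/-- The Hilbert function, extended by `0` to negative integers. -/
def HFZ (K : Type) [Field K] (I : Ideal (MvPolynomial ι K)) (q : ℤ) : ℕ :=
  if 0 ≤ q then hilb K I q.toNat else 0

/-- The Hilbert regularity: the smallest degree from which the Hilbert function
agrees with a (necessarily unique) polynomial. -/
def HReg (K : Type) [Field K] (I : Ideal (MvPolynomial ι K)) : ℤ :=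
  sInf {i : ℤ | ∃ P : Polynomial ℚ, ∀ q : ℤ, i ≤ q → Polynomial.eval (q : ℚ) P = HFZ K I q}

end ScatteringPaper

section
open CategoryTheory AlgebraicTopology

noncomputable section
namespace OT

/-- A graded vector space of finite total dimension. -/
def GFT (A : ℕ → Type) [∀ q, AddCommGroup (A q)] [∀ q, Module ℚ (A q)] : Prop :=
  (∀ q, Module.Finite ℚ (A q)) ∧ ∃ N, ∀ q, N ≤ q → Module.finrank ℚ (A q) = 0

def gchi (A : ℕ → Type) [∀ q, AddCommGroup (A q)] [∀ q, Module ℚ (A q)] : ℤ :=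
  ∑ᶠ q : ℕ, (-1 : ℤ) ^ q * (Module.finrank ℚ (A q) : ℤ)

lemma gchi_eq {A : ℕ → Type} [∀ q, AddCommGroup (A q)] [∀ q, Module ℚ (A q)] {N : ℕ}
    (h : ∀ q, N ≤ q → Module.finrank ℚ (A q) = 0) :
    gchi A = ∑ q ∈ Finset.range N, (-1 : ℤ) ^ q * (Module.finrank ℚ (A q) : ℤ) := by
  apply finsum_eq_sum_of_support_subset
  intro q hq
  simp only [Finset.coe_range, Set.mem_Iio]
  by_contra hc
  apply hq
  simp [h q (not_lt.1 hc)]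

lemma finite_mid {A B C : Type} [AddCommGroup A] [Module ℚ A] [AddCommGroup B] [Module ℚ B]
    [AddCommGroup C] [Module ℚ C] (f : A →ₗ[ℚ] B) (g : B →ₗ[ℚ] C)
    (h : LinearMap.ker g = LinearMap.range f) [Module.Finite ℚ A] [Module.Finite ℚ C] :
    Module.Finite ℚ B := by
  have h1 : Module.Finite ℚ (LinearMap.ker g) := by
    rw [h]; infer_instance
  have h2 : Module.Finite ℚ (B ⧸ LinearMap.ker g) :=
    Module.Finite.equiv g.quotKerEquivRange.symm
  exact Module.Finite.of_submodule_quotient (LinearMap.ker g)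

lemma finrank_mid {A B C : Type} [AddCommGroup A] [Module ℚ A] [AddCommGroup B] [Module ℚ B]
    [AddCommGroup C] [Module ℚ C] (f : A →ₗ[ℚ] B) (g : B →ₗ[ℚ] C)
    (h : LinearMap.ker g = LinearMap.range f) [Module.Finite ℚ B] :
    Module.finrank ℚ B = Module.finrank ℚ (LinearMap.range f) +
      Module.finrank ℚ (LinearMap.range g) := by
  rw [← h, add_comm, LinearMap.finrank_range_add_finrank_ker]

lemma finrank_mid_zero {A B C : Type} [AddCommGroup A] [Module ℚ A] [AddCommGroup B] [Module ℚ B]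
    [AddCommGroup C] [Module ℚ C] (f : A →ₗ[ℚ] B) (g : B →ₗ[ℚ] C)
    (h : LinearMap.ker g = LinearMap.range f) [Module.Finite ℚ A] [Module.Finite ℚ C]
    (hA : Module.finrank ℚ A = 0) (hC : Module.finrank ℚ C = 0) :
    Module.finrank ℚ B = 0 := by
  have := finite_mid f g h
  rw [finrank_mid f g h]
  have h1 := LinearMap.finrank_range_le f
  have h2 := Submodule.finrank_le (LinearMap.range g)
  omega

section les
variable {A B C : ℕ → Type} [∀ q, AddCommGroup (A q)] [∀ q, Module ℚ (A q)]
  [∀ q, AddCommGroup (B q)] [∀ q, Module ℚ (B q)]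
  [∀ q, AddCommGroup (C q)] [∀ q, Module ℚ (C q)]
  (f : ∀ q, A q →ₗ[ℚ] B q) (g : ∀ q, B q →ₗ[ℚ] C q) (δ : ∀ q, C (q+1) →ₗ[ℚ] A q)

lemma les_chi
    (hf : ∀ q, LinearMap.ker (f q) = LinearMap.range (δ q))
    (hg : ∀ q, LinearMap.ker (g q) = LinearMap.range (f q))
    (hg0 : LinearMap.range (g 0) = ⊤)
    (hδ : ∀ q, LinearMap.ker (δ q) = LinearMap.range (g (q+1)))
    (hA : GFT A) (hB : GFT B) (hC : GFT C) : gchi B = gchi A + gchi C := by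
  obtain ⟨fA, NA, hNA⟩ := hA
  obtain ⟨fB, NB, hNB⟩ := hB
  obtain ⟨fC, NC, hNC⟩ := hC
  set N := NA + NB + NC
  rw [gchi_eq (N := N) (fun q hq => hNA q (by omega)),
    gchi_eq (N := N) (fun q hq => hNB q (by omega)),
    gchi_eq (N := N) (fun q hq => hNC q (by omega))]
  have key : ∀ M : ℕ, ∑ q ∈ Finset.range (M+1), (-1 : ℤ) ^ q * (Module.finrank ℚ (A q) : ℤ)
      - ∑ q ∈ Finset.range (M+1), (-1 : ℤ) ^ q * (Module.finrank ℚ (B q) : ℤ)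
      + ∑ q ∈ Finset.range (M+1), (-1 : ℤ) ^ q * (Module.finrank ℚ (C q) : ℤ)
      = (-1 : ℤ) ^ M * (Module.finrank ℚ (LinearMap.range (δ M)) : ℤ) := by
    intro M
    induction M with
    | zero =>
      have e1 := finrank_mid (δ 0) (f 0) (hf 0)
      have e2 := finrank_mid (f 0) (g 0) (hg 0)
      have e3 : Module.finrank ℚ (C 0) = Module.finrank ℚ (LinearMap.range (g 0)) := by
        rw [hg0]; simp
      simp only [zero_add, Finset.range_one, Finset.sum_singleton, pow_zero, one_mul, e1, e2, e3]
      push_cast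
      ring
    | succ M ih =>
      have e1 := finrank_mid (δ (M+1)) (f (M+1)) (hf (M+1))
      have e2 := finrank_mid (f (M+1)) (g (M+1)) (hg (M+1))
      have e3 := finrank_mid (g (M+1)) (δ M) (hδ M)
      rw [Finset.sum_range_succ _ (M+1), Finset.sum_range_succ _ (M+1),
        Finset.sum_range_succ _ (M+1), e1, e2, e3]
      push_cast
      rw [pow_succ]
      linear_combination ih
  have := key N
  have e : Module.finrank ℚ (LinearMap.range (δ N)) = 0 := by
    have := Submodule.finrank_le (LinearMap.range (δ N))
    rw [hNA N (by omega)] at this; omega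
  rw [e] at this
  simp only [Finset.sum_range_succ, hNA N (by omega), hNB N (by omega), hNC N (by omega)] at this
  simp at this
  linear_combination -this

lemma les_B
    (hf : ∀ q, LinearMap.ker (f q) = LinearMap.range (δ q))
    (hg : ∀ q, LinearMap.ker (g q) = LinearMap.range (f q))
    (hg0 : LinearMap.range (g 0) = ⊤)
    (hδ : ∀ q, LinearMap.ker (δ q) = LinearMap.range (g (q+1)))
    (hA : GFT A) (hC : GFT C) : GFT B := by
  obtain ⟨fA, NA, hNA⟩ := hA
  obtain ⟨fC, NC, hNC⟩ := hC
  exact ⟨fun q => finite_mid (f q) (g q) (hg q), NA + NC, fun q hq =>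
    finrank_mid_zero (f q) (g q) (hg q) (hNA q (by omega)) (hNC q (by omega))⟩

lemma les_A
    (hf : ∀ q, LinearMap.ker (f q) = LinearMap.range (δ q))
    (hg : ∀ q, LinearMap.ker (g q) = LinearMap.range (f q))
    (hg0 : LinearMap.range (g 0) = ⊤)
    (hδ : ∀ q, LinearMap.ker (δ q) = LinearMap.range (g (q+1)))
    (hB : GFT B) (hC : GFT C) : GFT A := by
  obtain ⟨fA, NA, hNA⟩ := hB
  obtain ⟨fC, NC, hNC⟩ := hC
  exact ⟨fun q => finite_mid (δ q) (f q) (hf q), NA + NC, fun q hq =>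
    finrank_mid_zero (δ q) (f q) (hf q) (hNC _ (by omega)) (hNA q (by omega))⟩

lemma les_C
    (hf : ∀ q, LinearMap.ker (f q) = LinearMap.range (δ q))
    (hg : ∀ q, LinearMap.ker (g q) = LinearMap.range (f q))
    (hg0 : LinearMap.range (g 0) = ⊤)
    (hδ : ∀ q, LinearMap.ker (δ q) = LinearMap.range (g (q+1)))
    (hB : GFT B) (hA : GFT A) : GFT C := by
  obtain ⟨fA, NA, hNA⟩ := hA
  obtain ⟨fB, NB, hNB⟩ := hB
  refine ⟨fun q => ?_, NA + NB + 1, fun q hq => ?_⟩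
  · rcases q with _ | q
    · exact Module.Finite.of_surjective (g 0) (LinearMap.range_eq_top.1 hg0)
    · exact finite_mid (g (q+1)) (δ q) (hδ q)
  · rcases q with _ | q
    · omega
    · exact finrank_mid_zero (g (q+1)) (δ q) (hδ q) (hNB _ (by omega)) (hNA q (by omega))
end les

abbrev CC := ChainComplex (ModuleCat.{0} ℚ) ℕ

def HFT (K : CC) : Prop := GFT (fun q => K.homology q)
def hchi (K : CC) : ℤ := gchi (fun q => K.homology q)

section ses
variable {S : ShortComplex CC}

lemma ses_all (hS : S.ShortExact) : ∃ (f : ∀ q, S.X₁.homology q →ₗ[ℚ] S.X₂.homology q)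
    (g : ∀ q, S.X₂.homology q →ₗ[ℚ] S.X₃.homology q)
    (δ : ∀ q, S.X₃.homology (q+1) →ₗ[ℚ] S.X₁.homology q),
  (∀ q, LinearMap.ker (f q) = LinearMap.range (δ q)) ∧
  (∀ q, LinearMap.ker (g q) = LinearMap.range (f q)) ∧
  (LinearMap.range (g 0) = ⊤) ∧
  (∀ q, LinearMap.ker (δ q) = LinearMap.range (g (q+1))) := by
  refine ⟨fun q => (HomologicalComplex.homologyMap S.f q).hom,
    fun q => (HomologicalComplex.homologyMap S.g q).hom,
    fun q => (hS.δ (q+1) q (by simp)).hom, fun q => ?_, fun q => ?_, ?_, fun q => ?_⟩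
  · exact ((ShortComplex.moduleCat_exact_iff_range_eq_ker _).1
      (hS.homology_exact₁ (q+1) q (by simp))).symm
  · exact ((ShortComplex.moduleCat_exact_iff_range_eq_ker _).1 (hS.homology_exact₂ q)).symm
  · have := hS.epi_g
    have := HomologicalComplex.epi_homologyMap_of_epi_of_not_rel S.g 0 (by simp)
    exact LinearMap.range_eq_top.2 ((ModuleCat.epi_iff_surjective _).1 this)
  · exact ((ShortComplex.moduleCat_exact_iff_range_eq_ker _).1
      (hS.homology_exact₃ (q+1) q (by simp))).symm

lemma ses_chi (hS : S.ShortExact) (h1 : HFT S.X₁) (h2 : HFT S.X₂) (h3 : HFT S.X₃) :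
    hchi S.X₂ = hchi S.X₁ + hchi S.X₃ := by
  obtain ⟨f, g, δ, a, b, c, d⟩ := ses_all hS
  exact les_chi f g δ a b c d h1 h2 h3
lemma ses_1 (hS : S.ShortExact) (h2 : HFT S.X₂) (h3 : HFT S.X₃) : HFT S.X₁ := by
  obtain ⟨f, g, δ, a, b, c, d⟩ := ses_all hS
  exact les_A f g δ a b c d h2 h3
lemma ses_2 (hS : S.ShortExact) (h2 : HFT S.X₁) (h3 : HFT S.X₃) : HFT S.X₂ := by
  obtain ⟨f, g, δ, a, b, c, d⟩ := ses_all hS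
  exact les_B f g δ a b c d h2 h3
lemma ses_3 (hS : S.ShortExact) (h2 : HFT S.X₂) (h3 : HFT S.X₁) : HFT S.X₃ := by
  obtain ⟨f, g, δ, a, b, c, d⟩ := ses_all hS
  exact les_C f g δ a b c d h2 h3
end ses

lemma GFT_congr {A B : ℕ → Type} [∀ q, AddCommGroup (A q)] [∀ q, Module ℚ (A q)]
  [∀ q, AddCommGroup (B q)] [∀ q, Module ℚ (B q)] (e : ∀ q, A q ≃ₗ[ℚ] B q) (h : GFT A) :
    GFT B ∧ gchi B = gchi A := by
  refine ⟨⟨fun q => ?_, ?_⟩, ?_⟩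
  · have := h.1 q
    exact Module.Finite.equiv (e q)
  · obtain ⟨N, hN⟩ := h.2
    exact ⟨N, fun q hq => by rw [← (e q).finrank_eq, hN q hq]⟩
  · unfold gchi
    refine finsum_congr fun q => ?_
    rw [(e q).finrank_eq]

lemma HFT_congr {K K' : CC} (e : ∀ q, K.homology q ≅ K'.homology q) (h : HFT K) :
    HFT K' ∧ hchi K' = hchi K :=
  GFT_congr (fun q => (e q).toLinearEquiv) h

lemma HFT_iso {K K' : CC} (e : K ≅ K') (h : HFT K) : HFT K' ∧ hchi K' = hchi K :=
  HFT_congr (fun q => (HomologicalComplex.homologyFunctor _ _ q).mapIso e) h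

lemma HFT_zero {K : CC} (h : ∀ q, Subsingleton (K.homology q)) : HFT K ∧ hchi K = 0 := by
  have h0 : ∀ q, Module.finrank ℚ (K.homology q) = 0 := fun q => by
    have := h q
    exact Module.finrank_zero_of_subsingleton
  refine ⟨⟨fun q => ?_, 0, fun q _ => h0 q⟩, ?_⟩
  · have := h q
    infer_instance
  · exact gchi_eq (N := 0) (fun q _ => h0 q)

/-- Finite type spaces -/
def FT (X : Type) [TopologicalSpace X] : Prop := HFT (ScatteringPaper.singularChainComplex X)

lemma eulerChar_eq (X : Type) [TopologicalSpace X] :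
    ScatteringPaper.eulerChar X = hchi (ScatteringPaper.singularChainComplex X) := rfl

end OT
end
end

section
open CategoryTheory AlgebraicTopology

noncomputable section
namespace OT
open ScatteringPaper (singularChainComplex eulerChar)

/-- singular chains as a functor -/
def SCF : TopCat.{0} ⥤ CC := TopCat.toSSet ⋙ (SimplicialObject.whiskering _ _).obj (ModuleCat.free ℚ) ⋙
  alternatingFaceMapComplex (ModuleCat ℚ)

lemma SCF_obj (X : Type) [TopologicalSpace X] : SCF.obj (TopCat.of X) = singularChainComplex X := rfl

def SCF_homotopy {X Y : TopCat.{0}} {f g : X ⟶ Y} (H : TopCat.Homotopy f g) :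
    _root_.Homotopy (SCF.map f) (SCF.map g) :=
  (H.toSSet.toSimplicialObjectHomotopy.whiskerRight (ModuleCat.free ℚ)).toChainHomotopy

def SCF_equiv {X Y : Type} [TopologicalSpace X] [TopologicalSpace Y]
    (e : ContinuousMap.HomotopyEquiv X Y) : HomotopyEquiv (SCF.obj (TopCat.of X)) (SCF.obj (TopCat.of Y)) where
  hom := SCF.map (TopCat.ofHom e.toFun)
  inv := SCF.map (TopCat.ofHom e.invFun)
  homotopyHomInvId := (Homotopy.ofEq (SCF.map_comp _ _).symm).trans
    ((SCF_homotopy (f := TopCat.ofHom e.toFun ≫ TopCat.ofHom e.invFun) (g := 𝟙 _)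
      (Classical.choice e.left_inv)).trans (Homotopy.ofEq (SCF.map_id _)))
  homotopyInvHomId := (Homotopy.ofEq (SCF.map_comp _ _).symm).trans
    ((SCF_homotopy (f := TopCat.ofHom e.invFun ≫ TopCat.ofHom e.toFun) (g := 𝟙 _)
      (Classical.choice e.right_inv)).trans (Homotopy.ofEq (SCF.map_id _)))

lemma FT_hequiv {X Y : Type} [TopologicalSpace X] [TopologicalSpace Y]
    (e : ContinuousMap.HomotopyEquiv X Y) (h : FT X) : FT Y ∧ eulerChar Y = eulerChar X :=
  HFT_congr (fun q => (SCF_equiv e).toHomologyIso q) h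

lemma FT_homeo {X Y : Type} [TopologicalSpace X] [TopologicalSpace Y]
    (e : X ≃ₜ Y) (h : FT X) : FT Y ∧ eulerChar Y = eulerChar X :=
  FT_hequiv e.toHomotopyEquiv h

def SC_const (X : Type) [TopologicalSpace X] [TotallyDisconnectedSpace X] :
    singularChainComplex X ≅ ChainComplex.alternatingConst.obj ((ModuleCat.free ℚ).obj X) :=
  (AlgebraicTopology.alternatingFaceMapComplex _).mapIso
    (((SimplicialObject.whiskering _ _).obj _).mapIso
    (TopCat.toSSetIsoConst (TopCat.of X)) ≪≫ Functor.constComp _ _ _) ≪≫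
    AlgebraicTopology.alternatingFaceMapComplexConst.app _

lemma FT_disc (X : Type) [TopologicalSpace X] [TotallyDisconnectedSpace X] [Finite X] :
    FT X ∧ eulerChar X = Nat.card X := by
  have h0 : ∀ q, 1 ≤ q → Subsingleton ((singularChainComplex X).homology q) := fun q hq => by
    have : (singularChainComplex X).ExactAt q :=
      .of_iso (ChainComplex.alternatingConst_exactAt _ _ (by omega)) (SC_const X).symm
    exact (ModuleCat.isZero_iff_subsingleton (R := ℚ)).1 this.isZero_homology
  have e : (singularChainComplex X).homology 0 ≅ (ModuleCat.free ℚ).obj X :=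
    (HomologicalComplex.homologyFunctor _ _ 0).mapIso (SC_const X) ≪≫
    ChainComplex.alternatingConstHomologyZero _
  have e' : (singularChainComplex X).homology 0 ≃ₗ[ℚ] (X →₀ ℚ) := e.toLinearEquiv
  have hr : ∀ q, 1 ≤ q → Module.finrank ℚ ((singularChainComplex X).homology q) = 0 := fun q hq => by
    have := h0 q hq
    exact Module.finrank_zero_of_subsingleton
  refine ⟨⟨fun q => ?_, 1, hr⟩, ?_⟩
  · rcases q with _ | q
    · exact Module.Finite.equiv e'.symm
    · have := h0 (q+1) (by omega)
      infer_instance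
  · rw [eulerChar_eq]
    unfold hchi
    rw [gchi_eq (N := 1) hr]
    have := Fintype.ofFinite X
    simp [e'.finrank_eq]

lemma FT_empty (X : Type) [TopologicalSpace X] [IsEmpty X] : FT X ∧ eulerChar X = 0 := by
  have := FT_disc X
  simpa using this

lemma FT_point (X : Type) [TopologicalSpace X] [Unique X] : FT X ∧ eulerChar X = 1 := by
  have := FT_disc X
  simpa using this

end OT
end
end

section
open CategoryTheory AlgebraicTopology

noncomputable section
namespace OT

lemma succAbove_rel {n : ℕ} (i j : Fin (n+2)) (h : i ≤ j) (k : Fin (n+1)) :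
    j.succ.succAbove (i.succAbove k) = i.castSucc.succAbove (j.succAbove k) := by
  rcases i with ⟨i, _⟩
  rcases j with ⟨j, _⟩
  rcases k with ⟨k, _⟩
  simp only [Fin.succAbove, Fin.lt_def, Fin.le_def] at *
  ext
  split_ifs <;> simp at * <;> lia

/-- semisimplicial sets -/
structure SST where
  Y : ℕ → Type
  δ : ∀ n, Fin (n+2) → Y (n+1) → Y n
  rel : ∀ n (i j : Fin (n+2)), i ≤ j → ∀ y : Y (n+2),
    δ n i (δ (n+1) j.succ y) = δ n j (δ (n+1) i.castSucc y)

namespace SST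
variable (S : SST)

/-- boundary -/
def d (n : ℕ) : (S.Y (n+1) →₀ ℚ) →ₗ[ℚ] (S.Y n →₀ ℚ) :=
  ∑ i : Fin (n+2), ((-1 : ℚ) ^ (i : ℕ)) • Finsupp.lmapDomain ℚ ℚ (S.δ n i)

lemma d_single (n : ℕ) (y : S.Y (n+1)) (r : ℚ) :
    S.d n (Finsupp.single y r) = ∑ i : Fin (n+2), ((-1 : ℚ) ^ (i : ℕ)) • Finsupp.single (S.δ n i y) r := by
  simp [d, LinearMap.sum_apply, Finsupp.mapDomain_single]

lemma dd (n : ℕ) : S.d n ∘ₗ S.d (n+1) = 0 := by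
  unfold d
  have e : ∀ (A : Fin (n+2) → ((S.Y (n+1) →₀ ℚ) →ₗ[ℚ] (S.Y n →₀ ℚ)))
      (B : Fin (n+3) → ((S.Y (n+2) →₀ ℚ) →ₗ[ℚ] (S.Y (n+1) →₀ ℚ))),
      (∑ i, A i) ∘ₗ (∑ j, B j) = ∑ j, ∑ i, A i ∘ₗ B j := by
    intro A B
    apply LinearMap.ext
    intro c
    simp only [LinearMap.comp_apply, LinearMap.sum_apply, map_sum]
  rw [e, ← Finset.sum_product']
  let P := Fin (n + 3) × Fin (n + 2)
  let S' : Finset P := {ij : P | (ij.1 : ℕ) ≤ (ij.2 : ℕ)}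
  rw [Finset.univ_product_univ, ← Finset.sum_add_sum_compl S', ← eq_neg_iff_add_eq_zero,
    ← Finset.sum_neg_distrib]
  let φ : ∀ ij : P, ij ∈ S' → P := fun ij hij =>
    (ij.2.succ, Fin.castLT ij.1 (lt_of_le_of_lt (Finset.mem_filter.mp hij).right (Fin.is_lt ij.2)))
  apply Finset.sum_bij φ
  · intro ij hij
    simp_rw [S', φ, Finset.compl_filter, Finset.mem_filter_univ, Fin.val_succ,
      Fin.val_castLT] at hij ⊢
    lia
  · rintro ⟨i, j⟩ hij ⟨i', j'⟩ hij' h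
    have h1 : ((j.succ : Fin (n+3)) : ℕ) = (j'.succ : Fin (n+3)) := congrArg (fun p : P => (p.1 : ℕ)) h
    have h2 : (i : ℕ) = i' := congrArg (fun p : P => (p.2 : ℕ)) h
    simp only [Fin.val_succ] at h1
    rw [Prod.mk_inj]
    exact ⟨Fin.ext h2, Fin.ext (by omega)⟩
  · rintro ⟨i', j'⟩ hij'
    simp_rw [S', Finset.compl_filter, Finset.mem_filter_univ, not_le] at hij'
    refine ⟨(Fin.castSucc j', i'.pred <| ?_), ?_, ?_⟩
    · rintro rfl
      simp only [Fin.val_zero, not_lt_zero] at hij'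
    · simp only [S', Finset.mem_filter_univ, Fin.val_castSucc, Fin.val_pred]
      omega
    · simp only [φ, Fin.castLT_castSucc, Fin.succ_pred]
  · rintro ⟨i, j⟩ hij
    simp only [S', Finset.mem_filter_univ] at hij
    obtain ⟨i', rfl⟩ : ∃ i' : Fin (n+2), i = i'.castSucc :=
      ⟨⟨i, by omega⟩, rfl⟩
    simp only [φ, Fin.castLT_castSucc, Fin.val_castSucc, Fin.val_succ]
    apply Finsupp.lhom_ext
    intro y r
    simp only [LinearMap.comp_apply, LinearMap.smul_apply, Finsupp.lmapDomain_apply,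
      Finsupp.mapDomain_single, map_smul, LinearMap.neg_apply, smul_smul]
    rw [S.rel n i' j (by simpa using hij) y, ← neg_smul]
    congr 1
    ring

lemma dd_apply (n : ℕ) (c) : S.d n (S.d (n+1) c) = 0 := by
  have := congrArg (fun f => f c) (S.dd n)
  simpa using this

/-- map of chains -/
lemma d_map {S S' : SST} (f : ∀ n, S.Y n → S'.Y n)
    (hf : ∀ n i y, f n (S.δ n i y) = S'.δ n i (f (n+1) y)) (n : ℕ) (c) :
    S'.d n (Finsupp.mapDomain (f (n+1)) c) = Finsupp.mapDomain (f n) (S.d n c) := by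
  induction c using Finsupp.induction_linear with
  | zero => simp
  | add a b ha hb => simp only [Finsupp.mapDomain_add, map_add, ha, hb]
  | single y r =>
    simp only [Finsupp.mapDomain_single, d_single, Finsupp.mapDomain_finsetSum,
      Finsupp.mapDomain_smul, hf]
end SST

/-- tuples of points -/
def TU (P : Type) : SST where
  Y n := Fin (n+1) → P
  δ n i w := fun k => w (i.succAbove k)
  rel n i j h y := by
    funext k
    simp only [succAbove_rel i j h k]

section sd
variable {P : Type}

abbrev LC (P : Type) (n : ℕ) := (Fin (n+1) → P) →₀ ℚ

def bd (n : ℕ) : LC P (n+1) →ₗ[ℚ] LC P n := (TU P).d n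

lemma bd_single (n : ℕ) (w : Fin (n+2) → P) (r : ℚ) : bd n (Finsupp.single w r) =
    ∑ i : Fin (n+2), ((-1 : ℚ) ^ (i : ℕ)) • Finsupp.single (fun k => w (i.succAbove k)) r :=
  (TU P).d_single n w r

lemma bd_bd (n : ℕ) (c : LC P (n+2)) : bd n (bd (n+1) c) = 0 := (TU P).dd_apply n c

def cone (b : P) (n : ℕ) : LC P n →ₗ[ℚ] LC P (n+1) :=
  Finsupp.lmapDomain ℚ ℚ (fun w => Fin.cons (α := fun _ => P) b w)

lemma cone_single (b : P) (n : ℕ) (w : Fin (n+1) → P) (r : ℚ) :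
    cone b n (Finsupp.single w r) = Finsupp.single (Fin.cons (α := fun _ => P) b w) r := by
  simp [cone, Finsupp.mapDomain_single]

lemma bd_cone (b : P) (n : ℕ) (c : LC P (n+1)) :
    bd (n+1) (cone b (n+1) c) = c - cone b n (bd n c) := by
  induction c using Finsupp.induction_linear with
  | zero => simp
  | add a b ha hb => simp only [map_add, ha, hb]; abel
  | single y r =>
    rw [cone_single, bd_single, Fin.sum_univ_succ, bd_single, map_sum, sub_eq_add_neg,
      ← Finset.sum_neg_distrib]
    congr 1
    · simp
    · refine Finset.sum_congr rfl fun i _ => ?_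
      rw [map_smul, cone_single, Fin.val_succ, pow_succ, mul_neg_one, neg_smul]
      congr 3
      funext k
      refine Fin.cases ?_ (fun k => ?_) k
      · simp
      · simp

lemma bd_cone_zero (b : P) (c : LC P 0) :
    bd 0 (cone b 0 c) = c - (c.sum fun _ r => r) • Finsupp.single (fun _ => b) 1 := by
  induction c using Finsupp.induction_linear with
  | zero => simp
  | add a b ha hb =>
    rw [Finsupp.sum_add_index' (by simp) (by simp)]
    simp only [map_add, ha, hb, add_smul]; abel
  | single y r =>
    rw [cone_single, bd_single, Fin.sum_univ_two]
    simp only [Fin.val_zero, pow_zero, one_smul, Fin.val_one, pow_one, neg_smul]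
    rw [Finsupp.sum_single_index rfl, Finsupp.smul_single, smul_eq_mul, mul_one, sub_eq_add_neg]
    congr 3
    funext k
    have : k = 0 := Fin.fin_one_eq_zero k
    subst this
    simp

lemma aug_bd (c : LC P 1) : ((bd 0 c).sum fun _ r => r) = 0 := by
  induction c using Finsupp.induction_linear with
  | zero => simp
  | add a b ha hb =>
    rw [map_add, Finsupp.sum_add_index' (by simp) (by simp), ha, hb, add_zero]
  | single y r =>
    rw [bd_single, Fin.sum_univ_two]
    rw [Finsupp.sum_add_index' (by simp) (by simp)]
    simp [Finsupp.sum_single_index, ← Finsupp.single_neg]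

variable (bary : ∀ n, (Fin (n+1) → P) → P)

def Sd : ∀ n, LC P n →ₗ[ℚ] LC P n
  | 0 => LinearMap.id
  | n+1 => Finsupp.lsum ℚ fun w => LinearMap.toSpanSingleton ℚ _
      (cone (bary (n+1) w) n (Sd n (bd n (Finsupp.single w 1))))

def Tt : ∀ n, LC P n →ₗ[ℚ] LC P (n+1)
  | 0 => 0
  | n+1 => Finsupp.lsum ℚ fun w => LinearMap.toSpanSingleton ℚ _
      (cone (bary (n+1) w) (n+1) (Finsupp.single w 1 - Tt n (bd n (Finsupp.single w 1))))

lemma Sd_single (n : ℕ) (w : Fin (n+2) → P) : Sd bary (n+1) (Finsupp.single w 1) =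
    cone (bary (n+1) w) n (Sd bary n (bd n (Finsupp.single w 1))) := by
  simp [Sd]

lemma Tt_single (n : ℕ) (w : Fin (n+2) → P) : Tt bary (n+1) (Finsupp.single w 1) =
    cone (bary (n+1) w) (n+1) (Finsupp.single w 1 - Tt bary n (bd n (Finsupp.single w 1))) := by
  simp [Tt]

lemma ext1 {Y M : Type} [AddCommGroup M] [Module ℚ M] {f g : (Y →₀ ℚ) →ₗ[ℚ] M}
    (h : ∀ y, f (Finsupp.single y 1) = g (Finsupp.single y 1)) : f = g := by
  apply Finsupp.lhom_ext'
  intro y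
  apply LinearMap.ext_ring
  exact h y

lemma bd_Sd (n : ℕ) : bd n ∘ₗ Sd bary (n+1) = Sd bary n ∘ₗ bd n := by
  induction n with
  | zero =>
    refine ext1 fun w => ?_
    simp only [LinearMap.comp_apply, Sd_single]
    rw [bd_cone_zero]
    simp only [Sd, LinearMap.id_apply, aug_bd, zero_smul, sub_zero]
  | succ n ih =>
    refine ext1 fun w => ?_
    simp only [LinearMap.comp_apply, Sd_single]
    rw [bd_cone]
    have := congrArg (fun f => f (bd (n+1) (Finsupp.single w 1))) ih
    simp only [LinearMap.comp_apply] at this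
    rw [this, bd_bd]
    simp

lemma bd_Tt (n : ℕ) (c : LC P (n+1)) :
    bd (n+1) (Tt bary (n+1) c) + Tt bary n (bd n c) = c - Sd bary (n+1) c := by
  induction n with
  | zero =>
    suffices h : bd 1 ∘ₗ Tt bary 1 = LinearMap.id - Sd bary 1 by
      have := congrArg (fun f => f c) h
      simpa [Tt] using this
    refine ext1 fun w => ?_
    simp only [LinearMap.comp_apply, Tt_single, LinearMap.sub_apply, Sd_single, LinearMap.id_apply]
    simp only [Tt, LinearMap.zero_apply, sub_zero, Sd, LinearMap.id_apply]
    rw [bd_cone]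
  | succ n ih =>
    suffices h : bd (n+2) ∘ₗ Tt bary (n+2) + Tt bary (n+1) ∘ₗ bd (n+1) = LinearMap.id - Sd bary (n+2) by
      have := congrArg (fun f => f c) h
      simpa using this
    refine ext1 fun w => ?_
    simp only [LinearMap.comp_apply, Tt_single, LinearMap.sub_apply, Sd_single, LinearMap.id_apply,
      LinearMap.add_apply]
    rw [bd_cone]
    have := ih (bd (n+1) (Finsupp.single w 1))
    rw [bd_bd, map_zero, add_zero] at this
    rw [map_sub (bd (n+1)), this]
    simp only [sub_sub_cancel]
    abel

variable {P' : Type} (bary' : ∀ n, (Fin (n+1) → P') → P') (φ : P → P')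

def pushL (n : ℕ) : LC P n →ₗ[ℚ] LC P' n := Finsupp.lmapDomain ℚ ℚ (fun w => φ ∘ w)

lemma pushL_single (n : ℕ) (w : Fin (n+1) → P) (r : ℚ) :
    pushL φ n (Finsupp.single w r) = Finsupp.single (φ ∘ w) r := by
  simp [pushL, Finsupp.mapDomain_single]

lemma pushL_bd (n : ℕ) (c : LC P (n+1)) : bd n (pushL φ (n+1) c) = pushL φ n (bd n c) :=
  SST.d_map (S := TU P) (S' := TU P') (fun n w => φ ∘ w) (fun _ _ _ => rfl) n c

lemma pushL_cone (b : P) (n : ℕ) (c : LC P n) :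
    pushL φ (n+1) (cone b n c) = cone (φ b) n (pushL φ n c) := by
  induction c using Finsupp.induction_linear with
  | zero => simp
  | add a b ha hb => simp only [map_add, ha, hb]
  | single y r =>
    rw [cone_single, pushL_single, pushL_single, cone_single]
    congr 1
    funext k
    refine Fin.cases ?_ (fun k => ?_) k <;> simp

variable {bary bary' φ}
lemma pushL_Sd (hφ : ∀ n w, φ (bary n w) = bary' n (φ ∘ w)) (n : ℕ) (c : LC P n) :
    pushL φ n (Sd bary n c) = Sd bary' n (pushL φ n c) := by
  induction n with
  | zero => rfl
  | succ n ih =>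
    suffices h : pushL φ (n+1) ∘ₗ Sd bary (n+1) = Sd bary' (n+1) ∘ₗ pushL φ (n+1) from
      congrArg (fun f => f c) h
    refine ext1 fun w => ?_
    simp only [LinearMap.comp_apply, Sd_single, pushL_cone, pushL_single, ih, hφ, ← pushL_bd]

lemma pushL_Tt (hφ : ∀ n w, φ (bary n w) = bary' n (φ ∘ w)) (n : ℕ) (c : LC P n) :
    pushL φ (n+1) (Tt bary n c) = Tt bary' n (pushL φ n c) := by
  induction n with
  | zero => simp [Tt]
  | succ n ih =>
    suffices h : pushL φ (n+2) ∘ₗ Tt bary (n+1) = Tt bary' (n+1) ∘ₗ pushL φ (n+1) from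
      congrArg (fun f => f c) h
    refine ext1 fun w => ?_
    simp only [LinearMap.comp_apply, Tt_single, pushL_cone, pushL_single, map_sub, ih, hφ, ← pushL_bd]
end sd

end OT
end
end

section
open CategoryTheory AlgebraicTopology

noncomputable section
namespace OT

abbrev Dl (n : ℕ) : Type := stdSimplex ℝ (Fin (n+1))

/-- affine combination of points of a simplex -/
def comb {n m : ℕ} (w : Fin (n+1) → Dl m) : C(Dl n, Dl m) where
  toFun t := ⟨∑ i, t.1 i • (w i).1, by
    refine (convex_stdSimplex ℝ (Fin (m+1))).sum_mem (fun i _ => t.2.1 i) t.2.2 fun i _ => (w i).2⟩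
  continuous_toFun := by
    refine Continuous.subtype_mk ?_ _
    refine continuous_finsetSum _ fun i _ => ?_
    exact ((continuous_apply i).comp continuous_subtype_val).smul continuous_const

lemma comb_val {n m : ℕ} (w : Fin (n+1) → Dl m) (t : Dl n) :
    (comb w t).1 = ∑ i, t.1 i • (w i).1 := rfl

lemma comb_comb {n m k : ℕ} (w : Fin (n+1) → Dl m) (v : Fin (k+1) → Dl n) (t : Dl k) :
    comb w (comb v t) = comb (comb w ∘ v) t := by
  apply Subtype.ext
  simp only [comb_val, Function.comp]
  simp only [Finset.sum_apply, Pi.smul_apply, Finset.sum_smul, Finset.smul_sum, smul_smul, smul_eq_mul]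
  rw [Finset.sum_comm]

def vtx (n : ℕ) : Fin (n+1) → Dl n := fun i => ⟨Pi.single i 1, single_mem_stdSimplex ℝ i⟩

lemma comb_vtx_apply {n m : ℕ} (w : Fin (n+1) → Dl m) (i : Fin (n+1)) : comb w (vtx n i) = w i := by
  apply Subtype.ext
  rw [comb_val]
  simp only [vtx]
  rw [Finset.sum_eq_single i]
  · simp
  · intro j _ hj
    simp [hj]
  · simp

lemma comb_vtx_self (n : ℕ) (t : Dl n) : comb (vtx n) t = t := by
  apply Subtype.ext
  rw [comb_val]
  funext k
  simp only [vtx, Finset.sum_apply, Pi.smul_apply, Pi.single_apply, smul_eq_mul]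
  simp

/-- face inclusions -/
def fm {n m : ℕ} (f : Fin (n+1) → Fin (m+1)) : C(Dl n, Dl m) := ⟨stdSimplex.map f, stdSimplex.continuous_map f⟩

lemma fm_eq {n m : ℕ} (f : Fin (n+1) → Fin (m+1)) : fm f = comb (fun k => vtx m (f k)) := by
  ext1 t
  apply Subtype.ext
  rw [comb_val]
  funext k
  change FunOnFinite.linearMap ℝ ℝ f t k = _
  rw [FunOnFinite.linearMap_apply_apply]
  simp only [vtx, Finset.sum_apply, Pi.smul_apply, Pi.single_apply, smul_eq_mul, mul_ite, mul_one, mul_zero]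
  rw [← Finset.sum_filter]
  refine Finset.sum_congr ?_ fun _ _ => rfl
  ext; simp [eq_comm]

lemma fm_comp {n m k : ℕ} (g : Fin (m+1) → Fin (k+1)) (f : Fin (n+1) → Fin (m+1)) :
    (fm g).comp (fm f) = fm (g ∘ f) := by
  ext1 t
  exact stdSimplex.map_comp_apply f g t

/-- singular simplices -/
def SI (X : Type) [TopologicalSpace X] : SST where
  Y n := C(Dl n, X)
  δ n i σ := σ.comp (fm i.succAbove)
  rel n i j h σ := by
    simp only [ContinuousMap.comp_assoc, fm_comp]
    congr 2
    funext k
    exact succAbove_rel i j h k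

section
variable {X : Type} [TopologicalSpace X]

abbrev SCh (X : Type) [TopologicalSpace X] (n : ℕ) := C(Dl n, X) →₀ ℚ

def dX (n : ℕ) : SCh X (n+1) →ₗ[ℚ] SCh X n := (SI X).d n

def unif (n : ℕ) : Dl n := ⟨fun _ => (1 : ℝ)/(n+1), fun _ => by positivity, by
  simp; field_simp⟩

def bary (m n : ℕ) (w : Fin (n+1) → Dl m) : Dl m := comb w (unif n)

/-- realize a linear chain in a simplex and push forward by `σ` -/
def rl {m : ℕ} (σ : C(Dl m, X)) (n : ℕ) : LC (Dl m) n →ₗ[ℚ] SCh X n :=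
  Finsupp.lmapDomain ℚ ℚ (fun w => σ.comp (comb w))

lemma rl_single {m : ℕ} (σ : C(Dl m, X)) (n : ℕ) (w : Fin (n+1) → Dl m) (r : ℚ) :
    rl σ n (Finsupp.single w r) = Finsupp.single (σ.comp (comb w)) r := by
  simp [rl, Finsupp.mapDomain_single]

lemma rl_bd {m : ℕ} (σ : C(Dl m, X)) (n : ℕ) (c : LC (Dl m) (n+1)) :
    dX n (rl σ (n+1) c) = rl σ n (bd n c) := by
  refine SST.d_map (S := TU (Dl m)) (S' := SI X) (fun n w => σ.comp (comb w)) ?_ n c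
  intro n i (w : Fin (n+2) → Dl m)
  change σ.comp (comb (fun k => w (i.succAbove k))) = (σ.comp (comb w)).comp (fm i.succAbove)
  rw [fm_eq, ContinuousMap.comp_assoc]
  congr 1
  ext1 t
  rw [ContinuousMap.comp_apply, comb_comb]
  congr 2
  funext k
  simp [comb_vtx_apply]

lemma rl_push {m k : ℕ} (σ : C(Dl m, X)) (w : Fin (k+1) → Dl m) (n : ℕ) (c : LC (Dl k) n) :
    rl (σ.comp (comb w)) n c = rl σ n (pushL (comb w) n c) := by
  induction c using Finsupp.induction_linear with
  | zero => simp
  | add a b ha hb => simp only [map_add, ha, hb]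
  | single y r =>
    rw [pushL_single, rl_single, rl_single, ContinuousMap.comp_assoc]
    congr 2
    ext1 t
    rw [ContinuousMap.comp_apply, comb_comb]

lemma comb_bary {m k : ℕ} (w : Fin (k+1) → Dl m) (n : ℕ) (v : Fin (n+1) → Dl k) :
    comb w (bary k n v) = bary m n (comb w ∘ v) := comb_comb _ _ _

def SX (n : ℕ) : SCh X n →ₗ[ℚ] SCh X n :=
  Finsupp.lsum ℚ fun σ => LinearMap.toSpanSingleton ℚ _
      (rl σ n (Sd (bary n) n (Finsupp.single (vtx n) 1)))
def TX (n : ℕ) : SCh X n →ₗ[ℚ] SCh X (n+1) :=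
  Finsupp.lsum ℚ fun σ => LinearMap.toSpanSingleton ℚ _
      (rl σ (n+1) (Tt (bary n) n (Finsupp.single (vtx n) 1)))

lemma SX_single (n : ℕ) (σ : C(Dl n, X)) : SX n (Finsupp.single σ 1) =
    rl σ n (Sd (bary n) n (Finsupp.single (vtx n) 1)) := by simp [SX]
lemma TX_single (n : ℕ) (σ : C(Dl n, X)) : TX n (Finsupp.single σ 1) =
    rl σ (n+1) (Tt (bary n) n (Finsupp.single (vtx n) 1)) := by simp [TX]

lemma comb_comp_vtx {n m : ℕ} (w : Fin (n+1) → Dl m) : comb w ∘ vtx n = w :=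
  funext fun i => comb_vtx_apply w i

lemma SX_rl {m : ℕ} (σ : C(Dl m, X)) (n : ℕ) (c : LC (Dl m) n) :
    SX n (rl σ n c) = rl σ n (Sd (bary m) n c) := by
  suffices h : SX n ∘ₗ (rl σ n) = rl σ n ∘ₗ Sd (bary m) n from congrArg (fun f => f c) h
  refine ext1 fun w => ?_
  simp only [LinearMap.comp_apply, rl_single, SX_single]
  rw [rl_push, pushL_Sd (bary' := bary m) (comb_bary w), pushL_single, comb_comp_vtx]

lemma TX_rl {m : ℕ} (σ : C(Dl m, X)) (n : ℕ) (c : LC (Dl m) n) :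
    TX n (rl σ n c) = rl σ (n+1) (Tt (bary m) n c) := by
  suffices h : TX n ∘ₗ (rl σ n) = rl σ (n+1) ∘ₗ Tt (bary m) n from congrArg (fun f => f c) h
  refine ext1 fun w => ?_
  simp only [LinearMap.comp_apply, rl_single, TX_single]
  rw [rl_push, pushL_Tt (bary' := bary m) (comb_bary w), pushL_single, comb_comp_vtx]

lemma single_eq_rl (n : ℕ) (σ : C(Dl n, X)) :
    (Finsupp.single σ 1 : SCh X n) = rl σ n (Finsupp.single (vtx n) 1) := by
  rw [rl_single]
  congr 1
  ext1 t
  rw [ContinuousMap.comp_apply, comb_vtx_self]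

lemma dX_SX (n : ℕ) (c : SCh X (n+1)) : dX n (SX (n+1) c) = SX n (dX n c) := by
  suffices h : dX n ∘ₗ SX (n+1) = SX (X := X) n ∘ₗ dX n from congrArg (fun f => f c) h
  refine ext1 fun σ => ?_
  simp only [LinearMap.comp_apply]
  rw [single_eq_rl, SX_rl, rl_bd, rl_bd, SX_rl]
  have := congrArg (fun f => f (Finsupp.single (vtx (n+1)) 1)) (bd_Sd (bary (n+1)) n)
  simp only [LinearMap.comp_apply] at this
  rw [this]

lemma dX_TX (n : ℕ) (c : SCh X (n+1)) :
    dX (n+1) (TX (n+1) c) + TX n (dX n c) = c - SX (n+1) c := by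
  suffices h : dX (n+1) ∘ₗ TX (n+1) + TX (X := X) n ∘ₗ dX n = LinearMap.id - SX (n+1) from
    congrArg (fun f => f c) h
  refine ext1 fun σ => ?_
  simp only [LinearMap.comp_apply, LinearMap.add_apply, LinearMap.sub_apply, LinearMap.id_apply]
  rw [single_eq_rl, TX_rl, rl_bd, rl_bd, TX_rl, SX_rl, ← map_add, ← map_sub, bd_Tt]

lemma SX_zero (c : SCh X 0) : SX 0 c = c := by
  suffices h : SX (X := X) 0 = LinearMap.id from congrArg (fun f => f c) h
  refine ext1 fun σ => ?_
  rw [single_eq_rl, SX_rl]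
  rfl

end
end OT
end
end

section
open CategoryTheory AlgebraicTopology

noncomputable section
namespace OT

lemma map_supp {α β : Type} {f : α → β} {s : Set α} {t : Set β} (h : ∀ a ∈ s, f a ∈ t) {c : α →₀ ℚ}
    (hc : c ∈ Finsupp.supported ℚ ℚ s) : Finsupp.mapDomain f c ∈ Finsupp.supported ℚ ℚ t := by
  classical
  rw [Finsupp.mem_supported] at hc ⊢
  intro b hb
  obtain ⟨a, ha, rfl⟩ := Finset.mem_image.1 (Finsupp.mapDomain_support hb)
  exact h a (hc ha)

/-- a linear map sends chains supported in `s` to `W` -/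
lemma lin_supp {α M : Type} [AddCommGroup M] [Module ℚ M] (f : (α →₀ ℚ) →ₗ[ℚ] M) {s : Set α}
    {W : Submodule ℚ M} (h : ∀ a ∈ s, f (Finsupp.single a 1) ∈ W) {c : α →₀ ℚ}
    (hc : c ∈ Finsupp.supported ℚ ℚ s) : f c ∈ W := by
  rw [Finsupp.supported_eq_span_single] at hc
  induction hc using Submodule.span_induction with
  | mem x hx => obtain ⟨a, ha, rfl⟩ := hx; exact h a ha
  | zero => simp
  | add x y _ _ hx hy => rw [map_add]; exact W.add_mem hx hy
  | smul r x _ hx => rw [map_smul]; exact W.smul_mem _ hx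

section diam
variable {m : ℕ}

lemma dist_comb_le {n : ℕ} (w : Fin (n+1) → Dl m) (t : Dl n) (p : Dl m) {R : ℝ}
    (h : ∀ i, dist (w i) p ≤ R) : dist (comb w t) p ≤ R := by
  have hc := (convex_closedBall (p.1) R)
  have : (comb w t).1 ∈ Metric.closedBall p.1 R := by
    rw [comb_val]
    exact hc.sum_mem (fun i _ => t.2.1 i) t.2.2 fun i _ => h i
  exact this

lemma dist_bary_le {n : ℕ} (w : Fin (n+1) → Dl m) {D : ℝ} (h : ∀ i j, dist (w i) (w j) ≤ D)
    (k : Fin (n+1)) : dist (bary m n w) (w k) ≤ n/(n+1) * D := by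
  have h1 : dist (bary m n w) (w k) = ‖∑ i, ((1:ℝ)/(n+1)) • ((w i).1 - (w k).1)‖ := by
    change dist (comb w (unif n)).1 (w k).1 = _
    rw [dist_eq_norm, comb_val]
    congr 1
    simp only [unif, smul_sub, Finset.sum_sub_distrib]
    congr 1
    rw [Finset.sum_const, Finset.card_univ, Fintype.card_fin, ← Nat.cast_smul_eq_nsmul ℝ, smul_smul]
    push_cast
    rw [mul_one_div_cancel (by positivity), one_smul]
  rw [h1]
  calc _ ≤ ∑ i, ‖((1:ℝ)/(n+1)) • ((w i).1 - (w k).1)‖ := norm_sum_le _ _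
    _ ≤ ∑ i, (if i = k then 0 else (1/(n+1)) * D) := by
      refine Finset.sum_le_sum fun i _ => ?_
      split_ifs with hi
      · simp [hi]
      · rw [norm_smul, Real.norm_of_nonneg (by positivity), ← dist_eq_norm]
        gcongr
        exact h i k
    _ = _ := by
      rw [Finset.sum_ite, Finset.sum_const_zero, zero_add, Finset.sum_const, nsmul_eq_mul,
        Finset.filter_not, Finset.filter_eq', if_pos (Finset.mem_univ _), Finset.card_sdiff]
      simp
      ring

lemma range_comb_sub {n k : ℕ} (w : Fin (n+1) → Dl m) (v : Fin (k+1) → Dl m)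
    (h : ∀ i, v i ∈ Set.range (comb w)) : Set.range (comb v) ⊆ Set.range (comb w) := by
  choose t ht using h
  rintro _ ⟨s, rfl⟩
  refine ⟨comb t s, ?_⟩
  rw [comb_comb]
  congr 2
  funext i
  exact ht i

def Fine {n : ℕ} (w : Fin (n+1) → Dl m) (D : ℝ) : Set (Fin (n+1) → Dl m) :=
  {v | (∀ i j, dist (v i) (v j) ≤ D) ∧ ∀ i, v i ∈ Set.range (comb w)}

lemma Sd_fine (n : ℕ) : ∀ (w : Fin (n+1) → Dl m) (D : ℝ), (∀ i j, dist (w i) (w j) ≤ D) →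
    Sd (bary m) n (Finsupp.single w 1) ∈ Finsupp.supported ℚ ℚ (Fine w (n/(n+1)*D)) := by
  induction n with
  | zero =>
    intro w D h
    refine Finsupp.single_mem_supported ℚ 1 ⟨fun i j => ?_, fun i => ⟨vtx 0 i, comb_vtx_apply w i⟩⟩
    rw [Fin.fin_one_eq_zero i, Fin.fin_one_eq_zero j]
    simp
  | succ n ih =>
    intro w D h
    have hD : 0 ≤ D := dist_nonneg.trans (h 0 0)
    rw [Sd_single, bd_single, map_sum, map_sum]
    refine Submodule.sum_mem _ fun i _ => ?_
    rw [map_smul, map_smul]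
    refine Submodule.smul_mem _ _ ?_
    have h2 := ih (fun k => w (i.succAbove k)) D (fun _ _ => h _ _)
    refine map_supp ?_ h2
    rintro v ⟨hv1, hv2⟩
    have hv3 : ∀ k, v k ∈ Set.range (comb w) := by
      intro k
      refine range_comb_sub w (fun k => w (i.succAbove k)) ?_ (hv2 k)
      intro j
      exact ⟨vtx _ (i.succAbove j), comb_vtx_apply _ _⟩
    have hb : ∀ k, dist (bary m (n+1) w) (v k) ≤ (↑(n+1):ℝ)/(↑(n+1)+1) * D := by
      intro k
      obtain ⟨t, ht⟩ := hv3 k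
      rw [← ht, dist_comm]
      exact dist_comb_le w t _ fun j => by rw [dist_comm]; exact dist_bary_le w h j
    have hle : (n:ℝ)/(n+1) * D ≤ (↑(n+1):ℝ)/(↑(n+1)+1) * D := by
      gcongr ?_ * D
      rw [div_le_div_iff₀ (by positivity) (by positivity)]
      push_cast
      nlinarith
    refine ⟨fun a b => ?_, fun a => ?_⟩
    · refine Fin.cases ?_ (fun a => ?_) a <;> refine Fin.cases ?_ (fun b => ?_) b
      · simp; positivity
      · simpa using hb b
      · simpa [dist_comm] using hb a
      · simpa using (hv1 a b).trans hle
    · refine Fin.cases ?_ (fun a => ?_) a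
      · simp only [Fin.cons_zero]
        exact ⟨unif _, rfl⟩
      · simpa using hv3 a

lemma Sd_pow_fine (n k : ℕ) : ((Sd (bary n) n) ^ k) (Finsupp.single (vtx n) 1) ∈
    Finsupp.supported ℚ ℚ {v : Fin (n+1) → Dl n | ∀ i j, dist (v i) (v j) ≤ ((n:ℝ)/(n+1))^k} := by
  induction k with
  | zero =>
    refine Finsupp.single_mem_supported ℚ 1 ?_
    intro i j
    have := Metric.dist_le_diam_of_mem (bounded_stdSimplex (Fin (n+1))) (vtx n i).2 (vtx n j).2
    rw [pow_zero]; exact this.trans diam_stdSimplex_le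
  | succ k ih =>
    rw [pow_succ' (Sd (bary n) n), Module.End.mul_apply]
    refine lin_supp _ ?_ ih
    intro w hw
    refine Finsupp.supported_mono ?_ (Sd_fine n w _ hw)
    intro v hv
    rw [Set.mem_ofPred_eq, pow_succ']
    exact hv.1
end diam

section
variable {X : Type} [TopologicalSpace X]

/-- chains supported in `U` -/
def sup (U : Set X) (n : ℕ) : Submodule ℚ (SCh X n) :=
  Finsupp.supported ℚ ℚ {σ | Set.range σ ⊆ U}

lemma rl_mem {m : ℕ} {σ : C(Dl m, X)} {U : Set X} (h : Set.range σ ⊆ U) (n : ℕ) (c) :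
    rl σ n c ∈ sup U n := by
  refine map_supp (s := Set.univ) ?_ (by simp [Finsupp.mem_supported])
  rintro w -
  rintro _ ⟨t, rfl⟩
  exact h ⟨_, rfl⟩

lemma SX_mem {U : Set X} {n : ℕ} {c : SCh X n} (h : c ∈ sup U n) : SX n c ∈ sup U n :=
  lin_supp _ (fun σ hσ => by rw [SX_single]; exact rl_mem hσ _ _) h

lemma TX_mem {U : Set X} {n : ℕ} {c : SCh X n} (h : c ∈ sup U n) : TX n c ∈ sup U (n+1) :=
  lin_supp _ (fun σ hσ => by rw [TX_single]; exact rl_mem hσ _ _) h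

lemma dX_mem {U : Set X} {n : ℕ} {c : SCh X (n+1)} (h : c ∈ sup U (n+1)) : dX n c ∈ sup U n :=
  lin_supp _ (fun σ hσ => by rw [single_eq_rl, rl_bd]; exact rl_mem hσ _ _) h

def sml (U V : Set X) (n : ℕ) : Submodule ℚ (SCh X n) := sup U n ⊔ sup V n

lemma sml_map {U V : Set X} {n m : ℕ} {f : SCh X n →ₗ[ℚ] SCh X m}
    (h : ∀ W : Set X, ∀ c ∈ sup W n, f c ∈ sup W m) {c} (hc : c ∈ sml U V n) : f c ∈ sml U V m := by
  obtain ⟨a, ha, b, hb, rfl⟩ := Submodule.mem_sup.1 hc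
  rw [map_add]
  exact Submodule.add_mem_sup (h _ _ ha) (h _ _ hb)

variable {U V : Set X}

lemma SX_pow_rl {m : ℕ} (σ : C(Dl m, X)) (n k : ℕ) (c : LC (Dl m) n) :
    (SX n ^ k) (rl σ n c) = rl σ n ((Sd (bary m) n ^ k) c) := by
  induction k with
  | zero => rfl
  | succ k ih => rw [pow_succ', Module.End.mul_apply, ih, SX_rl, pow_succ', Module.End.mul_apply]

lemma SX_pow_mem {n : ℕ} {c : SCh X n} (h : c ∈ sml U V n) (k : ℕ) : (SX n ^ k) c ∈ sml U V n := by
  induction k with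
  | zero => exact h
  | succ k ih =>
    rw [pow_succ' (SX n), Module.End.mul_apply]
    exact sml_map (fun _ _ h => SX_mem h) ih

lemma small_single (hU : IsOpen U) (hV : IsOpen V) (hUV : U ∪ V = Set.univ) (n : ℕ) (σ : C(Dl n, X)) :
    ∃ k, (SX n ^ k) (Finsupp.single σ 1) ∈ sml U V n := by
  obtain ⟨δ, hδ, hL⟩ := lebesgue_number_lemma_of_metric (s := (Set.univ : Set (Dl n))) isCompact_univ
    (c := fun b : Bool => σ ⁻¹' (cond b U V))
    (fun b => by cases b
                 · exact hV.preimage σ.continuous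
                 · exact hU.preimage σ.continuous)
    (by
      intro x _
      have : σ x ∈ U ∪ V := hUV ▸ Set.mem_univ _
      rcases this with h | h
      · exact Set.mem_iUnion.2 ⟨true, h⟩
      · exact Set.mem_iUnion.2 ⟨false, h⟩)
  have hlt : (n:ℝ)/(n+1) < 1 := by
    rw [div_lt_one (by positivity)]; linarith
  obtain ⟨k, hk⟩ := exists_pow_lt_of_lt_one hδ hlt
  refine ⟨k, ?_⟩
  rw [single_eq_rl, SX_pow_rl]
  refine lin_supp (rl σ n) ?_ (Sd_pow_fine n k)
  intro v hv
  rw [rl_single]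
  have hr : Set.range (comb v) ⊆ Metric.ball (v 0) δ := by
    rintro _ ⟨t, rfl⟩
    exact (dist_comb_le v t (v 0) (fun i => hv i 0)).trans_lt hk
  obtain ⟨b, hb⟩ := hL (v 0) (Set.mem_univ _)
  have hfin : ∀ W : Set X, Metric.ball (v 0) δ ⊆ σ ⁻¹' W →
      (Finsupp.single (σ.comp (comb v)) 1 : SCh X n) ∈ sup W n := by
    intro W hW
    refine Finsupp.single_mem_supported ℚ 1 ?_
    rintro _ ⟨t, rfl⟩
    exact hW (hr ⟨t, rfl⟩)
  cases b
  · exact Submodule.mem_sup_right (hfin V hb)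
  · exact Submodule.mem_sup_left (hfin U hb)

lemma small_all (hU : IsOpen U) (hV : IsOpen V) (hUV : U ∪ V = Set.univ) (n : ℕ) (c : SCh X n) :
    ∃ k, (SX n ^ k) c ∈ sml U V n := by
  induction c using Finsupp.induction_linear with
  | zero => exact ⟨0, by simp⟩
  | add a b ha hb =>
    obtain ⟨k, hk⟩ := ha
    obtain ⟨l, hl⟩ := hb
    refine ⟨k + l, ?_⟩
    rw [map_add]
    refine Submodule.add_mem _ ?_ ?_
    · rw [add_comm k l, pow_add, Module.End.mul_apply]
      exact SX_pow_mem hk l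
    · rw [pow_add, Module.End.mul_apply]
      exact SX_pow_mem hl k
  | single σ r =>
    obtain ⟨k, hk⟩ := small_single hU hV hUV n σ
    refine ⟨k, ?_⟩
    have : (Finsupp.single σ r : SCh X n) = r • Finsupp.single σ 1 := by simp
    rw [this, map_smul]
    exact Submodule.smul_mem _ _ hk

/-- acyclicity of the quotient, positive degrees -/
lemma acyc_pow (n : ℕ) (k : ℕ) : ∀ c : SCh X (n+1), dX n c ∈ sml U V n →
    ∃ y, c - (SX (n+1) ^ k) c - dX (n+1) y ∈ sml U V (n+1) := by
  induction k with
  | zero => intro c _; exact ⟨0, by simp⟩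
  | succ k ih =>
    intro c hc
    obtain ⟨y, hy⟩ := ih (SX (n+1) c) (by
      rw [dX_SX]; exact sml_map (fun _ _ h => SX_mem h) hc)
    refine ⟨y + TX (n+1) c, ?_⟩
    have h1 := dX_TX n c
    have h2 : TX n (dX n c) ∈ sml U V (n+1) := sml_map (fun _ _ h => TX_mem h) hc
    have : c - (SX (n+1) ^ (k+1)) c - dX (n+1) (y + TX (n+1) c)
      = (SX (n+1) c - (SX (n+1) ^ k) (SX (n+1) c) - dX (n+1) y) + TX n (dX n c) := by
      rw [pow_succ, Module.End.mul_apply, map_add]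
      have h3 : dX (n+1) (TX (n+1) c) = c - SX (n+1) c - TX n (dX n c) := by
        rw [← h1]; abel
      rw [h3]; abel
    rw [this]
    exact Submodule.add_mem _ hy h2

lemma acyc_succ (hU : IsOpen U) (hV : IsOpen V) (hUV : U ∪ V = Set.univ) (n : ℕ) (c : SCh X (n+1))
    (hc : dX n c ∈ sml U V n) : ∃ y, c - dX (n+1) y ∈ sml U V (n+1) := by
  obtain ⟨k, hk⟩ := small_all hU hV hUV (n+1) c
  obtain ⟨y, hy⟩ := acyc_pow n k c hc
  refine ⟨y, ?_⟩
  have := Submodule.add_mem _ hy hk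
  convert this using 1
  abel

lemma acyc_zero (hU : IsOpen U) (hV : IsOpen V) (hUV : U ∪ V = Set.univ) (c : SCh X 0) :
    c ∈ sml U V 0 := by
  obtain ⟨k, hk⟩ := small_all hU hV hUV 0 c
  have : SX (X := X) 0 = 1 := LinearMap.ext SX_zero
  rw [this, one_pow] at hk
  exact hk
end
end OT
end
end

section
open CategoryTheory AlgebraicTopology

noncomputable section
namespace OT

/-- chain complex from linear maps -/
def mkC (M : ℕ → Type) [∀ n, AddCommGroup (M n)] [∀ n, Module ℚ (M n)]
    (d : ∀ n, M (n+1) →ₗ[ℚ] M n) (dd : ∀ n, d n ∘ₗ d (n+1) = 0) : CC :=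
  ChainComplex.of (fun n => ModuleCat.of ℚ (M n)) (fun n => ModuleCat.ofHom (d n)) (by
    intro n
    rw [← ModuleCat.ofHom_comp, dd]; rfl)

lemma mkC_d (M : ℕ → Type) [∀ n, AddCommGroup (M n)] [∀ n, Module ℚ (M n)]
    (d : ∀ n, M (n+1) →ₗ[ℚ] M n) (dd : ∀ n, d n ∘ₗ d (n+1) = 0) (j : ℕ) :
    (mkC M d dd).d (j+1) j = ModuleCat.ofHom (d j) :=
  ChainComplex.of_d (fun n => ModuleCat.of ℚ (M n)) (fun n => ModuleCat.ofHom (d n)) j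

section
variable {M1 M2 M3 : ℕ → Type} [∀ n, AddCommGroup (M1 n)] [∀ n, Module ℚ (M1 n)]
  [∀ n, AddCommGroup (M2 n)] [∀ n, Module ℚ (M2 n)]
  [∀ n, AddCommGroup (M3 n)] [∀ n, Module ℚ (M3 n)]
  {d1 : ∀ n, M1 (n+1) →ₗ[ℚ] M1 n} {dd1 : ∀ n, d1 n ∘ₗ d1 (n+1) = 0}
  {d2 : ∀ n, M2 (n+1) →ₗ[ℚ] M2 n} {dd2 : ∀ n, d2 n ∘ₗ d2 (n+1) = 0}
  {d3 : ∀ n, M3 (n+1) →ₗ[ℚ] M3 n} {dd3 : ∀ n, d3 n ∘ₗ d3 (n+1) = 0}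

def mkH (f : ∀ n, M1 n →ₗ[ℚ] M2 n) (hf : ∀ n, d2 n ∘ₗ f (n+1) = f n ∘ₗ d1 n) :
    mkC M1 d1 dd1 ⟶ mkC M2 d2 dd2 :=
  { f := fun n => ModuleCat.ofHom (f n)
    comm' := by
      intro i j hij
      have hij' : j + 1 = i := hij
      subst hij'
      have t1 : (mkC M1 d1 dd1).d (j+1) j = ModuleCat.ofHom (d1 j) := mkC_d _ _ _ _
      have t2 : (mkC M2 d2 dd2).d (j+1) j = ModuleCat.ofHom (d2 j) := mkC_d _ _ _ _
      rw [t1, t2]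
      ext x
      exact LinearMap.congr_fun (hf j) x }

lemma mk_ses (f : ∀ n, M1 n →ₗ[ℚ] M2 n) (hf : ∀ n, d2 n ∘ₗ f (n+1) = f n ∘ₗ d1 n)
    (g : ∀ n, M2 n →ₗ[ℚ] M3 n) (hg : ∀ n, d3 n ∘ₗ g (n+1) = g n ∘ₗ d2 n)
    (fi : ∀ n, Function.Injective (f n)) (gs : ∀ n, Function.Surjective (g n))
    (ex : ∀ n, Function.Exact (f n) (g n)) :
    ∃ S : ShortComplex CC, S.ShortExact ∧ S.X₁ = mkC M1 d1 dd1 ∧ S.X₂ = mkC M2 d2 dd2 ∧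
      S.X₃ = mkC M3 d3 dd3 := by
  refine ⟨ShortComplex.mk (mkH (dd1 := dd1) (dd2 := dd2) f hf) (mkH (dd2 := dd3) g hg) ?_, ?_, rfl, rfl, rfl⟩
  · ext n x
    exact (ex n).apply_apply_eq_zero x
  · apply HomologicalComplex.shortExact_of_degreewise_shortExact
    intro n
    have e1 : Mono (ModuleCat.ofHom (f n)) := (ModuleCat.mono_iff_injective _).2 (fi n)
    have e2 : Epi (ModuleCat.ofHom (g n)) := (ModuleCat.epi_iff_surjective _).2 (gs n)
    refine @ShortComplex.ShortExact.mk _ _ _ _ ?_ e1 e2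
    rw [ShortComplex.moduleCat_exact_iff]
    intro x hx
    exact (ex n x).1 hx

lemma mk_zero (h0 : ∀ c : M1 0, ∃ y, d1 0 y = c)
    (h1 : ∀ n (c : M1 (n+1)), d1 n c = 0 → ∃ y, d1 (n+1) y = c) :
    HFT (mkC M1 d1 dd1) ∧ hchi (mkC M1 d1 dd1) = 0 := by
  apply HFT_zero
  intro q
  rw [← ModuleCat.isZero_iff_subsingleton, ← HomologicalComplex.exactAt_iff_isZero_homology]
  rcases q with _ | q
  · rw [HomologicalComplex.exactAt_iff' _ 1 0 0 (by simp) (by simp), ShortComplex.moduleCat_exact_iff]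
    intro c _
    obtain ⟨y, hy⟩ := h0 c
    refine ⟨y, ?_⟩
    change ((mkC M1 d1 dd1).d 1 0).hom y = c
    rw [← hy]
    have : (mkC M1 d1 dd1).d (0+1) 0 = ModuleCat.ofHom (d1 0) := mkC_d _ _ _ _
    exact congrArg (fun z => (ModuleCat.Hom.hom z) y) this
  · rw [HomologicalComplex.exactAt_iff' _ (q+2) (q+1) q (by simp) (by simp), ShortComplex.moduleCat_exact_iff]
    intro c hc
    have t2 : (mkC M1 d1 dd1).d (q+1) q = ModuleCat.ofHom (d1 q) := mkC_d _ _ _ _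
    have t1 : (mkC M1 d1 dd1).d (q+1+1) (q+1) = ModuleCat.ofHom (d1 (q+1)) := mkC_d _ _ _ _
    obtain ⟨y, hy⟩ := h1 q c (by
      have := congrArg (fun z => (ModuleCat.Hom.hom z) c) t2
      exact this.symm.trans hc)
    refine ⟨y, ?_⟩
    rw [← hy]
    exact congrArg (fun z => (ModuleCat.Hom.hom z) y) t1

lemma mk_iso (e : ∀ n, M1 n ≃ₗ[ℚ] M2 n) (he : ∀ n x, d2 n (e (n+1) x) = e n (d1 n x))
    (h : HFT (mkC M1 d1 dd1)) : HFT (mkC M2 d2 dd2) ∧ hchi (mkC M2 d2 dd2) = hchi (mkC M1 d1 dd1) := by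
  refine HFT_iso (HomologicalComplex.Hom.isoOfComponents (fun n => (e n).toModuleIso) ?_) h
  intro i j hij
  have hij' : j + 1 = i := hij
  subst hij'
  have t1 : (mkC M1 d1 dd1).d (j+1) j = ModuleCat.ofHom (d1 j) := mkC_d _ _ _ _
  have t2 : (mkC M2 d2 dd2).d (j+1) j = ModuleCat.ofHom (d2 j) := mkC_d _ _ _ _
  rw [t1, t2]
  ext x
  exact he j x

end

lemma hom_altsum {M N : ModuleCat.{0} ℚ} {k : ℕ} (f : Fin k → (M ⟶ N)) (x : M) :
    (ModuleCat.Hom.hom (∑ i : Fin k, (-1 : ℤ) ^ (i : ℕ) • f i : M ⟶ N)) x =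
      ∑ i : Fin k, ((-1 : ℚ) ^ (i : ℕ)) • (ModuleCat.Hom.hom (f i)) x := by
  rw [ModuleCat.hom_sum, LinearMap.sum_apply]
  refine Finset.sum_congr rfl fun i _ => ?_
  rw [ModuleCat.hom_zsmul, LinearMap.smul_apply, ← Int.cast_smul_eq_zsmul ℚ]
  push_cast
  rfl

section
variable {X : Type} [TopologicalSpace X]

lemma dX_dX (n : ℕ) : dX (X := X) n ∘ₗ dX (n+1) = 0 := (SI X).dd n

lemma sing_iso : Nonempty (ScatteringPaper.singularChainComplex X ≅ mkC (fun n => SCh X n) (fun n => dX n) dX_dX) := by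
  refine ⟨HomologicalComplex.Hom.isoOfComponents
    (fun n => (Finsupp.domLCongr ((TopCat.of X).toSSetObjEquiv (Opposite.op (SimplexCategory.mk n)))).toModuleIso) ?_⟩
  intro i j hij
  have hij' : j + 1 = i := hij
  subst hij'
  have t2 : (mkC (fun n => SCh X n) (fun n => dX n) dX_dX).d (j+1) j = ModuleCat.ofHom (dX j) := mkC_d _ _ _ _
  rw [t2]
  have t1 : (ScatteringPaper.singularChainComplex X).d (j+1) j = _ :=
    AlgebraicTopology.alternatingFaceMapComplex_obj_d _ j
  rw [t1]
  apply ModuleCat.hom_ext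
  apply Finsupp.lhom_ext
  intro σ r
  have e1 : (Finsupp.domLCongr (R := ℚ) (M := ℚ) ((TopCat.of X).toSSetObjEquiv (Opposite.op (SimplexCategory.mk (j+1)))))
     (Finsupp.single σ r) = Finsupp.single ((TopCat.of X).toSSetObjEquiv _ σ) r := Finsupp.domLCongr_single _ _ _
  change dX j (Finsupp.domLCongr (R := ℚ) (M := ℚ) ((TopCat.of X).toSSetObjEquiv (Opposite.op (SimplexCategory.mk (j+1)))) (Finsupp.single σ r))
    = Finsupp.domLCongr (R := ℚ) (M := ℚ) ((TopCat.of X).toSSetObjEquiv (Opposite.op (SimplexCategory.mk j)))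
      ((ModuleCat.Hom.hom (AlternatingFaceMapComplex.objD
            (((SimplicialObject.whiskering Type (ModuleCat ℚ)).obj (ModuleCat.free ℚ)).obj
              (TopCat.toSSet.obj (TopCat.of X))) j)) (Finsupp.single σ r))
  rw [e1]
  have e2 : ((ModuleCat.Hom.hom (AlternatingFaceMapComplex.objD
            (((SimplicialObject.whiskering Type (ModuleCat ℚ)).obj (ModuleCat.free ℚ)).obj
              (TopCat.toSSet.obj (TopCat.of X))) j)) (Finsupp.single σ r))
      = ∑ i : Fin (j+2), ((-1 : ℚ) ^ (i : ℕ)) • Finsupp.single ((TopCat.toSSet.obj (TopCat.of X)).δ i σ) r := by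
    refine (hom_altsum _ _).trans ?_
    refine Finset.sum_congr rfl fun i _ => ?_
    have e3 : (ModuleCat.Hom.hom (((((SimplicialObject.whiskering Type (ModuleCat ℚ)).obj (ModuleCat.free ℚ)).obj
              (TopCat.toSSet.obj (TopCat.of X)))).δ i)) (Finsupp.single σ r) =
        Finsupp.single ((TopCat.toSSet.obj (TopCat.of X)).δ i σ) r := Finsupp.mapDomain_single
    exact congrArg _ e3
  rw [e2, map_sum]
  refine ((SI X).d_single j _ r).trans ?_
  refine Finset.sum_congr rfl fun i _ => ?_
  rw [map_smul]
  congr 1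
  exact (Finsupp.domLCongr_single ((TopCat.of X).toSSetObjEquiv (Opposite.op (SimplexCategory.mk j)))
    ((TopCat.toSSet.obj (TopCat.of X)).δ i σ) r).symm

abbrev KC (X : Type) [TopologicalSpace X] : CC := mkC (fun n => SCh X n) (fun n => dX n) dX_dX

lemma FT_iff : FT X ↔ HFT (KC X) := by
  obtain ⟨e⟩ := sing_iso (X := X)
  exact ⟨fun h => (HFT_iso e h).1, fun h => (HFT_iso e.symm h).1⟩

lemma chi_KC (h : FT X) : ScatteringPaper.eulerChar X = hchi (KC X) := by
  obtain ⟨e⟩ := sing_iso (X := X)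
  exact (HFT_iso e h).2.symm
end
end OT
end
end

section
open CategoryTheory AlgebraicTopology

noncomputable section
namespace OT

section
variable {M : ℕ → Type} [∀ n, AddCommGroup (M n)] [∀ n, Module ℚ (M n)]
  {d : ∀ n, M (n+1) →ₗ[ℚ] M n} (dd : ∀ n, d n ∘ₗ d (n+1) = 0)

def subC (P : ∀ n, Submodule ℚ (M n)) (hP : ∀ n, ∀ c ∈ P (n+1), d n c ∈ P n) : CC :=
  mkC (fun n => ↥(P n)) (fun n => (d n).restrict (hP n)) (by
    intro n
    ext x
    exact LinearMap.congr_fun (dd n) x.1)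

lemma sub_mv (P Q : ∀ n, Submodule ℚ (M n)) (hP : ∀ n, ∀ c ∈ P (n+1), d n c ∈ P n)
    (hQ : ∀ n, ∀ c ∈ Q (n+1), d n c ∈ Q n) (R : ∀ n, Submodule ℚ (M n)) (hR : ∀ n, ∀ c ∈ R (n+1), d n c ∈ R n)
    (W : ∀ n, Submodule ℚ (M n)) (hW : ∀ n, ∀ c ∈ W (n+1), d n c ∈ W n)
    (hPQ : ∀ n, P n ⊓ Q n = R n) (hPQ' : ∀ n, P n ⊔ Q n = W n) :
    (HFT (subC dd P hP) → HFT (subC dd Q hQ) → HFT (subC dd R hR) → HFT (subC dd W hW)) ∧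
    (HFT (subC dd W hW) → HFT (subC dd Q hQ) → HFT (subC dd R hR) → HFT (subC dd P hP)) ∧
    (HFT (subC dd P hP) → HFT (subC dd Q hQ) → HFT (subC dd R hR) →
      hchi (subC dd W hW) + hchi (subC dd R hR) = hchi (subC dd P hP) + hchi (subC dd Q hQ)) := by
  have ddPQ : ∀ n, ((d n).restrict (hP n)).prodMap ((d n).restrict (hQ n)) ∘ₗ
      ((d (n+1)).restrict (hP (n+1))).prodMap ((d (n+1)).restrict (hQ (n+1))) = 0 := by
    intro n
    apply LinearMap.ext
    rintro ⟨x, y⟩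
    exact Prod.ext (Subtype.ext (LinearMap.congr_fun (dd n) x.1)) (Subtype.ext (LinearMap.congr_fun (dd n) y.1))
  obtain ⟨S, hS, e1, e2, e3⟩ := mk_ses (M1 := fun n => ↥(P n)) (M2 := fun n => ↥(P n) × ↥(Q n)) (M3 := fun n => ↥(Q n))
    (d1 := fun n => (d n).restrict (hP n)) (d3 := fun n => (d n).restrict (hQ n))
    (d2 := fun n => ((d n).restrict (hP n)).prodMap ((d n).restrict (hQ n)))
    (dd1 := by
      intro n
      ext x
      exact LinearMap.congr_fun (dd n) x.1)
    (dd3 := by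
      intro n
      ext x
      exact LinearMap.congr_fun (dd n) x.1)
    (dd2 := ddPQ)
    (fun n => LinearMap.inl ℚ _ _) (by
      intro n
      apply LinearMap.ext
      intro x
      simp)
    (fun n => LinearMap.snd ℚ _ _) (by
      intro n
      apply LinearMap.ext
      intro x
      simp)
    (fun n => LinearMap.inl_injective) (fun n => LinearMap.snd_surjective) (fun n => Function.Exact.inl_snd)
  obtain ⟨S', hS', e1', e2', e3'⟩ := mk_ses (M1 := fun n => ↥(R n)) (M2 := fun n => ↥(P n) × ↥(Q n)) (M3 := fun n => ↥(W n))
    (d1 := fun n => (d n).restrict (hR n)) (d3 := fun n => (d n).restrict (hW n))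
    (d2 := fun n => ((d n).restrict (hP n)).prodMap ((d n).restrict (hQ n)))
    (dd1 := by
      intro n
      ext x
      exact LinearMap.congr_fun (dd n) x.1)
    (dd3 := by
      intro n
      ext x
      exact LinearMap.congr_fun (dd n) x.1)
    (dd2 := ddPQ)
    (fun n => (Submodule.inclusion ((hPQ n).symm.le.trans inf_le_left)).prod
        (Submodule.inclusion ((hPQ n).symm.le.trans inf_le_right))) (by
      intro n
      apply LinearMap.ext
      intro x
      rfl)
    (fun n => (Submodule.inclusion (le_sup_left.trans (hPQ' n).le)).coprod
        (-(Submodule.inclusion (le_sup_right.trans (hPQ' n).le)))) (by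
      intro n
      apply LinearMap.ext
      rintro ⟨x, y⟩
      apply Subtype.ext
      simp [LinearMap.restrict_apply])
    (by
      intro n x y h
      have := congrArg (fun z => (z.1 : M n)) h
      exact Subtype.ext this)
    (by
      rintro n ⟨z, hz⟩
      rw [← hPQ', Submodule.mem_sup] at hz
      obtain ⟨x, hx, y, hy, rfl⟩ := hz
      refine ⟨(⟨x, hx⟩, ⟨-y, neg_mem hy⟩), ?_⟩
      apply Subtype.ext
      simp)
    (by
      rintro n ⟨⟨x, hx⟩, ⟨y, hy⟩⟩
      constructor
      · intro h
        have h1 := congrArg Subtype.val h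
        have h2 : x = y := by
          simpa [add_neg_eq_zero] using h1
        subst h2
        refine ⟨⟨x, (hPQ n).le ⟨hx, hy⟩⟩, rfl⟩
      · rintro ⟨z, hz⟩
        have h1 : x = z.1 := (congrArg (fun z => (z.1 : M n)) hz).symm
        have h2 : y = z.1 := (congrArg (fun z => (z.2 : M n)) hz).symm
        apply Subtype.ext
        simp [h1, h2])
  have E1 : S.X₁ = subC dd P hP := e1
  have E3 : S.X₃ = subC dd Q hQ := e3
  have E2 : S'.X₂ = S.X₂ := e2'.trans e2.symm
  have E1' : S'.X₁ = subC dd R hR := e1'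
  have E3' : S'.X₃ = subC dd W hW := e3'
  rw [← E1, ← E3, ← E1', ← E3']
  refine ⟨fun p q r => ses_3 hS' (E2 ▸ ses_2 hS p q) r, fun w q r => ses_1 hS (E2 ▸ ses_2 hS' r w) q, fun p q r => ?_⟩
  have m := ses_2 hS p q
  have t1 := ses_chi hS p m q
  have m' : HFT S'.X₂ := E2 ▸ m
  have t2 := ses_chi hS' r m' (ses_3 hS' m' r)
  rw [E2] at t2
  lia

lemma sub_all (P : ∀ n, Submodule ℚ (M n)) (hP : ∀ n, ∀ c ∈ P (n+1), d n c ∈ P n)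
    (h0 : ∀ c, c ∈ P 0) (h1 : ∀ n c, d n c ∈ P n → ∃ y, c - d (n+1) y ∈ P (n+1)) :
    (HFT (subC dd P hP) ↔ HFT (mkC M d dd)) ∧
    (HFT (subC dd P hP) → hchi (mkC M d dd) = hchi (subC dd P hP)) := by
  have dd3 : ∀ n, ((P (n+1)).mapQ (P n) (d n) (hP n)) ∘ₗ ((P (n+2)).mapQ (P (n+1)) (d (n+1)) (hP (n+1))) = 0 := by
    intro n
    rw [← Submodule.mapQ_comp]
    apply LinearMap.ext
    intro x
    induction x using Submodule.Quotient.induction_on with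
    | H x =>
      rw [Submodule.mapQ_apply, dd n]
      simp
  obtain ⟨S, hS, e1, e2, e3⟩ := mk_ses (M1 := fun n => ↥(P n)) (M2 := M) (M3 := fun n => M n ⧸ P n)
    (d1 := fun n => (d n).restrict (hP n)) (d3 := fun n => (P (n+1)).mapQ (P n) (d n) (hP n))
    (d2 := d)
    (dd1 := by
      intro n
      ext x
      exact LinearMap.congr_fun (dd n) x.1)
    (dd3 := dd3)
    (dd2 := dd)
    (fun n => (P n).subtype) (by
      intro n
      apply LinearMap.ext
      intro x
      rfl)
    (fun n => (P n).mkQ) (by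
      intro n
      apply LinearMap.ext
      intro x
      rfl)
    (fun n => (P n).subtype_injective) (fun n => (P n).mkQ_surjective)
      (fun n => LinearMap.exact_subtype_mkQ (P n))
  have E1 : S.X₁ = subC dd P hP := e1
  have h3 : HFT S.X₃ ∧ hchi S.X₃ = 0 := by
    rw [e3]
    apply mk_zero
    · intro c
      induction c using Submodule.Quotient.induction_on with
      | H x =>
        refine ⟨0, ?_⟩
        rw [map_zero]
        exact ((Submodule.Quotient.mk_eq_zero _).2 (h0 x)).symm
    · intro n c hc
      induction c using Submodule.Quotient.induction_on with
      | H x =>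
        rw [Submodule.mapQ_apply, Submodule.Quotient.mk_eq_zero] at hc
        obtain ⟨y, hy⟩ := h1 n x hc
        refine ⟨Submodule.Quotient.mk y, ?_⟩
        rw [Submodule.mapQ_apply]
        exact ((Submodule.Quotient.eq _).2 hy).symm
  rw [← E1, ← e2]
  refine ⟨⟨fun h => ses_2 hS h h3.1, fun h => ses_1 hS h h3.1⟩, fun h => ?_⟩
  have := ses_chi hS h (ses_2 hS h h3.1) h3.1
  rw [this, h3.2, add_zero]
end

section
variable {X : Type} [TopologicalSpace X]

def inc (A : Set X) (n : ℕ) : C(Dl n, A) → C(Dl n, X) := fun σ => (⟨Subtype.val, continuous_subtype_val⟩ : C(A, X)).comp σ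

lemma inc_inj (A : Set X) (n : ℕ) : Function.Injective (inc A n) := by
  intro σ τ h
  ext x
  exact congrArg (fun f : C(Dl n, X) => f x) h

lemma sup_mem_iff (A : Set X) (n : ℕ) (c : SCh X n) :
    c ∈ sup A n ↔ ∃ b, Finsupp.lmapDomain ℚ ℚ (inc A n) b = c := by
  constructor
  · intro h
    have h' : c ∈ Submodule.span ℚ ((fun i => Finsupp.single i (1:ℚ)) '' {σ : C(Dl n, X) | Set.range σ ⊆ A}) := by
      rw [← Finsupp.supported_eq_span_single]; exact h
    have : Submodule.span ℚ ((fun i => Finsupp.single i (1:ℚ)) '' {σ : C(Dl n, X) | Set.range σ ⊆ A}) ≤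
        LinearMap.range (Finsupp.lmapDomain ℚ ℚ (inc A n)) := by
      rw [Submodule.span_le]
      rintro _ ⟨σ, hσ, rfl⟩
      refine ⟨Finsupp.single ⟨fun x => ⟨σ x, hσ ⟨x, rfl⟩⟩, by fun_prop⟩ 1, ?_⟩
      rw [Finsupp.lmapDomain_apply, Finsupp.mapDomain_single]
      rfl
    exact this h'
  · rintro ⟨b, rfl⟩
    induction b using Finsupp.induction_linear with
    | zero => rw [map_zero]; exact Submodule.zero_mem _
    | add a b ha hb => rw [map_add]; exact Submodule.add_mem _ ha hb
    | single σ r =>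
      rw [Finsupp.lmapDomain_apply, Finsupp.mapDomain_single]
      refine Finsupp.single_mem_supported ℚ _ ?_
      rintro _ ⟨x, rfl⟩
      exact (σ x).2

abbrev supC (A : Set X) : CC := subC (M := fun n => SCh X n) dX_dX (sup A) (fun _ _ h => dX_mem h)

def supE (A : Set X) (n : ℕ) : SCh A n ≃ₗ[ℚ] sup A n :=
  LinearEquiv.ofBijective ((Finsupp.lmapDomain ℚ ℚ (inc A n)).codRestrict (sup A n)
    (fun b => (sup_mem_iff A n _).2 ⟨b, rfl⟩)) ⟨by
      intro a b h
      exact Finsupp.mapDomain_injective (inc_inj A n) (congrArg Subtype.val h), by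
      rintro ⟨c, hc⟩
      obtain ⟨b, hb⟩ := (sup_mem_iff A n _).1 hc
      exact ⟨b, Subtype.ext hb⟩⟩

lemma supE_d (A : Set X) (n : ℕ) (x : SCh A (n+1)) :
    ((dX n).restrict (fun _ h => dX_mem h)) (supE A (n+1) x) = supE A n (dX n x) := by
  apply Subtype.ext
  exact SST.d_map (S := SI A) (S' := SI X) (fun n => inc A n) (fun _ _ _ => rfl) n x

lemma FT_sup (A : Set X) : (FT A ↔ HFT (supC A)) ∧ (FT A → ScatteringPaper.eulerChar A = hchi (supC A)) := by
  have h1 := mk_iso (dd1 := dX_dX (X := A)) (dd2 := by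
      intro n
      apply LinearMap.ext
      intro x
      exact Subtype.ext (LinearMap.congr_fun (dX_dX n) x.1)) (supE A) (supE_d A)
  have h2 := mk_iso (dd2 := dX_dX (X := A)) (dd1 := by
      intro n
      apply LinearMap.ext
      intro x
      exact Subtype.ext (LinearMap.congr_fun (dX_dX n) x.1)) (fun n => (supE A n).symm) (d1 := fun n => ((dX n).restrict (fun _ h => dX_mem h)))
      (fun n x => by
        rw [LinearEquiv.eq_symm_apply, ← supE_d, LinearEquiv.apply_symm_apply])
  refine ⟨⟨fun h => (h1 (FT_iff.1 h)).1, fun h => FT_iff.2 (h2 h).1⟩, fun h => ?_⟩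
  rw [chi_KC h]
  exact (h1 (FT_iff.1 h)).2.symm

theorem MV_univ (A B : Set X) (hA : IsOpen A) (hB : IsOpen B) (hAB : A ∪ B = Set.univ) :
    (FT A → FT B → FT ↥(A ∩ B) → FT X) ∧ (FT X → FT B → FT ↥(A ∩ B) → FT A) ∧
    (FT A → FT B → FT ↥(A ∩ B) →
      ScatteringPaper.eulerChar X + ScatteringPaper.eulerChar ↥(A ∩ B) = ScatteringPaper.eulerChar A + ScatteringPaper.eulerChar B) := by
  have hS : ∀ n, ∀ c ∈ sml A B (n+1), dX n c ∈ sml A B n := fun n c h => sml_map (fun _ _ h => dX_mem h) h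
  have H1 := sub_mv (M := fun n => SCh X n) dX_dX (sup A) (sup B) (fun _ _ h => dX_mem h) (fun _ _ h => dX_mem h)
    (sup (A ∩ B)) (fun _ _ h => dX_mem h) (sml A B) hS (by
      intro n
      unfold sup
      rw [← Finsupp.supported_inter]
      congr 1
      ext σ
      exact Set.subset_inter_iff.symm) (fun n => rfl)
  have H2 := sub_all (M := fun n => SCh X n) dX_dX (sml A B) hS (acyc_zero hA hB hAB) (acyc_succ hA hB hAB)
  refine ⟨fun a b c => ?_, fun x b c => ?_, fun a b c => ?_⟩
  · rw [(FT_sup _).1] at a b c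
    rw [FT_iff]
    exact H2.1.1 (H1.1 a b c)
  · rw [(FT_sup _).1] at b c
    rw [(FT_sup _).1]
    rw [FT_iff] at x
    exact H1.2.1 (H2.1.2 x) b c
  · rw [(FT_sup _).2 a, (FT_sup _).2 b, (FT_sup _).2 c]
    rw [(FT_sup _).1] at a b c
    have h := H1.1 a b c
    rw [chi_KC (FT_iff.2 (H2.1.1 h))]
    refine Eq.trans ?_ (H1.2.2 a b c)
    congr 1
    exact H2.2 h

/-- Mayer-Vietoris for subsets -/
theorem MV (A B : Set X) (hA : IsOpen A) (hB : IsOpen B) :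
    (FT A → FT B → FT ↥(A ∩ B) → FT ↥(A ∪ B)) ∧ (FT ↥(A ∪ B) → FT B → FT ↥(A ∩ B) → FT A) ∧
    (FT A → FT B → FT ↥(A ∩ B) →
      ScatteringPaper.eulerChar ↥(A ∪ B) + ScatteringPaper.eulerChar ↥(A ∩ B) = ScatteringPaper.eulerChar A + ScatteringPaper.eulerChar B) := by
  let f : ↥(A ∪ B) → X := Subtype.val
  have hf : Continuous f := continuous_subtype_val
  have key : ∀ C : Set X, C ⊆ A ∪ B → (FT ↥(f ⁻¹' C) ↔ FT C) ∧ (FT C →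
      ScatteringPaper.eulerChar ↥(f ⁻¹' C) = ScatteringPaper.eulerChar C) := by
    intro C hC
    let e : ↥(f ⁻¹' C) ≃ₜ C :=
      { toFun := fun x => ⟨x.1.1, x.2⟩
        invFun := fun x => ⟨⟨x.1, hC x.2⟩, x.2⟩
        left_inv := fun x => rfl
        right_inv := fun x => rfl
        continuous_toFun := by fun_prop
        continuous_invFun := by fun_prop }
    refine ⟨⟨fun h => (FT_homeo e h).1, fun h => (FT_homeo e.symm h).1⟩, fun h => (FT_homeo e.symm h).2⟩
  have H := MV_univ (f ⁻¹' A) (f ⁻¹' B) (hA.preimage hf) (hB.preimage hf) (by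
    ext x; exact ⟨fun _ => trivial, fun _ => x.2⟩)
  have kA := key A Set.subset_union_left
  have kB := key B Set.subset_union_right
  have kC := key (A ∩ B) (Set.inter_subset_left.trans Set.subset_union_left)
  rw [Set.preimage_inter] at kC
  rw [kA.1, kB.1, kC.1] at H
  refine ⟨H.1, H.2.1, fun a b c => ?_⟩
  have := H.2.2 a b c
  rwa [kA.2 a, kB.2 b, kC.2 c] at this
end
end OT
end
end

section
open CategoryTheory AlgebraicTopology

noncomputable section
namespace OT
open ScatteringPaper (eulerChar)

section
variable {W : Type} [TopologicalSpace W]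

lemma star_lem (B : Set W) (Z : Set (W × ℂ)) (s : W → ℂ) (hs : ContinuousOn s B) (hZ : ∀ p ∈ Z, p.1 ∈ B)
    (hsZ : ∀ y ∈ B, (y, s y) ∈ Z)
    (hst : ∀ p ∈ Z, ∀ θ : ℝ, 0 ≤ θ → θ ≤ 1 → (p.1, (1 - θ : ℂ) * p.2 + θ * s p.1) ∈ Z) (h : FT B) :
    FT Z ∧ eulerChar Z = eulerChar B := by
  have hs' : Continuous (fun y : B => s y) := continuousOn_iff_continuous_domRestrict.1 hs
  have hs2 : Continuous (fun p : Z => s p.1.1) :=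
    hs'.comp (f := fun p : Z => (⟨p.1.1, hZ _ p.2⟩ : B)) (by fun_prop)
  let F : C(B, Z) := ⟨fun y => ⟨(y.1, s y), hsZ _ y.2⟩, Continuous.subtype_mk (continuous_subtype_val.prodMk hs') _⟩
  let G : C(Z, B) := ⟨fun p => ⟨p.1.1, hZ _ p.2⟩, by fun_prop⟩
  have hGF : G.comp F = ContinuousMap.id B := by ext y; rfl
  have hc : Continuous (fun q : unitInterval × Z => s q.2.1.1) := hs2.comp continuous_snd
  have hFG : (F.comp G).Homotopic (ContinuousMap.id Z) := by
    refine ContinuousMap.Homotopic.symm ⟨{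
      toFun := fun q => ⟨(q.2.1.1, (1 - (q.1 : ℝ) : ℂ) * q.2.1.2 + (q.1 : ℝ) * s q.2.1.1),
        hst _ q.2.2 q.1 q.1.2.1 q.1.2.2⟩
      continuous_toFun := by
        refine Continuous.subtype_mk (Continuous.prodMk (by fun_prop) ?_) _
        refine Continuous.add (by fun_prop) (Continuous.mul (by fun_prop) hc)
      map_zero_left := ?_
      map_one_left := ?_ }⟩
    · intro p; apply Subtype.ext; simp
    · intro p; apply Subtype.ext; simp [F, G]
  exact FT_hequiv ⟨F, G, by rw [hGF], hFG⟩ h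

variable (B : Set W) (k : W → ℝ)

def NN : Set (W × ℂ) := {p | p.1 ∈ B ∧ k p.1 * ‖p.2‖ < 1}

variable {B k}

lemma NN_open (hB : IsOpen B) (hk : ContinuousOn k B) : IsOpen (NN B k) := by
  have h1 : IsOpen {p : W × ℂ | p.1 ∈ B} := hB.preimage continuous_fst
  have h2 : ContinuousOn (fun p : W × ℂ => k p.1 * ‖p.2‖) {p : W × ℂ | p.1 ∈ B} := by
    refine ContinuousOn.mul (hk.comp continuousOn_fst (fun p hp => hp)) (by fun_prop)
  exact h2.isOpen_inter_preimage h1 isOpen_Iio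

lemma NN_conv (hk0 : ∀ y, 0 ≤ k y) {p : W × ℂ} (hp : p ∈ NN B k) {z : ℂ} (hz : k p.1 * ‖z‖ < 1)
    {θ : ℝ} (h0 : 0 ≤ θ) (h1 : θ ≤ 1) : (p.1, (1 - θ : ℂ) * p.2 + θ * z) ∈ NN B k := by
  refine ⟨hp.1, ?_⟩
  have e1 : ‖(1 - θ : ℂ) * p.2 + θ * z‖ ≤ (1 - θ) * ‖p.2‖ + θ * ‖z‖ := by
    refine (norm_add_le _ _).trans ?_
    rw [norm_mul, norm_mul]
    have a1 : ‖(1 - θ : ℂ)‖ = 1 - θ := by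
      rw [← Complex.ofReal_one, ← Complex.ofReal_sub, Complex.norm_real, Real.norm_of_nonneg (by linarith)]
    have a2 : ‖(θ : ℂ)‖ = θ := by rw [Complex.norm_real, Real.norm_of_nonneg h0]
    rw [a1, a2]
  have e2 := hp.2
  have e3 := hk0 p.1
  have e4 : k p.1 * ‖(1 - θ : ℂ) * p.2 + θ * z‖ ≤ (1 - θ) * (k p.1 * ‖p.2‖) + θ * (k p.1 * ‖z‖) := by
    refine (mul_le_mul_of_nonneg_left e1 e3).trans (le_of_eq (by ring))
  show k p.1 * ‖(1 - θ : ℂ) * p.2 + θ * z‖ < 1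
  rcases h0.eq_or_lt with rfl | h0
  · simp only [sub_zero, one_mul, zero_mul, add_zero] at e4; linarith
  · nlinarith [mul_pos h0 (sub_pos.2 hz), mul_nonneg (sub_nonneg.2 h1) (sub_nonneg.2 e2.le)]

lemma NN_sec (hk0 : ∀ y, 0 ≤ k y) (y : W) (c : ℂ) (hc : ‖c‖ = 1) : k y * ‖((1 + k y)⁻¹ : ℝ) * c‖ < 1 := by
  rw [norm_mul, hc, mul_one, Complex.norm_real, Real.norm_of_nonneg (by have := hk0 y; positivity)]
  have := hk0 y
  rw [← div_eq_mul_inv, div_lt_one (by linarith)]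
  linarith

lemma NN_piece (hk : ContinuousOn k B) (hk0 : ∀ y, 0 ≤ k y) (h : FT B) (c : ℂ) (hc : ‖c‖ = 1) (P : Set ℂ)
    (hP : ∀ r : ℝ, 0 < r → (r : ℂ) * c ∈ P)
    (hP2 : ∀ z ∈ P, ∀ r : ℝ, 0 < r → ∀ θ : ℝ, 0 ≤ θ → θ ≤ 1 → (1 - θ : ℂ) * z + θ * (r * c) ∈ P) :
    FT ↥{p | p ∈ NN B k ∧ p.2 ∈ P} ∧ eulerChar ↥{p | p ∈ NN B k ∧ p.2 ∈ P} = eulerChar B := by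
  have hr : ∀ y, 0 < (1 + k y)⁻¹ := fun y => by have := hk0 y; positivity
  refine star_lem B _ (fun y => ((1 + k y)⁻¹ : ℝ) * c) ?_ (fun p hp => hp.1.1) ?_ ?_ h
  · refine ContinuousOn.mul (Complex.continuous_ofReal.comp_continuousOn ?_) continuousOn_const
    refine ContinuousOn.inv₀ (by fun_prop) (fun y _ => by have := hk0 y; positivity)
  · intro y hy
    exact ⟨⟨hy, NN_sec hk0 y c hc⟩, hP _ (hr y)⟩
  · rintro p ⟨hp, hp2⟩ θ h0 h1
    exact ⟨NN_conv hk0 hp (NN_sec hk0 p.1 c hc) h0 h1, hP2 _ hp2 _ (hr _) θ h0 h1⟩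

lemma NN_full (hk : ContinuousOn k B) (hk0 : ∀ y, 0 ≤ k y) (h : FT B) :
    FT (NN B k) ∧ eulerChar (NN B k) = eulerChar B := by
  have := NN_piece hk hk0 h 1 (by simp) Set.univ (by simp) (by simp)
  have e : {p | p ∈ NN B k ∧ p.2 ∈ (Set.univ : Set ℂ)} = NN B k := by ext; simp
  rwa [e] at this

lemma NN_punct (hB : IsOpen B) (hk : ContinuousOn k B) (hk0 : ∀ y, 0 ≤ k y) (h : FT B) :
    FT ↥{p | p ∈ NN B k ∧ p.2 ≠ 0} ∧ eulerChar ↥{p | p ∈ NN B k ∧ p.2 ≠ 0} = 0 := by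
  have hO := NN_open hB hk
  have op : ∀ P : Set ℂ, IsOpen P → IsOpen {p | p ∈ NN B k ∧ p.2 ∈ P} := fun P hP =>
    hO.inter (hP.preimage continuous_snd)
  have key1 : ∀ c : ℝ, ‖c‖ = 1 →
      FT ↥{p | p ∈ NN B k ∧ p.2 ∈ {z : ℂ | 0 < c * z.re ∨ z.im ≠ 0}} ∧
      eulerChar ↥{p | p ∈ NN B k ∧ p.2 ∈ {z : ℂ | 0 < c * z.re ∨ z.im ≠ 0}} = eulerChar B := by
    intro c hc
    have hcc : c * c = 1 := by
      rw [Real.norm_eq_abs] at hc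
      have := abs_mul_abs_self c
      rw [hc] at this; linarith
    refine NN_piece hk hk0 h (c : ℂ) (by simpa using hc) _ ?_ ?_
    · intro r hr
      left
      simp
      nlinarith
    · rintro z hz r hr θ h0 h1
      rcases hz with hz | hz
      · left
        simp
        rcases h0.eq_or_lt with rfl | h0
        · simpa using hz
        · nlinarith [mul_pos h0 hr, mul_nonneg (sub_nonneg.2 h1) hz.le]
      · rcases h1.eq_or_lt with rfl | h1
        · left
          simp
          nlinarith
        · right
          simp
          exact ⟨by linarith, hz⟩
  have key2 : ∀ c : ℝ, ‖c‖ = 1 →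
      FT ↥{p | p ∈ NN B k ∧ p.2 ∈ {z : ℂ | 0 < c * z.im}} ∧
      eulerChar ↥{p | p ∈ NN B k ∧ p.2 ∈ {z : ℂ | 0 < c * z.im}} = eulerChar B := by
    intro c hc
    have hcc : c * c = 1 := by
      rw [Real.norm_eq_abs] at hc
      have := abs_mul_abs_self c
      rw [hc] at this; linarith
    refine NN_piece hk hk0 h (c * Complex.I : ℂ) (by simpa using hc) _ ?_ ?_
    · intro r hr
      simp
      nlinarith
    · rintro z hz r hr θ h0 h1
      simp at hz
      simp
      rcases h0.eq_or_lt with rfl | h0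
      · simpa using hz
      · nlinarith [mul_pos h0 hr, mul_nonneg (sub_nonneg.2 h1) hz.le]
  have o1 : ∀ c : ℝ, IsOpen {z : ℂ | 0 < c * z.re ∨ z.im ≠ 0} := fun c =>
    IsOpen.union (s₁ := {z : ℂ | 0 < c * z.re}) (s₂ := {z : ℂ | z.im ≠ 0})
      (isOpen_lt continuous_const (by fun_prop)) (isOpen_ne_fun (by fun_prop) (by fun_prop))
  have o2 : ∀ c : ℝ, IsOpen {z : ℂ | 0 < c * z.im} := fun c =>
    isOpen_lt continuous_const (by fun_prop)
  have U := MV _ _ (op _ (o2 1)) (op _ (o2 (-1)))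
  have S := MV _ _ (op _ (o1 1)) (op _ (o1 (-1)))
  have k1 := key1 1 (by simp)
  have k2 := key1 (-1) (by simp)
  have k3 := key2 1 (by simp)
  have k4 := key2 (-1) (by simp)
  have emp : {p | p ∈ NN B k ∧ p.2 ∈ {z : ℂ | 0 < (1:ℝ) * z.im}} ∩ {p | p ∈ NN B k ∧ p.2 ∈ {z : ℂ | 0 < (-1:ℝ) * z.im}} = ∅ := by
    ext p
    simp
    intro _ _ _
    linarith
  have hE : FT ↥({p | p ∈ NN B k ∧ p.2 ∈ {z : ℂ | 0 < (1:ℝ) * z.im}} ∩ {p | p ∈ NN B k ∧ p.2 ∈ {z : ℂ | 0 < (-1:ℝ) * z.im}}) ∧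
     eulerChar ↥({p | p ∈ NN B k ∧ p.2 ∈ {z : ℂ | 0 < (1:ℝ) * z.im}} ∩ {p | p ∈ NN B k ∧ p.2 ∈ {z : ℂ | 0 < (-1:ℝ) * z.im}}) = 0 := by
    rw [emp]; exact FT_empty _
  have int : {p | p ∈ NN B k ∧ p.2 ∈ {z : ℂ | 0 < (1:ℝ) * z.re ∨ z.im ≠ 0}} ∩ {p | p ∈ NN B k ∧ p.2 ∈ {z : ℂ | 0 < (-1:ℝ) * z.re ∨ z.im ≠ 0}} =
     {p | p ∈ NN B k ∧ p.2 ∈ {z : ℂ | 0 < (1:ℝ) * z.im}} ∪ {p | p ∈ NN B k ∧ p.2 ∈ {z : ℂ | 0 < (-1:ℝ) * z.im}} := by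
    ext p
    simp only [Set.mem_inter_iff, Set.mem_union, Set.mem_ofPred_eq]
    constructor
    · rintro ⟨⟨h1, h2⟩, _, h3⟩
      have : p.2.im ≠ 0 := by
        intro hh
        rcases h2 with h2 | h2
        · rcases h3 with h3 | h3
          · linarith
          · exact h3 hh
        · exact h2 hh
      rcases lt_or_gt_of_ne this with h4 | h4
      · right; exact ⟨h1, by linarith⟩
      · left; exact ⟨h1, by linarith⟩
    · rintro (⟨h1, h2⟩ | ⟨h1, h2⟩)
      · have : p.2.im ≠ 0 := by intro hh; rw [hh] at h2; linarith
        exact ⟨⟨h1, Or.inr this⟩, h1, Or.inr this⟩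
      · have : p.2.im ≠ 0 := by intro hh; rw [hh] at h2; linarith
        exact ⟨⟨h1, Or.inr this⟩, h1, Or.inr this⟩
  have uni : {p | p ∈ NN B k ∧ p.2 ∈ {z : ℂ | 0 < (1:ℝ) * z.re ∨ z.im ≠ 0}} ∪ {p | p ∈ NN B k ∧ p.2 ∈ {z : ℂ | 0 < (-1:ℝ) * z.re ∨ z.im ≠ 0}} =
     {p | p ∈ NN B k ∧ p.2 ≠ 0} := by
    ext p
    simp only [Set.mem_union, Set.mem_ofPred_eq]
    constructor
    · rintro (⟨h1, h2⟩ | ⟨h1, h2⟩)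
      · exact ⟨h1, fun hh => by rw [hh] at h2; simp at h2⟩
      · exact ⟨h1, fun hh => by rw [hh] at h2; simp at h2⟩
    · rintro ⟨h1, h2⟩
      by_cases hi : p.2.im = 0
      · have hr : p.2.re ≠ 0 := fun hr => h2 (Complex.ext hr hi)
        rcases lt_or_gt_of_ne hr with h4 | h4
        · right; exact ⟨h1, Or.inl (by linarith)⟩
        · left; exact ⟨h1, Or.inl (by linarith)⟩
      · left; exact ⟨h1, Or.inr hi⟩
  have fU := U.1 k3.1 k4.1 hE.1
  have cU := U.2.2 k3.1 k4.1 hE.1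
  rw [int, uni] at S
  refine ⟨S.1 k1.1 k2.1 fU, ?_⟩
  have cS := S.2.2 k1.1 k2.1 fU
  rw [k1.2, k2.2] at cS
  rw [k3.2, k4.2, hE.2] at cU
  lia

/-- deletion-restriction for the Euler characteristic -/
theorem del_res (hB : IsOpen B) (hk : ContinuousOn k B) (hk0 : ∀ y, 0 ≤ k y) (h : FT B)
    (X' : Set (W × ℂ)) (hX' : IsOpen X') (h1 : NN B k ⊆ X') (h2 : ∀ p ∈ X', p.2 = 0 → p.1 ∈ B) (hF : FT X')
    :
    FT ↥{p | p ∈ X' ∧ p.2 ≠ 0} ∧ eulerChar ↥{p | p ∈ X' ∧ p.2 ≠ 0} = eulerChar X' - eulerChar B := by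
  have hO : IsOpen {p : W × ℂ | p ∈ X' ∧ p.2 ≠ 0} := hX'.inter (isOpen_ne_fun (by fun_prop) (by fun_prop))
  have M := MV _ _ hO (NN_open hB hk)
  have e1 : {p : W × ℂ | p ∈ X' ∧ p.2 ≠ 0} ∪ NN B k = X' := by
    ext p
    constructor
    · rintro (hp | hp)
      · exact hp.1
      · exact h1 hp
    · intro hp
      by_cases h0 : p.2 = 0
      · right
        exact ⟨h2 p hp h0, by simp [h0]⟩
      · exact Or.inl ⟨hp, h0⟩
  have e2 : {p : W × ℂ | p ∈ X' ∧ p.2 ≠ 0} ∩ NN B k = {p | p ∈ NN B k ∧ p.2 ≠ 0} := by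
    ext p
    exact ⟨fun hp => ⟨hp.2, hp.1.2⟩, fun hp => ⟨⟨h1 hp.1, hp.2⟩, hp.1⟩⟩
  rw [e1, e2] at M
  have p := NN_punct hB hk hk0 h
  have f := NN_full hk hk0 h
  have q := M.2.1 hF f.1 p.1
  refine ⟨q, ?_⟩
  have := M.2.2 q f.1 p.1
  rw [f.2, p.2] at this
  lia
end
end OT
end
end

section
open Filter Topology

noncomputable section
namespace OT

section
variable {T : Type} (𝒰 : Ultrafilter T)

lemma uf_cases (z : T → ℂ) : (∃ z0, Tendsto z 𝒰 (𝓝 z0)) ∨ Tendsto (fun t => (z t)⁻¹) 𝒰 (𝓝 0) := by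
  by_cases h : ∃ R : ℝ, ∀ᶠ t in (𝒰 : Filter T), ‖z t‖ ≤ R
  · left
    obtain ⟨R, hR⟩ := h
    have hc := isCompact_closedBall (0 : ℂ) R
    obtain ⟨z0, _, hz⟩ := hc.ultrafilter_le_nhds (𝒰.map z) (by
      rw [le_principal_iff]
      show ∀ᶠ t in (𝒰 : Filter T), z t ∈ Metric.closedBall 0 R
      simpa using hR)
    exact ⟨z0, hz⟩
  · right
    push Not at h
    refine Filter.tendsto_inv₀_cobounded.comp ?_
    rw [← tendsto_norm_atTop_iff_cobounded, tendsto_atTop]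
    intro R
    filter_upwards [h R] with t ht using ht.le

lemma uf_bdd (z : T → ℂ) (R : ℝ) (hR : ∀ᶠ t in (𝒰 : Filter T), ‖z t‖ ≤ R) : ∃ z0, Tendsto z 𝒰 (𝓝 z0) := by
  have hc := isCompact_closedBall (0 : ℂ) R
  obtain ⟨z0, _, hz⟩ := hc.ultrafilter_le_nhds (𝒰.map z) (by
      rw [le_principal_iff]
      show ∀ᶠ t in (𝒰 : Filter T), z t ∈ Metric.closedBall 0 R
      simpa using hR)
  exact ⟨z0, hz⟩

lemma uf_away (z : T → ℂ) (h : ¬ Tendsto z 𝒰 (𝓝 0)) :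
    (∀ᶠ t in (𝒰 : Filter T), z t ≠ 0) ∧ ∃ w0, Tendsto (fun t => (z t)⁻¹) 𝒰 (𝓝 w0) := by
  rw [Metric.tendsto_nhds] at h
  push Not at h
  obtain ⟨δ, hδ, h⟩ := h
  have := h
  constructor
  · filter_upwards [this] with t ht h0
    rw [h0] at ht; simp at ht; linarith
  · refine uf_bdd 𝒰 _ δ⁻¹ ?_
    filter_upwards [this] with t ht
    rw [dist_zero_right] at ht
    rw [norm_inv]
    gcongr

/-- if `κ z → 0` and `z` does not tend to zero then `κ → 0` -/
lemma uf_div (κ z : T → ℂ) (h : ¬ Tendsto z 𝒰 (𝓝 0)) (hk : Tendsto (fun t => κ t * z t) 𝒰 (𝓝 0)) :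
    Tendsto κ 𝒰 (𝓝 0) := by
  obtain ⟨h1, w0, h2⟩ := uf_away 𝒰 z h
  have := hk.mul h2
  rw [zero_mul] at this
  refine this.congr' ?_
  filter_upwards [h1] with t ht
  field_simp

variable {V : Type} [NormedAddCommGroup V] [NormedSpace ℂ V] [FiniteDimensional ℂ V]

lemma lin_lift {J : Type} [Finite J] (Φ : V →ₗ[ℂ] (J → ℂ)) {l : Filter T} [l.NeBot] (y : T → V) (c : J → ℂ)
    (h : Tendsto (fun t => Φ (y t)) l (𝓝 c)) :
    ∃ (p : T → V) (p0 : V), (∀ t, Φ (p t) = Φ (y t)) ∧ Tendsto p l (𝓝 p0) ∧ Φ p0 = c := by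
  have := Fintype.ofFinite J
  obtain ⟨σ, hσ⟩ := Φ.rangeRestrict.exists_rightInverse_of_surjective (LinearMap.range_rangeRestrict Φ)
  have hσ' : ∀ z : LinearMap.range Φ, Φ (σ z) = z := fun z => congrArg Subtype.val (LinearMap.congr_fun hσ z)
  have hcl : IsClosed (LinearMap.range Φ : Set (J → ℂ)) := Submodule.closed_of_finiteDimensional _
  have hc : c ∈ LinearMap.range Φ := hcl.mem_of_tendsto h (Eventually.of_forall fun t => ⟨_, rfl⟩)
  have hcont : Continuous σ := σ.continuous_of_finiteDimensional
  refine ⟨fun t => σ ⟨Φ (y t), ⟨_, rfl⟩⟩, σ ⟨c, hc⟩, fun t => hσ' _, ?_, hσ' _⟩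
  refine (hcont.tendsto _).comp ?_
  exact tendsto_subtype_rng.2 h

/-- version for subfamilies -/
lemma lin_lift' {J : Type} [Finite J] (a : J → V →L[ℂ] ℂ) (P : Set J) {l : Filter T} [l.NeBot] (y : T → V) (c : J → ℂ)
    (h : ∀ j ∈ P, Tendsto (fun t => a j (y t)) l (𝓝 (c j))) :
    ∃ (p : T → V) (p0 : V), (∀ t, ∀ j ∈ P, a j (p t) = a j (y t)) ∧ Tendsto p l (𝓝 p0) ∧ ∀ j ∈ P, a j p0 = c j := by
  have := Fintype.ofFinite P
  obtain ⟨p, p0, h1, h2, h3⟩ := lin_lift (J := P) (LinearMap.pi fun j => (a j.1).toLinearMap) (l := l) y (fun j => c j)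
    (tendsto_pi_nhds.2 fun j => h j.1 j.2)
  exact ⟨p, p0, fun t j hj => congrFun (h1 t) ⟨j, hj⟩, h2, fun j hj => congrFun h3 ⟨j, hj⟩⟩

lemma lin_scale {J : Type} [Finite J] (a : J → V →L[ℂ] ℂ) (b : J → ℂ) (P : Set J) (x : T → V) (ε : T → ℂ)
    (hε : Tendsto ε 𝒰 (𝓝 0)) (hε0 : ∀ᶠ t in (𝒰 : Filter T), ε t ≠ 0) (c : J → ℂ)
    (h : ∀ j ∈ P, Tendsto (fun t => (a j (x t) + b j) / ε t) 𝒰 (𝓝 (c j))) :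
    ∃ v, ∀ j ∈ P, a j v = c j := by
  obtain ⟨_, q, _, _, hq⟩ := lin_lift' a P (l := 𝒰) x (fun j => - b j) (by
    intro j hj
    have := (h j hj).mul hε
    rw [mul_zero] at this
    have h2 : Tendsto (fun t => a j (x t) + b j) 𝒰 (𝓝 0) := by
      refine this.congr' ?_
      filter_upwards [hε0] with t ht
      field_simp
    simpa using h2.sub_const (b j))
  obtain ⟨_, v, _, _, hv⟩ := lin_lift' a P (l := 𝒰) (fun t => (ε t)⁻¹ • (x t - q)) c (by
    intro j hj
    refine (h j hj).congr fun t => ?_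
    rw [map_smul, map_sub, hq j hj, smul_eq_mul]
    ring)
  exact ⟨v, hv⟩

variable {ι : Type} [Fintype ι]

theorem proper (a : ι → V →L[ℂ] ℂ) (b : ι → ℂ) (ess : ∀ v, (∀ i, a i v = 0) → v = 0)
    (α : V →L[ℂ] ℂ) (β : ℂ) (κ : T → ℂ) (u : T → ι → ℂ) (u0 : ι → ℂ)
    (hu : Tendsto u 𝒰 (𝓝 u0)) (hsum : ∀ F : Finset ι, F.Nonempty → ∑ i ∈ F, u0 i ≠ 0) (x : T → V)
    (hx : ∀ᶠ t in (𝒰 : Filter T), ∀ i, a i (x t) + b i ≠ 0)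
    (heq : ∀ᶠ t in (𝒰 : Filter T), ∀ w, ∑ i, u t i * a i w / (a i (x t) + b i) + κ t * α w = 0)
    (hκ : Tendsto (fun t => κ t * (α (x t) + β)) 𝒰 (𝓝 0)) :
    ∃ x0, (∀ i, a i x0 + b i ≠ 0) ∧ Tendsto x 𝒰 (𝓝 x0) := by
  classical
  have hu' : ∀ i, Tendsto (fun t => u t i) 𝒰 (𝓝 (u0 i)) := fun i => tendsto_pi_nhds.1 hu i
  let a' : Option ι → V →L[ℂ] ℂ := fun o => o.elim α a
  let b' : Option ι → ℂ := fun o => o.elim β b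
  by_cases h0 : ∃ i, Tendsto (fun t => a i (x t) + b i) 𝒰 (𝓝 0)
  · exfalso
    obtain ⟨i1, hi1⟩ := h0
    have hmin : ∃ i0, ∀ᶠ t in (𝒰 : Filter T), ∀ i, ‖a i0 (x t) + b i0‖ ≤ ‖a i (x t) + b i‖ := by
      have hN : Nonempty ι := ⟨i1⟩
      have : (⋃ i0 ∈ (Set.univ : Set ι), {t | ∀ i, ‖a i0 (x t) + b i0‖ ≤ ‖a i (x t) + b i‖}) ∈ 𝒰 := by
        refine Filter.mem_of_superset Filter.univ_mem ?_
        intro t _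
        obtain ⟨i0, hi0⟩ := Finite.exists_min (fun i => ‖a i (x t) + b i‖)
        exact Set.mem_iUnion₂.2 ⟨i0, trivial, hi0⟩
      rw [Ultrafilter.finite_biUnion_mem_iff Set.finite_univ] at this
      obtain ⟨i0, _, h⟩ := this
      exact ⟨i0, h⟩
    obtain ⟨i0, hi0⟩ := hmin
    set ε : T → ℂ := fun t => a i0 (x t) + b i0 with hεdef
    have hε0 : ∀ᶠ t in (𝒰 : Filter T), ε t ≠ 0 := by filter_upwards [hx] with t ht using ht i0
    have hε : Tendsto ε 𝒰 (𝓝 0) := by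
      rw [tendsto_zero_iff_norm_tendsto_zero] at hi1 ⊢
      refine squeeze_zero' (Eventually.of_forall fun t => norm_nonneg _) ?_ hi1
      filter_upwards [hi0] with t ht using ht i1
    have hr : ∀ i, ∃ c, Tendsto (fun t => ε t / (a i (x t) + b i)) 𝒰 (𝓝 c) := by
      intro i
      refine uf_bdd 𝒰 _ 1 ?_
      filter_upwards [hi0, hx] with t h1 h2
      rw [norm_div]
      exact div_le_one_of_le₀ (h1 i) (norm_nonneg _)
    choose c hc using hr
    have hci0 : c i0 = 1 := by
      refine tendsto_nhds_unique (hc i0) (tendsto_const_nhds.congr' ?_)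
      filter_upwards [hε0] with t ht
      exact (div_self ht).symm
    obtain ⟨v, hv, hv2⟩ : ∃ v, (∀ i, c i ≠ 0 → a i v = (c i)⁻¹) ∧ Tendsto (fun t => κ t * ε t * α v) 𝒰 (𝓝 0) := by
      have hinv : ∀ i, c i ≠ 0 → Tendsto (fun t => (a i (x t) + b i) / ε t) 𝒰 (𝓝 (c i)⁻¹) := by
        intro i hi
        refine ((hc i).inv₀ hi).congr fun t => ?_
        rw [inv_div]
      by_cases ht : Tendsto (fun t => (α (x t) + β) / ε t) 𝒰 (𝓝 0)
      · obtain ⟨v, hv⟩ := lin_scale 𝒰 a' b' {o | ∀ i, o = some i → c i ≠ 0} x ε hε hε0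
          (fun o => o.elim 0 (fun i => (c i)⁻¹)) (by
            rintro (_ | i) hj
            · exact ht
            · exact hinv i (hj i rfl))
        refine ⟨v, fun i hi => hv (some i) (by rintro _ ⟨⟩; exact hi), ?_⟩
        have : α v = 0 := hv none (by rintro _ ⟨⟩)
        simp [this]
      · obtain ⟨v, hv⟩ := lin_scale 𝒰 a b {i | c i ≠ 0} x ε hε hε0 (fun i => (c i)⁻¹) hinv
        refine ⟨v, hv, ?_⟩
        have := uf_div 𝒰 (fun t => κ t * ε t) _ ht (by
          refine hκ.congr' ?_
          filter_upwards [hε0] with t ht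
          field_simp)
        simpa using this.mul_const (α v)
    refine hsum (Finset.univ.filter fun i => c i ≠ 0) ⟨i0, by simp [hci0]⟩ ?_
    have l1 : Tendsto (fun t => ∑ i, u t i * a i v * (ε t / (a i (x t) + b i)) + κ t * ε t * α v) 𝒰
        (𝓝 (∑ i, u0 i * a i v * c i + 0)) :=
      (tendsto_finsetSum _ fun i _ => ((hu' i).mul_const _).mul (hc i)).add hv2
    have l2 : (fun t => ∑ i, u t i * a i v * (ε t / (a i (x t) + b i)) + κ t * ε t * α v) =ᶠ[𝒰] fun _ => 0 := by
      filter_upwards [heq] with t ht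
      have := congrArg (fun z => ε t * z) (ht v)
      simp only [mul_zero, mul_add, Finset.mul_sum] at this
      rw [← this]
      congr 1
      · refine Finset.sum_congr rfl fun i _ => ?_
        ring
      · ring
    have l3 := tendsto_nhds_unique (l1.congr' l2) tendsto_const_nhds
    rw [add_zero] at l3
    rw [Finset.sum_filter]
    refine Eq.trans ?_ l3
    refine Finset.sum_congr rfl fun i _ => ?_
    split_ifs with hi
    · rw [hv i hi]; field_simp
    · push Not at hi
      simp [hi]
  · push Not at h0
    by_cases hG : ∃ i, Tendsto (fun t => (a i (x t) + b i)⁻¹) 𝒰 (𝓝 0)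
    · exfalso
      have hF : ∀ i, ¬ Tendsto (fun t => (a i (x t) + b i)⁻¹) 𝒰 (𝓝 0) → ∃ c, Tendsto (fun t => a i (x t)) 𝒰 (𝓝 c) := by
        intro i hi
        obtain ⟨z0, hz⟩ := (uf_cases 𝒰 (fun t => a i (x t) + b i)).resolve_right hi
        exact ⟨z0 - b i, by simpa using hz.sub_const (b i)⟩
      choose! c hc using hF
      obtain ⟨p, p0, hp, hp0, hp2⟩ : ∃ (p : T → V) (p0 : V), (∀ t i, ¬ Tendsto (fun t => (a i (x t) + b i)⁻¹) 𝒰 (𝓝 0) →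
          a i (p t) = a i (x t)) ∧ Tendsto p 𝒰 (𝓝 p0) ∧ Tendsto (fun t => κ t * α (x t - p t)) 𝒰 (𝓝 0) := by
        by_cases ht : Tendsto (fun t => α (x t) + β) 𝒰 (𝓝 0)
        · obtain ⟨p, p0, h1, h2, _⟩ := lin_lift' a' {o | ∀ i, o = some i → ¬ Tendsto (fun t => (a i (x t) + b i)⁻¹) 𝒰 (𝓝 0)}
            (l := 𝒰) x (fun o => o.elim (-β) c) (by
              rintro (_ | i) hj
              · have := ht.sub_const β
                simp only [add_sub_cancel_right, zero_sub] at this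
                exact this
              · exact hc i (hj i rfl))
          refine ⟨p, p0, fun t i hi => h1 t (some i) (by rintro _ ⟨⟩; exact hi), h2, ?_⟩
          have : ∀ t, α (p t) = α (x t) := fun t => h1 t none (by rintro _ ⟨⟩)
          simp [this]
        · obtain ⟨p, p0, h1, h2, _⟩ := lin_lift' a {i | ¬ Tendsto (fun t => (a i (x t) + b i)⁻¹) 𝒰 (𝓝 0)} (l := 𝒰) x c (fun i hi => hc i hi)
          refine ⟨p, p0, fun t i hi => h1 t i hi, h2, ?_⟩
          have hk := uf_div 𝒰 κ _ ht hκ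
          have h3 : Tendsto (fun t => β + α (p t)) 𝒰 (𝓝 (β + α p0)) := ((α.continuous.tendsto _).comp h2).const_add β
          have h4 := hκ.sub (hk.mul h3)
          rw [zero_mul, sub_zero] at h4
          refine h4.congr fun t => ?_
          rw [map_sub]; ring
      obtain ⟨i0, hi0⟩ := hG
      refine hsum (Finset.univ.filter fun i => Tendsto (fun t => (a i (x t) + b i)⁻¹) 𝒰 (𝓝 0)) ⟨i0, by simpa using hi0⟩ ?_
      have l1 : Tendsto (fun t => ∑ i, u t i * a i (x t - p t) / (a i (x t) + b i) + κ t * α (x t - p t)) 𝒰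
        (𝓝 (∑ i, (if Tendsto (fun t => (a i (x t) + b i)⁻¹) 𝒰 (𝓝 0) then u0 i else 0) + 0)) := by
        refine (tendsto_finsetSum _ fun i _ => ?_).add hp2
        split_ifs with hi
        · have h5 : Tendsto (fun t => b i + a i (p t)) 𝒰 (𝓝 (b i + a i p0)) := (((a i).continuous.tendsto _).comp hp0).const_add _
          have h6 := (hu' i).mul ((h5.mul hi).const_sub 1)
          rw [mul_zero, sub_zero, mul_one] at h6
          refine h6.congr' ?_
          filter_upwards [hx] with t ht
          have := ht i
          rw [map_sub]
          field_simp
          ring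
        · have : ∀ t, a i (x t - p t) = 0 := fun t => by rw [map_sub, hp t i hi, sub_self]
          simp [this]
      have l2 : (fun t => ∑ i, u t i * a i (x t - p t) / (a i (x t) + b i) + κ t * α (x t - p t)) =ᶠ[𝒰] fun _ => 0 := by
        filter_upwards [heq] with t ht using ht _
      have l3 := tendsto_nhds_unique (l1.congr' l2) tendsto_const_nhds
      rw [add_zero] at l3
      rw [Finset.sum_filter, l3]
    · push Not at hG
      have hF : ∀ i, ∃ c, Tendsto (fun t => a i (x t) + b i) 𝒰 (𝓝 c) := fun i =>
        (uf_cases 𝒰 (fun t => a i (x t) + b i)).resolve_right (hG i)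
      choose c hc using hF
      obtain ⟨p, p0, h1, h2, h3⟩ := lin_lift' a Set.univ (l := 𝒰) x (fun i => c i - b i) (fun i _ => by
        simpa using (hc i).sub_const (b i))
      have hpx : p = x := by
        funext t
        rw [← sub_eq_zero]
        apply ess
        intro i
        rw [map_sub, h1 t i trivial, sub_self]
      rw [hpx] at h2
      refine ⟨p0, fun i hi => ?_, h2⟩
      apply h0 i
      rw [h3 i trivial] at hi
      have : c i = 0 := by linear_combination hi
      rw [← this]; exact hc i
end
end OT
end
end

section
open Filter Topology

noncomputable section
namespace OT

section
variable {P V E : Type} [NormedAddCommGroup P] [NormedSpace ℂ P] [FiniteDimensional ℂ P]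
  [NormedAddCommGroup V] [NormedSpace ℂ V] [FiniteDimensional ℂ V]
  [NormedAddCommGroup E] [NormedSpace ℂ E] [FiniteDimensional ℂ E]

lemma loc_uniq (F : P × V → E) (u0 : P) (z : V) (hz : F (u0, z) = 0) (F' : P × V →L[ℂ] E)
    (hF : HasStrictFDerivAt F F' (u0, z)) (hinj : ∀ v, F' (0, v) = 0 → v = 0)
    (hdim : Module.finrank ℂ V = Module.finrank ℂ E) (U : Set V) (hU : U ∈ 𝓝 z) :
    ∃ O ⊆ U, IsOpen O ∧ z ∈ O ∧ ∀ᶠ u in 𝓝 u0, ∃! x, x ∈ O ∧ F (u, x) = 0 := by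
  have : CompleteSpace P := FiniteDimensional.complete ℂ P
  have : CompleteSpace V := FiniteDimensional.complete ℂ V
  have : CompleteSpace E := FiniteDimensional.complete ℂ E
  have hinj' : Function.Injective (F' ∘L .inr ℂ P V) := by
    rw [injective_iff_map_eq_zero]
    intro v hv
    exact hinj v hv
  have hinv : (F' ∘L .inr ℂ P V).IsInvertible := by
    let e := LinearEquiv.ofInjectiveOfFinrankEq (F' ∘L .inr ℂ P V).toLinearMap hinj' hdim
    refine ⟨e.toContinuousLinearEquiv, ?_⟩
    ext v
    rfl
  have h1 := hF.eventually_apply_eq_iff_implicitFunctionOfProdDomain hinv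
  have h2 := hF.tendsto_implicitFunctionOfProdDomain hinv
  set ψ := hF.implicitFunctionOfProdDomain hinv
  rw [nhds_prod_eq, eventually_prod_iff] at h1
  obtain ⟨pa, ha, pb, hb, hab⟩ := h1
  obtain ⟨O, hO, hO2, hO3⟩ := mem_nhds_iff.1 (inter_mem hU hb)
  refine ⟨O, fun x hx => (hO hx).1, hO2, hO3, ?_⟩
  filter_upwards [ha, h2 (hO2.mem_nhds hO3)] with u hu hu2
  refine ⟨ψ u, ⟨hu2, ?_⟩, ?_⟩
  · have := (hab hu (hO hu2).2).2 rfl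
    exact this.trans hz
  · rintro x ⟨hx, hx2⟩
    exact ((hab hu (hO hx).2).1 (hx2.trans hz.symm)).symm

theorem loc_const (F : P × V → E) (Ω : Set V) (hΩ : IsOpen Ω) (u0 : P)
    (hdim : Module.finrank ℂ V = Module.finrank ℂ E)
    (hcont : ∀ x ∈ Ω, ContinuousAt F (u0, x))
    (hfin : {x | x ∈ Ω ∧ F (u0, x) = 0}.Finite)
    (hder : ∀ x ∈ Ω, F (u0, x) = 0 → ∃ F' : P × V →L[ℂ] E, HasStrictFDerivAt F F' (u0, x) ∧
      ∀ v, F' (0, v) = 0 → v = 0)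
    (hprop : ∀ 𝒰 : Ultrafilter (P × V), Tendsto Prod.fst (𝒰 : Filter (P × V)) (𝓝 u0) →
      (∀ᶠ p in (𝒰 : Filter (P × V)), p.2 ∈ Ω ∧ F p = 0) → ∃ x0 ∈ Ω, Tendsto Prod.snd (𝒰 : Filter (P × V)) (𝓝 x0)) :
    ∀ᶠ u in 𝓝 u0, {x | x ∈ Ω ∧ F (u, x) = 0}.Finite ∧
      {x | x ∈ Ω ∧ F (u, x) = 0}.ncard = {x | x ∈ Ω ∧ F (u0, x) = 0}.ncard := by
  set Z0 := {x | x ∈ Ω ∧ F (u0, x) = 0} with hZ0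
  obtain ⟨U, hU1, hU2⟩ := hfin.t2_separation
  have hloc : ∀ z ∈ Z0, ∃ O ⊆ U z ∩ Ω, IsOpen O ∧ z ∈ O ∧ ∀ᶠ u in 𝓝 u0, ∃! x, x ∈ O ∧ F (u, x) = 0 := by
    intro z hz
    obtain ⟨F', h1, h2⟩ := hder z hz.1 hz.2
    exact loc_uniq F u0 z hz.2 F' h1 h2 hdim _ (inter_mem ((hU1 z).2.mem_nhds (hU1 z).1) (hΩ.mem_nhds hz.1))
  choose! O hO1 hO2 hO3 hO4 using hloc
  have e1 : ∀ᶠ u in 𝓝 u0, ∀ z ∈ Z0, ∃! x, x ∈ O z ∧ F (u, x) = 0 :=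
    (hfin.eventually_all (p := fun z u => ∃! x, x ∈ O z ∧ F (u, x) = 0)).2 hO4
  have e2 : ∀ᶠ u in 𝓝 u0, ∀ x, x ∈ Ω → F (u, x) = 0 → ∃ z ∈ Z0, x ∈ O z := by
    by_contra hcon
    rw [not_eventually] at hcon
    let S : Set (P × V) := {p | p.2 ∈ Ω ∧ F p = 0 ∧ ¬ ∃ z ∈ Z0, p.2 ∈ O z}
    have hne : (comap Prod.fst (𝓝 u0) ⊓ 𝓟 S).NeBot := by
      rw [← frequently_mem_iff_neBot, frequently_comap]
      refine hcon.mono fun u hu => ?_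
      push Not at hu
      obtain ⟨x, h1, h2, h3⟩ := hu
      exact ⟨(u, x), rfl, h1, h2, by push Not; exact h3⟩
    obtain ⟨𝒰, h𝒰⟩ := Ultrafilter.exists_le (comap Prod.fst (𝓝 u0) ⊓ 𝓟 S)
    have t1 : Tendsto Prod.fst (𝒰 : Filter (P × V)) (𝓝 u0) :=
      tendsto_iff_comap.2 (h𝒰.trans inf_le_left)
    have t2 : ∀ᶠ p in (𝒰 : Filter (P × V)), p ∈ S := h𝒰.trans inf_le_right (mem_principal_self S)
    obtain ⟨x0, hx0, t3⟩ := hprop 𝒰 t1 (t2.mono fun p hp => ⟨hp.1, hp.2.1⟩)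
    have t4 : Tendsto (fun p : P × V => p) (𝒰 : Filter (P × V)) (𝓝 (u0, x0)) := t1.prodMk_nhds t3
    have t5 : F (u0, x0) = 0 := by
      refine tendsto_nhds_unique ((hcont x0 hx0).tendsto.comp t4) (tendsto_const_nhds.congr' ?_)
      filter_upwards [t2] with p hp using hp.2.1.symm
    have hz : x0 ∈ Z0 := ⟨hx0, t5⟩
    have t6 := t3 ((hO2 x0 hz).mem_nhds (hO3 x0 hz))
    obtain ⟨p, hp1, hp2⟩ := (t2.and t6).exists
    exact hp1.2.2 ⟨x0, hz, hp2⟩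
  filter_upwards [e1, e2] with u h1 h2
  choose! ψ hψ hψ2 using h1
  have himg : {x | x ∈ Ω ∧ F (u, x) = 0} = ψ '' Z0 := by
    ext x
    constructor
    · rintro ⟨hx, hx2⟩
      obtain ⟨z, hz, hxz⟩ := h2 x hx hx2
      exact ⟨z, hz, (hψ2 z hz x ⟨hxz, hx2⟩).symm⟩
    · rintro ⟨z, hz, rfl⟩
      exact ⟨(hO1 z hz (hψ z hz).1).2, (hψ z hz).2⟩
  rw [himg]
  refine ⟨hfin.image _, Set.InjOn.ncard_image ?_⟩
  intro z hz z' hz' h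
  by_contra hne
  have := hU2 hz hz' hne
  refine Set.disjoint_left.1 this (hO1 z hz (hψ z hz).1).1 ?_
  rw [h]
  exact (hO1 z' hz' (hψ z' hz').1).1
end
end OT
end
end

section
open Filter Topology

noncomputable section
namespace OT
set_option linter.unusedSectionVars false

section
variable {P V E : Type} [NormedAddCommGroup P] [NormedSpace ℂ P] [FiniteDimensional ℂ P]
  [NormedAddCommGroup V] [NormedSpace ℂ V] [FiniteDimensional ℂ V]
  [NormedAddCommGroup E] [NormedSpace ℂ E] [FiniteDimensional ℂ E]

theorem loc_fin (F : P × V → E) (Ω : Set V) (u0 : P)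
    (hdim : Module.finrank ℂ V = Module.finrank ℂ E)
    (hcont : ∀ x ∈ Ω, ContinuousAt F (u0, x))
    (hder : ∀ x ∈ Ω, F (u0, x) = 0 → ∃ F' : P × V →L[ℂ] E, HasStrictFDerivAt F F' (u0, x) ∧
      ∀ v, F' (0, v) = 0 → v = 0)
    (hprop : ∀ 𝒰 : Ultrafilter (P × V), Tendsto Prod.fst (𝒰 : Filter (P × V)) (𝓝 u0) →
      (∀ᶠ p in (𝒰 : Filter (P × V)), p.2 ∈ Ω ∧ F p = 0) → ∃ x0 ∈ Ω, Tendsto Prod.snd (𝒰 : Filter (P × V)) (𝓝 x0)) :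
    {x | x ∈ Ω ∧ F (u0, x) = 0}.Finite := by
  by_contra hinf
  have hne : (cofinite ⊓ 𝓟 {x | x ∈ Ω ∧ F (u0, x) = 0}).NeBot :=
    Set.Infinite.cofinite_inf_principal_neBot hinf
  obtain ⟨𝒰, h𝒰⟩ := Ultrafilter.exists_le (cofinite ⊓ 𝓟 {x | x ∈ Ω ∧ F (u0, x) = 0})
  have t2 : ∀ᶠ x in (𝒰 : Filter V), x ∈ Ω ∧ F (u0, x) = 0 := h𝒰.trans inf_le_right (mem_principal_self _)
  obtain ⟨x0, hx0, t3⟩ := hprop (𝒰.map fun x => (u0, x)) (by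
    rw [Ultrafilter.coe_map, tendsto_map'_iff]
    exact tendsto_const_nhds) (by
    rw [Ultrafilter.coe_map, eventually_map]
    exact t2)
  rw [Ultrafilter.coe_map, tendsto_map'_iff] at t3
  replace t3 : Tendsto (fun x => x) (𝒰 : Filter V) (𝓝 x0) := t3
  have t5 : F (u0, x0) = 0 := by
    refine tendsto_nhds_unique ((hcont x0 hx0).tendsto.comp ((tendsto_const_nhds (x := u0)).prodMk_nhds t3)) (tendsto_const_nhds.congr' ?_)
    filter_upwards [t2] with p hp using hp.2.symm
  obtain ⟨F', h1, h2⟩ := hder x0 hx0 t5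
  obtain ⟨O, -, hO, hxO, h3⟩ := loc_uniq F u0 x0 t5 F' h1 h2 hdim _ univ_mem
  have h4 := h3.self_of_nhds
  have t6 := t3 (hO.mem_nhds hxO)
  have t7 : ∀ᶠ x in (𝒰 : Filter V), x ≠ x0 := h𝒰.trans inf_le_left (by simp [mem_cofinite])
  obtain ⟨y, ⟨hy1, hy2⟩, hy3⟩ := ((t2.and t6).and t7).exists
  exact hy3 (h4.unique ⟨hy2, hy1.2⟩ ⟨hxO, t5⟩)
end

section
variable {V : Type} [NormedAddCommGroup V] [NormedSpace ℂ V] [FiniteDimensional ℂ V]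
  {ι : Type} [Fintype ι] (a : ι → V →L[ℂ] ℂ) (b : ι → ℂ)

def Xc : Set V := {x | ∀ i, a i x + b i ≠ 0}
def Sol (u : ι → ℂ) : Set V := {x | x ∈ Xc a b ∧ ∀ w, ∑ i, u i * a i w / (a i x + b i) = 0}
def Nondeg (u : ι → ℂ) (x : V) : Prop :=
  ∀ v, (∀ w, ∑ i, u i * a i v * a i w / (a i x + b i) ^ 2 = 0) → v = 0
def Ess : Prop := ∀ v, (∀ i, a i v = 0) → v = 0

lemma Xc_open : IsOpen (Xc a b) := by
  have : Xc a b = ⋂ i, {x | a i x + b i ≠ 0} := by ext; simp [Xc]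
  rw [this]
  refine isOpen_iInter_of_finite fun i => isOpen_ne_fun (by fun_prop) (by fun_prop)

def FF (α : V →L[ℂ] ℂ) (β : ℂ) (e : V) (p : ((ι → ℂ) × ℂ) × V) : V →L[ℂ] ℂ :=
  ∑ i, (p.1.1 i / (a i p.2 + b i)) • (a i + ((α p.2 + β - 1) * a i e) • α) + p.1.2 • α

lemma FF_apply (α : V →L[ℂ] ℂ) (β : ℂ) (e : V) (p : ((ι → ℂ) × ℂ) × V) (w : V) :
    FF a b α β e p w = ∑ i, (p.1.1 i / (a i p.2 + b i)) * (a i w + ((α p.2 + β - 1) * a i e) * α w)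
      + p.1.2 * α w := by
  simp [FF, mul_add]

def DD (α : V →L[ℂ] ℂ) (β : ℂ) (e : V) (u : ι → ℂ) (x v w : V) : ℂ :=
  ∑ i, (-(u i * a i v) / (a i x + b i) ^ 2 * (a i w + ((α x + β - 1) * a i e) * α w) +
    u i / (a i x + b i) * (α v * a i e * α w))

lemma FF_contDiffAt (α : V →L[ℂ] ℂ) (β : ℂ) (e : V) (p : ((ι → ℂ) × ℂ) × V) (hp : p.2 ∈ Xc a b) :
    ContDiffAt ℂ 1 (FF a b α β e) p := by
  unfold FF
  refine ContDiffAt.add (ContDiffAt.sum fun i _ => ?_) (by fun_prop)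
  have h1 : ContDiffAt ℂ 1 (fun p : ((ι → ℂ) × ℂ) × V => p.1.1 i) p := by fun_prop
  have h2 : ContDiffAt ℂ 1 (fun p : ((ι → ℂ) × ℂ) × V => a i p.2 + b i) p := by fun_prop
  have h3 : ContDiffAt ℂ 1 (fun p : ((ι → ℂ) × ℂ) × V => a i + ((α p.2 + β - 1) * a i e) • α) p := by fun_prop
  exact (h1.div h2 (hp i)).smul h3

lemma FF_deriv (α : V →L[ℂ] ℂ) (β : ℂ) (e : V) (u : ι → ℂ) (s : ℂ) (x : V) (hx : x ∈ Xc a b) :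
    ∃ F' : ((ι → ℂ) × ℂ) × V →L[ℂ] (V →L[ℂ] ℂ), HasStrictFDerivAt (FF a b α β e) F' ((u, s), x) ∧
      ∀ v w, F' (0, v) w = DD a b α β e u x v w := by
  have h1 := (FF_contDiffAt a b α β e ((u, s), x) hx).hasStrictFDerivAt one_ne_zero
  refine ⟨_, h1, fun v w => ?_⟩
  set F' := fderiv ℂ (FF a b α β e) ((u, s), x)
  have hl : HasDerivAt (fun ε : ℂ => (((u, s), x + ε • v) : ((ι → ℂ) × ℂ) × V)) (0, v) 0 := by
    refine (hasDerivAt_const (0 : ℂ) ((u, s) : (ι → ℂ) × ℂ)).prodMk ?_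
    simpa using ((hasDerivAt_id (0 : ℂ)).smul_const v).const_add x
  have h2 : HasDerivAt (fun ε : ℂ => FF a b α β e ((u, s), x + ε • v)) (F' (0, v)) 0 := by
    have h1' : HasFDerivAt (FF a b α β e) F' ((u, s), x + (0 : ℂ) • v) := by
      rw [zero_smul, add_zero]
      exact h1.hasFDerivAt
    exact HasFDerivAt.comp_hasDerivAt (0 : ℂ) h1' hl
  have h3 := ((ContinuousLinearMap.apply ℂ ℂ w).hasFDerivAt (x := FF a b α β e ((u, s), x + (0 : ℂ) • v))).comp_hasDerivAt (0 : ℂ) h2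
  refine h3.unique ?_
  have h4 : (fun ε : ℂ => FF a b α β e ((u, s), x + ε • v) w) = fun ε =>
    ∑ i, (u i / (a i x + b i + ε * a i v)) * (a i w + ((α x + β - 1 + ε * α v) * a i e) * α w)
      + s * α w := by
    funext ε
    rw [FF_apply]
    congr 1
    refine Finset.sum_congr rfl fun i _ => ?_
    simp only [map_add, map_smul, smul_eq_mul]
    ring_nf
  change HasDerivAt (fun ε : ℂ => FF a b α β e ((u, s), x + ε • v) w) _ 0
  rw [h4]
  refine HasDerivAt.add_const _ (HasDerivAt.fun_sum fun i _ => ?_)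
  have d1 : HasDerivAt (fun ε : ℂ => a i x + b i + ε * a i v) (a i v) 0 := by
    simpa using ((hasDerivAt_id (0 : ℂ)).mul_const (a i v)).const_add (a i x + b i)
  have d2 : HasDerivAt (fun ε : ℂ => a i w + ((α x + β - 1 + ε * α v) * a i e) * α w) (α v * a i e * α w) 0 := by
    simpa using (((((hasDerivAt_id (0 : ℂ)).mul_const (α v)).const_add (α x + β - 1)).mul_const (a i e)).mul_const (α w)).const_add (a i w)
  have d3 := ((hasDerivAt_const (0 : ℂ) (u i)).div d1 (by simpa using hx i)).mul d2
  refine HasDerivAt.congr_deriv d3 ?_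
  simp only [zero_mul, add_zero, zero_sub, Pi.div_apply]

theorem FF_loc (ess : Ess a) (α : V →L[ℂ] ℂ) (β : ℂ) (e : V) (hα : α e = 1 ∨ (α = 0 ∧ β = 0))
    (u0 : ι → ℂ) (hsum : ∀ F : Finset ι, F.Nonempty → ∑ i ∈ F, u0 i ≠ 0)
    (hnd : ∀ x ∈ Xc a b, FF a b α β e ((u0, 0), x) = 0 → ∀ v, (∀ w, DD a b α β e u0 x v w = 0) → v = 0) :
    {x | x ∈ Xc a b ∧ FF a b α β e ((u0, 0), x) = 0}.Finite ∧ ∀ᶠ p in 𝓝 (u0, (0 : ℂ)),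
      {x | x ∈ Xc a b ∧ FF a b α β e (p, x) = 0}.Finite ∧
      {x | x ∈ Xc a b ∧ FF a b α β e (p, x) = 0}.ncard = {x | x ∈ Xc a b ∧ FF a b α β e ((u0, 0), x) = 0}.ncard := by
  have hdim : Module.finrank ℂ V = Module.finrank ℂ (V →L[ℂ] ℂ) := by
    have e1 : (V →L[ℂ] ℂ) ≃ₗ[ℂ] (V →ₗ[ℂ] ℂ) := LinearMap.toContinuousLinearMap.symm
    rw [e1.finrank_eq]
    exact (Subspace.dual_finrank_eq (K := ℂ) (V := V)).symm
  have hcont : ∀ x ∈ Xc a b, ContinuousAt (FF a b α β e) ((u0, 0), x) := fun x hx =>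
    (FF_contDiffAt a b α β e ((u0, 0), x) hx).continuousAt
  have hder : ∀ x ∈ Xc a b, FF a b α β e ((u0, 0), x) = 0 → ∃ F' : ((ι → ℂ) × ℂ) × V →L[ℂ] (V →L[ℂ] ℂ),
      HasStrictFDerivAt (FF a b α β e) F' ((u0, 0), x) ∧ ∀ v, F' (0, v) = 0 → v = 0 := by
    intro x hx h
    obtain ⟨F', h1, h2⟩ := FF_deriv a b α β e u0 0 x hx
    refine ⟨F', h1, fun v hv => hnd x hx h v fun w => ?_⟩
    rw [← h2, hv]; rfl
  have hprop : ∀ 𝒰 : Ultrafilter (((ι → ℂ) × ℂ) × V), Tendsto Prod.fst (𝒰 : Filter (((ι → ℂ) × ℂ) × V)) (𝓝 (u0, (0 : ℂ))) →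
      (∀ᶠ p in (𝒰 : Filter (((ι → ℂ) × ℂ) × V)), p.2 ∈ Xc a b ∧ FF a b α β e p = 0) →
      ∃ x0 ∈ Xc a b, Tendsto Prod.snd (𝒰 : Filter (((ι → ℂ) × ℂ) × V)) (𝓝 x0) := by
    intro 𝒰 h1 h2
    have hK : ∀ᶠ p in (𝒰 : Filter (((ι → ℂ) × ℂ) × V)), ∀ w,
      ∑ i, p.1.1 i * a i w / (a i p.2 + b i) + (-∑ i, p.1.1 i * a i e / (a i p.2 + b i)) * α w = 0 ∧
      (-∑ i, p.1.1 i * a i e / (a i p.2 + b i)) * (α p.2 + β) = p.1.2 * α e := by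
      filter_upwards [h2] with p hp w
      have key : ∀ w, ∑ i, p.1.1 i * a i w / (a i p.2 + b i) + ((α p.2 + β - 1) * α w) * (∑ i, p.1.1 i * a i e / (a i p.2 + b i))  + p.1.2 * α w = 0 := by
        intro w
        have := congrArg (fun f : V →L[ℂ] ℂ => f w) hp.2
        simp only [FF_apply, zero_apply] at this
        rw [← this, Finset.mul_sum, ← Finset.sum_add_distrib]
        congr 1
        refine Finset.sum_congr rfl fun i _ => ?_
        ring
      rcases hα with hα | ⟨rfl, rfl⟩
      · have k1 := key e
        have k2 := key w
        rw [hα] at k1 ⊢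
        constructor
        · linear_combination k2 - α w * k1
        · linear_combination -k1
      · have k2 := key w
        simpa using k2
    have hu : Tendsto (fun p : ((ι → ℂ) × ℂ) × V => p.1.1) 𝒰 (𝓝 u0) := (continuous_fst.tendsto _).comp h1
    have hs : Tendsto (fun p : ((ι → ℂ) × ℂ) × V => p.1.2) 𝒰 (𝓝 0) := (continuous_snd.tendsto _).comp h1
    exact proper 𝒰 a b ess α β (fun p => -∑ i, p.1.1 i * a i e / (a i p.2 + b i)) (fun p => p.1.1) u0 hu hsum
      Prod.snd (h2.mono fun p hp => hp.1) (hK.mono fun p hp w => (hp w).1) (by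
        have := hs.mul_const (α e)
        rw [zero_mul] at this
        refine this.congr' ?_
        filter_upwards [hK] with p hp using (hp 0).2.symm)
  have hfin := loc_fin (FF a b α β e) (Xc a b) (u0, 0) hdim hcont hder hprop
  exact ⟨hfin, loc_const (FF a b α β e) (Xc a b) (Xc_open a b) (u0, 0) hdim hcont hfin hder hprop⟩

end
end OT
end
end

section
open Filter Topology

noncomputable section
namespace OT
set_option linter.unusedSectionVars false

section
variable {V : Type} [NormedAddCommGroup V] [NormedSpace ℂ V] [FiniteDimensional ℂ V]
  {ι : Type} [Fintype ι] (a : ι → V →L[ℂ] ℂ) (b : ι → ℂ)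

lemma FF_zero (u : ι → ℂ) (s : ℂ) : {x | x ∈ Xc a b ∧ FF a b 0 0 0 ((u, s), x) = 0} = Sol a b u := by
  ext x
  refine and_congr Iff.rfl ?_
  rw [ContinuousLinearMap.ext_iff]
  refine forall_congr' fun w => ?_
  rw [FF_apply]
  simp [div_mul_eq_mul_div]

theorem loc1 (ess : Ess a) (u0 : ι → ℂ) (hsum : ∀ F : Finset ι, F.Nonempty → ∑ i ∈ F, u0 i ≠ 0)
    (hnd : ∀ x ∈ Sol a b u0, Nondeg a b u0 x) :
    (Sol a b u0).Finite ∧ ∀ᶠ u in 𝓝 u0, (Sol a b u).ncard = (Sol a b u0).ncard := by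
  have h := FF_loc a b ess 0 0 0 (Or.inr ⟨rfl, rfl⟩) u0 hsum (by
    intro x hx h v hv
    have h1 : x ∈ Sol a b u0 := by rw [← FF_zero a b u0 0]; exact ⟨hx, h⟩
    refine hnd x h1 v fun w => ?_
    rw [← neg_eq_zero, ← hv w, DD, ← Finset.sum_neg_distrib]
    refine Finset.sum_congr rfl fun i _ => ?_
    simp
    ring)
  simp only [FF_zero] at h
  refine ⟨h.1, ?_⟩
  have hc : Tendsto (fun u : ι → ℂ => (u, (0 : ℂ))) (𝓝 u0) (𝓝 (u0, 0)) :=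
    Continuous.tendsto (by fun_prop) u0
  filter_upwards [hc.eventually h.2] with u hu
  exact hu.2

def sumPoly (ι : Type) [Fintype ι] : MvPolynomial ι ℂ :=
  open Classical in ∏ F ∈ (Finset.univ : Finset (Finset ι)).filter (fun F => F.Nonempty), ∑ i ∈ F, MvPolynomial.X i

lemma sumPoly_ne : sumPoly ι ≠ 0 := by
  classical
  rw [sumPoly, Finset.prod_ne_zero_iff]
  intro F hF h
  simp only [Finset.mem_filter, Finset.mem_univ, true_and] at hF
  have := congrArg (MvPolynomial.eval (fun _ => (1 : ℂ))) h
  simp at this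
  exact hF.ne_empty this

lemma sumPoly_eval (u : ι → ℂ) (h : MvPolynomial.eval u (sumPoly ι) ≠ 0) (F : Finset ι) (hF : F.Nonempty) :
    ∑ i ∈ F, u i ≠ 0 := by
  classical
  rw [sumPoly, map_prod, Finset.prod_ne_zero_iff] at h
  have := h F (by simpa using hF)
  simpa using this

lemma poly_line (g : MvPolynomial ι ℂ) (u0 v : ι → ℂ) (h0 : MvPolynomial.eval u0 g ≠ 0) :
    {z : ℂ | MvPolynomial.eval (u0 + z • v) g = 0}.Finite := by
  set q : Polynomial ℂ := MvPolynomial.aeval (fun i => Polynomial.C (u0 i) + Polynomial.X * Polynomial.C (v i)) g with hq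
  have he : ∀ z, q.eval z = MvPolynomial.eval (u0 + z • v) g := by
    intro z
    rw [hq, MvPolynomial.aeval_def, ← Polynomial.coe_evalRingHom, MvPolynomial.eval₂_eq_eval_map,
      MvPolynomial.eval_map, MvPolynomial.hom_eval₂, MvPolynomial.eval]
    congr 1
    · ext z; simp
    · funext i; simp; ring
  have hq0 : q ≠ 0 := by
    rintro h
    have := he 0
    rw [h] at this
    simp at this
    exact h0 this.symm
  refine (Polynomial.finite_setOfPred_isRoot hq0).subset fun z hz => ?_
  rw [Set.mem_ofPred_eq, Polynomial.IsRoot, he]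
  exact hz

lemma exists_nonroot (g : MvPolynomial ι ℂ) (hg : g ≠ 0) : ∃ u, MvPolynomial.eval u g ≠ 0 := by
  by_contra! h
  exact hg (MvPolynomial.funext fun u => by simp [h u])

theorem const_count (ess : Ess a) (g : MvPolynomial ι ℂ) (hg : g ≠ 0)
    (hnd : ∀ u, MvPolynomial.eval u g ≠ 0 → ∀ x ∈ Sol a b u, Nondeg a b u x) :
    ∃ N : ℕ, ∃ g' : MvPolynomial ι ℂ, g' ≠ 0 ∧ ∀ u, MvPolynomial.eval u g' ≠ 0 →
      (Sol a b u).Finite ∧ (Sol a b u).ncard = N ∧ ∀ x ∈ Sol a b u, Nondeg a b u x := by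
  obtain ⟨u0, hu0⟩ := exists_nonroot (g * sumPoly ι) (mul_ne_zero hg sumPoly_ne)
  have key : ∀ u, MvPolynomial.eval u (g * sumPoly ι) ≠ 0 → (Sol a b u).Finite ∧ ∀ᶠ u' in 𝓝 u, (Sol a b u').ncard = (Sol a b u).ncard := by
    intro u hu
    rw [map_mul] at hu
    exact loc1 a b ess u (sumPoly_eval u (right_ne_zero_of_mul hu)) (hnd u (left_ne_zero_of_mul hu))
  refine ⟨(Sol a b u0).ncard, g * sumPoly ι, mul_ne_zero hg sumPoly_ne, fun u hu => ⟨(key u hu).1, ?_,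
    hnd u (by rw [map_mul] at hu; exact left_ne_zero_of_mul hu)⟩⟩
  have hfin := poly_line (g * sumPoly ι) u0 (u - u0) hu0
  have hconn := (hfin.countable.isPathConnected_compl_of_one_lt_rank (by
    rw [Complex.rank_real_complex]; norm_num)).isConnected.isPreconnected
  have hcont : ContinuousOn (fun z : ℂ => (Sol a b (u0 + z • (u - u0))).ncard) {z : ℂ | MvPolynomial.eval (u0 + z • (u - u0)) (g * sumPoly ι) = 0}ᶜ := by
    intro z hz
    refine ContinuousAt.continuousWithinAt ?_
    refine tendsto_const_nhds.congr' ?_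
    have hc : Tendsto (fun z : ℂ => u0 + z • (u - u0)) (𝓝 z) (𝓝 (u0 + z • (u - u0))) :=
      Continuous.tendsto (by fun_prop) z
    filter_upwards [hc.eventually (key _ hz).2] with z' hz'
    exact hz'.symm
  have := hconn.constant hcont (x := 1) (y := 0) (by simpa using hu) (by simpa using hu0)
  simpa using this

end
end OT
end
end

section
open Filter Topology

noncomputable section
namespace OT
set_option linter.unusedSectionVars false

section
variable {V : Type} [NormedAddCommGroup V] [NormedSpace ℂ V] [FiniteDimensional ℂ V]
  {ι : Type} [Fintype ι]

/-- Full arrangement from a deleted arrangement and one more hyperplane. -/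
abbrev KerT (α : V →L[ℂ] ℂ) : Submodule ℂ V := LinearMap.ker α.toLinearMap

def ra (a : ι → V →L[ℂ] ℂ) (α : V →L[ℂ] ℂ) : ι → (KerT α →L[ℂ] ℂ) := fun i => (a i).comp (KerT α).subtypeL
def rb (a : ι → V →L[ℂ] ℂ) (b : ι → ℂ) (p0 : V) : ι → ℂ := fun i => a i p0 + b i

lemma ra_ell (a : ι → V →L[ℂ] ℂ) (b : ι → ℂ) (α : V →L[ℂ] ℂ) (p0 : V) (i : ι) (y : KerT α) :
    ra a α i y + rb a b p0 i = a i (p0 + y) + b i := by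
  simp [ra, rb]; ring

lemma FF_zero_iff (a : ι → V →L[ℂ] ℂ) (b : ι → ℂ) (α : V →L[ℂ] ℂ) (β : ℂ) (e : V) (he : α e = 1)
    (u : ι → ℂ) (s : ℂ) (x : V) : FF a b α β e ((u, s), x) = 0 ↔
      ((∑ i, u i * a i e / (a i x + b i)) * (α x + β) + s = 0 ∧
       ∀ w, ∑ i, u i * a i w / (a i x + b i) = (∑ i, u i * a i e / (a i x + b i)) * α w) := by
  have key : ∀ w, FF a b α β e ((u, s), x) w =
      ∑ i, u i * a i w / (a i x + b i) + ((α x + β - 1) * α w) * (∑ i, u i * a i e / (a i x + b i)) + s * α w := by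
    intro w
    rw [FF_apply, Finset.mul_sum, ← Finset.sum_add_distrib]
    congr 1
    refine Finset.sum_congr rfl fun i _ => ?_
    ring
  rw [ContinuousLinearMap.ext_iff]
  simp only [key, zero_apply]
  constructor
  · intro h
    have h1 := h e
    rw [he] at h1
    refine ⟨by linear_combination h1, fun w => ?_⟩
    linear_combination h w - α w * h1
  · rintro ⟨h1, h2⟩ w
    rw [h2 w]
    linear_combination α w * h1

theorem degen (a : ι → V →L[ℂ] ℂ) (b : ι → ℂ) (α : V →L[ℂ] ℂ) (β : ℂ) (e : V) (he : α e = 1)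
    (ess : Ess a) (u0 : ι → ℂ) (hsum : ∀ F : Finset ι, F.Nonempty → ∑ i ∈ F, u0 i ≠ 0)
    (h1 : ∀ x ∈ Sol a b u0, Nondeg a b u0 x ∧ α x + β ≠ 0)
    (p0 : V) (hp0 : α p0 + β = 0)
    (h2 : ∀ y ∈ Sol (ra a α) (rb a b p0) u0, Nondeg (ra a α) (rb a b p0) u0 y) :
    ∀ᶠ p in 𝓝 (u0, (0 : ℂ)), p.2 ≠ 0 →
      (Sol (fun o : Option ι => o.elim α a) (fun o => o.elim β b) (fun o => o.elim p.2 p.1)).ncard =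
      (Sol a b u0).ncard + (Sol (ra a α) (rb a b p0) u0).ncard := by
  have hz : {x | x ∈ Xc a b ∧ FF a b α β e ((u0, 0), x) = 0} =
      Sol a b u0 ∪ (fun y : KerT α => p0 + (y : V)) '' Sol (ra a α) (rb a b p0) u0 := by
    ext x
    rw [Set.mem_ofPred_eq, FF_zero_iff a b α β e he]
    constructor
    · rintro ⟨hx, hK, hw⟩
      rw [add_zero, mul_eq_zero] at hK
      rcases hK with hK | hK
      · left
        refine ⟨hx, fun w => ?_⟩
        rw [hw w, hK, zero_mul]
      · right
        have hk : x - p0 ∈ KerT α := by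
          rw [LinearMap.mem_ker]
          simp only [ContinuousLinearMap.coe_coe, map_sub]
          linear_combination hK - hp0
        refine ⟨⟨x - p0, hk⟩, ⟨fun i => ?_, fun w => ?_⟩, by simp⟩
        · rw [ra_ell]
          simpa using hx i
        · simp only [ra_ell]
          have := hw w
          have hw0 : α (w : V) = 0 := w.2
          rw [hw0, mul_zero] at this
          simpa [ra] using this
    · rintro (⟨hx, hw⟩ | ⟨y, ⟨hy, hw⟩, rfl⟩)
      · refine ⟨hx, ?_, ?_⟩
        · rw [hw e]; simp
        · intro w; rw [hw w, hw e, zero_mul]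
      · refine ⟨fun i => ?_, ?_, ?_⟩
        · have := hy i
          rwa [ra_ell] at this
        · have hy0 : α (y : V) = 0 := y.2
          simp [hy0, hp0]
        · intro w
          have hk : w - α w • e ∈ KerT α := by
            rw [LinearMap.mem_ker]
            simp [he]
          have := hw ⟨_, hk⟩
          simp only [ra_ell] at this
          simp only [ra, ContinuousLinearMap.comp_apply, Submodule.subtypeL_apply, map_sub, map_smul, smul_eq_mul] at this
          rw [← sub_eq_zero, ← this, Finset.sum_mul, ← Finset.sum_sub_distrib]
          refine Finset.sum_congr rfl fun i _ => ?_
          ring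
  have hnd : ∀ x ∈ Xc a b, FF a b α β e ((u0, 0), x) = 0 → ∀ v, (∀ w, DD a b α β e u0 x v w = 0) → v = 0 := by
    intro x hx hx0 v hv
    have hzx : x ∈ {x | x ∈ Xc a b ∧ FF a b α β e ((u0, 0), x) = 0} := ⟨hx, hx0⟩
    set B : V → ℂ := fun w => ∑ i, u0 i * a i v * a i w / (a i x + b i) ^ 2 with hB
    set K := ∑ i, u0 i * a i e / (a i x + b i) with hK
    have hDD : ∀ w, -(B w + (α x + β - 1) * B e * α w) + K * α v * α w = 0 := by
      intro w
      rw [← hv w, DD, hB, hK]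
      simp only [Finset.mul_sum, Finset.sum_mul]
      rw [← Finset.sum_add_distrib, ← Finset.sum_neg_distrib, ← Finset.sum_add_distrib]
      refine Finset.sum_congr rfl fun i _ => ?_
      ring
    have hBe := hDD e
    rw [he] at hBe
    have hBw : ∀ w, B w = B e * α w := by
      intro w
      linear_combination α w * hBe - hDD w
    rw [hz] at hzx
    rw [FF_zero_iff a b α β e he] at hx0
    by_cases hK0 : K = 0
    · have hs : x ∈ Sol a b u0 := ⟨hx, fun w => by rw [hx0.2 w, ← hK, hK0, zero_mul]⟩
      refine (h1 x hs).1 v fun w => ?_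
      have : B e = 0 := by
        have h3 : (α x + β) * B e = 0 := by rw [hK0] at hBe; linear_combination -hBe
        exact (mul_eq_zero.1 h3).resolve_left (h1 x hs).2
      change B w = 0
      rw [hBw, this, zero_mul]
    · rcases hzx with hs | ⟨y, hy, rfl⟩
      · exact absurd (hs.2 e) hK0
      · have hy0 : α (y : V) = 0 := y.2
        have ht : α (p0 + (y : V)) + β = 0 := by rw [map_add, hy0, add_zero, hp0]
        have hv0 : α v = 0 := by
          have h3 : K * α v = 0 := by rw [ht] at hBe; linear_combination hBe
          exact (mul_eq_zero.1 h3).resolve_left hK0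
        have := h2 y hy ⟨v, hv0⟩ fun w => by
          have hw0 : α (w : V) = 0 := w.2
          have h3 := hBw w
          rw [hw0, mul_zero] at h3
          simp only [ra_ell]
          exact h3
        exact congrArg Subtype.val this
  obtain ⟨hfin, hev⟩ := FF_loc a b ess α β e (Or.inl he) u0 hsum hnd
  filter_upwards [hev] with p hp hp2
  have hs : {x | x ∈ Xc a b ∧ FF a b α β e (p, x) = 0} =
    Sol (fun o : Option ι => o.elim α a) (fun o => o.elim β b) (fun o => o.elim p.2 p.1) := by
    ext x
    rw [Set.mem_ofPred_eq, FF_zero_iff a b α β e he]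
    simp only [Sol, Xc, Set.mem_ofPred_eq, Option.forall, Fintype.sum_option, Option.elim_none, Option.elim_some]
    constructor
    · rintro ⟨hx, hK, hw⟩
      have ht : α x + β ≠ 0 := by
        intro h
        rw [h, mul_zero, zero_add] at hK
        exact hp2 hK
      refine ⟨⟨ht, hx⟩, fun w => ?_⟩
      rw [hw w]
      field_simp
      linear_combination α w * hK
    · rintro ⟨⟨ht, hx⟩, hw⟩
      have hK := hw e
      rw [he] at hK
      refine ⟨hx, ?_, fun w => ?_⟩
      · field_simp at hK
        linear_combination hK
      · linear_combination hw w - α w * hK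
  rw [hz] at hfin
  rw [← hs, hp.2, hz, Set.ncard_union_eq ?_ (hfin.subset Set.subset_union_left)
    (hfin.subset Set.subset_union_right), Set.InjOn.ncard_image]
  · intro y _ y' _ h
    exact Subtype.ext (add_left_cancel h)
  · rw [Set.disjoint_left]
    rintro x hx ⟨y, hy, rfl⟩
    have hy0 : α (y : V) = 0 := y.2
    exact (h1 _ hx).2 (by rw [map_add, hy0, add_zero, hp0])
end
end OT
end
end

section
open Filter Topology

noncomputable section
namespace OT
set_option linter.unusedSectionVars false

section
variable {σ τ : Type} [Fintype σ] [Fintype τ] (hc : Fintype.card σ = Fintype.card τ)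
  (f : τ → MvPolynomial σ ℂ)

lemma eval_comp (g : MvPolynomial τ ℂ) (z : σ → ℂ) :
    MvPolynomial.eval z (MvPolynomial.aeval f g) = MvPolynomial.eval (fun i => MvPolynomial.eval z (f i)) g := by
  rw [← MvPolynomial.coe_aeval_eq_eval, ← MvPolynomial.coe_aeval_eq_eval]
  simp only [RingHom.coe_coe]
  rw [← AlgHom.comp_apply, MvPolynomial.comp_aeval]

lemma prime_gen (hc : Fintype.card σ = Fintype.card τ) (π : MvPolynomial σ ℂ) (hπ : Prime π) :
    ∃ g : MvPolynomial τ ℂ, g ≠ 0 ∧ ∀ z, MvPolynomial.eval z π = 0 →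
      MvPolynomial.eval (fun i => MvPolynomial.eval z (f i)) g = 0 := by
  have hP : (Ideal.span {π}).IsPrime := (Ideal.span_singleton_prime hπ.ne_zero).2 hπ
  let S := MvPolynomial σ ℂ ⧸ Ideal.span {π}
  have : IsDomain S := Ideal.Quotient.isDomain _
  let q : MvPolynomial σ ℂ →ₐ[ℂ] S := Ideal.Quotient.mkₐ ℂ _
  have hdep : ¬ AlgebraicIndependent ℂ (fun i => q (f i)) := by
    intro hind
    have h1 := hind.cardinalMk_le_trdeg
    let x : σ → S := fun j => q (MvPolynomial.X j)
    have hx : Algebra.adjoin ℂ (Set.range x) = ⊤ := by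
      have : Set.range x = q '' Set.range MvPolynomial.X := by
        rw [← Set.range_comp]; rfl
      rw [this, ← AlgHom.map_adjoin, MvPolynomial.adjoin_range_X, Algebra.map_top, AlgHom.range_eq_top]
      exact Ideal.Quotient.mkₐ_surjective ℂ _
    have halg : Algebra.IsAlgebraic (Algebra.adjoin ℂ (Set.range x)) S := by
      constructor
      intro y
      have hy : y ∈ Algebra.adjoin ℂ (Set.range x) := by rw [hx]; trivial
      exact isAlgebraic_algebraMap (⟨y, hy⟩ : Algebra.adjoin ℂ (Set.range x))
    have h2 := Algebra.IsAlgebraic.isTranscendenceBasis_of_le_trdeg_of_finite ℂ x (by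
      refine le_trans ?_ h1
      simp [hc])
    have h3 : MvPolynomial.aeval x π = 0 := by
      have : MvPolynomial.aeval x = q := by
        ext j; simp [x]
      rw [this]
      exact Ideal.Quotient.eq_zero_iff_mem.2 (Ideal.mem_span_singleton_self π)
    exact hπ.ne_zero ((injective_iff_map_eq_zero _).1 h2.1 π h3)
  rw [AlgebraicIndependent, injective_iff_map_eq_zero] at hdep
  push Not at hdep
  obtain ⟨g, hg, hg0⟩ := hdep
  refine ⟨g, hg0, fun z hz => ?_⟩
  rw [← eval_comp]
  have : MvPolynomial.aeval (fun i => q (f i)) = q.comp (MvPolynomial.aeval f) := by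
    rw [MvPolynomial.comp_aeval]
  rw [this] at hg
  have hm : MvPolynomial.aeval f g ∈ Ideal.span {π} := Ideal.Quotient.eq_zero_iff_mem.1 hg
  obtain ⟨c, hc⟩ := Ideal.mem_span_singleton.1 hm
  rw [hc, map_mul, hz, zero_mul]

lemma B1 (hc : Fintype.card σ = Fintype.card τ) (h : MvPolynomial σ ℂ) (hh : h ≠ 0) :
    ∃ g : MvPolynomial τ ℂ, g ≠ 0 ∧ ∀ z, MvPolynomial.eval z h = 0 →
      MvPolynomial.eval (fun i => MvPolynomial.eval z (f i)) g = 0 := by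
  induction h using UniqueFactorizationMonoid.induction_on_prime with
  | h₁ => exact absurd rfl hh
  | h₂ x hx => exact ⟨1, one_ne_zero, fun z hz => absurd hz ((hx.map (MvPolynomial.eval z)).ne_zero)⟩
  | h₃ a p ha hp ih =>
    obtain ⟨g1, h1, h2⟩ := ih ha
    obtain ⟨g2, h3, h4⟩ := prime_gen f hc p hp
    refine ⟨g1 * g2, mul_ne_zero h1 h3, fun z hz => ?_⟩
    rw [map_mul, mul_eq_zero] at hz ⊢
    rcases hz with hz | hz
    · exact Or.inr (h4 z hz)
    · exact Or.inl (h2 z hz)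

def dual (z δ : σ → ℂ) : MvPolynomial σ ℂ →ₐ[ℂ] TrivSqZeroExt ℂ ℂ :=
  MvPolynomial.aeval fun j => TrivSqZeroExt.inl (z j) + TrivSqZeroExt.inr (δ j)

lemma sep_lem (hf : AlgebraicIndependent ℂ f) (hc : Fintype.card σ = Fintype.card τ) (j : σ) :
    ∃ h : MvPolynomial σ ℂ, h ≠ 0 ∧ ∀ z, MvPolynomial.eval z h ≠ 0 → ∀ δ : σ → ℂ,
      (∀ i, dual z δ (f i) = TrivSqZeroExt.inl (MvPolynomial.eval z (f i))) → δ j = 0 := by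
  have htb : IsTranscendenceBasis ℂ f := hf.isTranscendenceBasis_of_trdeg_le_of_finite (by
    rw [MvPolynomial.trdeg_of_isDomain]; simp [hc])
  have halg := htb.isAlgebraic
  set S0 := Algebra.adjoin ℂ (Set.range f) with hS0
  have hex : ∃ n, ∃ p : Polynomial S0, p ≠ 0 ∧ Polynomial.aeval (MvPolynomial.X j : MvPolynomial σ ℂ) p = 0 ∧ p.natDegree = n := by
    obtain ⟨p, hp, hp2⟩ := halg.isAlgebraic (MvPolynomial.X j)
    exact ⟨_, p, hp, hp2, rfl⟩
  classical
  obtain ⟨p, hp0, hp1, hp2⟩ := Nat.find_spec hex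
  have hmin := fun m (hm : m < Nat.find hex) => Nat.find_min hex hm
  rw [← hp2] at hmin
  have hdeg : 0 < p.natDegree := by
    by_contra hd
    have hd0 : p.natDegree = 0 := by omega
    rw [Polynomial.natDegree_eq_zero] at hd0
    obtain ⟨c, rfl⟩ := hd0
    rw [Polynomial.aeval_C] at hp1
    apply hp0
    have : c = 0 := Subtype.ext hp1
    rw [this, map_zero]
  have hd0 : Polynomial.derivative p ≠ 0 := by
    intro h
    have := Polynomial.derivative_eq_zero.1 h
    omega
  have hd1 : Polynomial.aeval (MvPolynomial.X j : MvPolynomial σ ℂ) (Polynomial.derivative p) ≠ 0 := by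
    intro h
    exact hmin _ (Polynomial.natDegree_derivative_lt hdeg.ne') ⟨_, hd0, h, rfl⟩
  refine ⟨_, hd1, fun z hz δ hδ => ?_⟩
  let ev : S0 →+* ℂ := (MvPolynomial.eval z).comp (algebraMap S0 (MvPolynomial σ ℂ))
  have hφ : (dual z δ : MvPolynomial σ ℂ →+* TrivSqZeroExt ℂ ℂ).comp (algebraMap S0 (MvPolynomial σ ℂ)) =
      (algebraMap ℂ (TrivSqZeroExt ℂ ℂ)).comp ev := by
    have hsub : S0 ≤ AlgHom.equalizer (dual z δ) ((Algebra.ofId ℂ (TrivSqZeroExt ℂ ℂ)).comp (MvPolynomial.aeval z)) := by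
      rw [hS0, Algebra.adjoin_le_iff]
      rintro _ ⟨i, rfl⟩
      change dual z δ (f i) = _
      rw [hδ i]
      rfl
    ext1 c
    exact hsub c.2
  have hX : dual z δ (MvPolynomial.X j) = TrivSqZeroExt.inl (z j) + TrivSqZeroExt.inr (δ j) := by
    simp [dual]
  have key := congrArg (dual z δ) hp1
  rw [map_zero, Polynomial.aeval_def, ← AlgHom.coe_toRingHom, Polynomial.hom_eval₂, AlgHom.coe_toRingHom] at key
  change Polynomial.eval₂ ((dual z δ : MvPolynomial σ ℂ →+* TrivSqZeroExt ℂ ℂ).comp (algebraMap S0 (MvPolynomial σ ℂ))) _ p = 0 at key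
  rw [hφ, hX, ← Polynomial.eval₂_map, ← Polynomial.aeval_def, Polynomial.aeval_add_of_sq_eq_zero _ _ _ (by
    rw [sq, TrivSqZeroExt.inr_mul_inr])] at key
  have h1 : (TrivSqZeroExt.inl (z j) : TrivSqZeroExt ℂ ℂ) = algebraMap ℂ _ (z j) := rfl
  rw [h1, Polynomial.aeval_algebraMap_apply, Polynomial.aeval_algebraMap_apply] at key
  have k2 := congrArg TrivSqZeroExt.snd key
  simp only [TrivSqZeroExt.snd_add, TrivSqZeroExt.snd_mul, TrivSqZeroExt.algebraMap_eq_inl, TrivSqZeroExt.snd_inl,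
    TrivSqZeroExt.fst_inl, TrivSqZeroExt.snd_inr, TrivSqZeroExt.fst_inr, TrivSqZeroExt.snd_zero] at k2
  simp at k2
  refine k2.resolve_left ?_
  intro h
  apply hz
  rw [Polynomial.aeval_def, Polynomial.hom_eval₂, MvPolynomial.eval_X]
  rw [Polynomial.eval_map] at h
  exact h

lemma B2 (hc : Fintype.card σ = Fintype.card τ) :
    ∃ g : MvPolynomial τ ℂ, g ≠ 0 ∧ ∀ z, MvPolynomial.eval (fun i => MvPolynomial.eval z (f i)) g ≠ 0 →
      ∀ δ : σ → ℂ,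
      (∀ i, dual z δ (f i) = TrivSqZeroExt.inl (MvPolynomial.eval z (f i))) → δ = 0 := by
  by_cases hf : AlgebraicIndependent ℂ f
  · choose h h0 h1 using sep_lem f hf hc
    obtain ⟨g, hg, hg2⟩ := B1 f hc (∏ j, h j) (Finset.prod_ne_zero_iff.2 fun j _ => h0 j)
    refine ⟨g, hg, fun z hz δ hδ => ?_⟩
    have h2 : MvPolynomial.eval z (∏ j, h j) ≠ 0 := fun h3 => hz (hg2 z h3)
    rw [map_prod, Finset.prod_ne_zero_iff] at h2
    funext j
    exact h1 j z (h2 j (Finset.mem_univ j)) δ hδ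
  · rw [AlgebraicIndependent, injective_iff_map_eq_zero] at hf
    push Not at hf
    obtain ⟨g, hg, hg0⟩ := hf
    refine ⟨g, hg0, fun z hz => absurd ?_ hz⟩
    rw [← eval_comp, hg, map_zero]
end
end OT
end
end

section
open Filter Topology

noncomputable section
namespace OT
set_option linter.unusedSectionVars false

section
variable {W : Type} [AddCommGroup W] [Module ℂ W] {σ : Type} [Fintype σ] (B : Module.Basis σ ℂ W)

def linP (φ : W →ₗ[ℂ] ℂ) : MvPolynomial σ ℂ := ∑ j, MvPolynomial.C (φ (B j)) * MvPolynomial.X j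

lemma linP_eval (φ : W →ₗ[ℂ] ℂ) (p : W) : MvPolynomial.eval (B.equivFun p) (linP B φ) = φ p := by
  conv_rhs => rw [← B.sum_equivFun p]
  rw [linP, map_sum, map_sum]
  refine Finset.sum_congr rfl fun i _ => ?_
  rw [map_mul, MvPolynomial.eval_C, MvPolynomial.eval_X, map_smul, smul_eq_mul, mul_comm]

lemma linP_dual (φ : W →ₗ[ℂ] ℂ) (p q : W) : dual (B.equivFun p) (B.equivFun q) (linP B φ) =
    TrivSqZeroExt.inl (φ p) + TrivSqZeroExt.inr (φ q) := by
  conv_rhs => rw [← B.sum_equivFun p, ← B.sum_equivFun q]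
  have h : ∀ c : ℂ, dual (B.equivFun p) (B.equivFun q) (MvPolynomial.C c) = TrivSqZeroExt.inl c := fun c =>
    AlgHom.commutes (dual (B.equivFun p) (B.equivFun q)) c
  have h2 : ∀ j, dual (B.equivFun p) (B.equivFun q) (MvPolynomial.X j) =
    TrivSqZeroExt.inl (B.equivFun p j) + TrivSqZeroExt.inr (B.equivFun q j) := fun j => by simp [dual]
  rw [linP, map_sum]
  simp only [map_mul, h, h2, map_sum, map_smul, smul_eq_mul]
  ext
  · simp only [TrivSqZeroExt.fst_sum, TrivSqZeroExt.fst_mul, TrivSqZeroExt.fst_add, TrivSqZeroExt.fst_inl, TrivSqZeroExt.fst_inr, add_zero]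
    exact Finset.sum_congr rfl fun i _ => mul_comm _ _
  · simp only [TrivSqZeroExt.snd_sum, TrivSqZeroExt.snd_mul, TrivSqZeroExt.snd_add, TrivSqZeroExt.fst_inl, TrivSqZeroExt.snd_inl, TrivSqZeroExt.snd_inr, zero_add]
    refine Finset.sum_congr rfl fun i _ => ?_
    simp [mul_comm]
end

section
variable {V : Type} [NormedAddCommGroup V] [NormedSpace ℂ V] [FiniteDimensional ℂ V]
  {ι : Type} [Fintype ι] (a : ι → V →L[ℂ] ℂ) (b : ι → ℂ)

def RelS : Submodule ℂ (ι → ℂ) where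
  carrier := {c | ∀ w, ∑ i, c i * a i w = 0}
  add_mem' := by
    intro c c' h h' w
    simp only [Pi.add_apply, add_mul, Finset.sum_add_distrib]
    rw [h w, h' w, add_zero]
  zero_mem' := by intro w; simp
  smul_mem' := by
    intro r c h w
    simp only [Pi.smul_apply, smul_eq_mul, mul_assoc, ← Finset.mul_sum]
    rw [h w, mul_zero]

lemma RelS_dim (ess : Ess a) : Module.finrank ℂ V + Module.finrank ℂ (RelS a) = Fintype.card ι := by
  classical
  let bV := Module.finBasis ℂ V
  let A : Matrix ι (Fin (Module.finrank ℂ V)) ℂ := Matrix.of fun i k => a i (bV k)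
  have hker : LinearMap.ker A.transpose.mulVecLin = RelS a := by
    ext c
    rw [LinearMap.mem_ker]
    constructor
    · intro h w
      rw [← bV.sum_equivFun w]
      simp only [map_sum, map_smul, smul_eq_mul, Finset.mul_sum]
      rw [Finset.sum_comm]
      refine Finset.sum_eq_zero fun k _ => ?_
      have := congrFun h k
      simp only [Matrix.mulVecLin_apply, Matrix.mulVec, dotProduct, Matrix.transpose_apply, A, Matrix.of_apply, Pi.zero_apply] at this
      calc _ = bV.equivFun w k * ∑ i, a i (bV k) * c i := by
            rw [Finset.mul_sum]; exact Finset.sum_congr rfl fun i _ => by ring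
        _ = 0 := by rw [this, mul_zero]
    · intro h
      funext k
      have := h (bV k)
      simp only [Matrix.mulVecLin_apply, Matrix.mulVec, dotProduct, Matrix.transpose_apply, A, Matrix.of_apply, Pi.zero_apply]
      rw [← this]
      exact Finset.sum_congr rfl fun i _ => by ring
  have hinj : Function.Injective A.mulVecLin := by
    rw [injective_iff_map_eq_zero]
    intro c hc
    have h0 : bV.equivFun.symm c = 0 := by
      refine ess _ fun i => ?_
      have := congrFun hc i
      simp only [Matrix.mulVecLin_apply, Matrix.mulVec, dotProduct, A, Matrix.of_apply, Pi.zero_apply] at this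
      rw [Module.Basis.equivFun_symm_apply, map_sum, ← this]
      exact Finset.sum_congr rfl fun k _ => by rw [map_smul, smul_eq_mul, mul_comm]
    exact (LinearEquiv.map_eq_zero_iff _).1 h0
  have h1 : A.rank = Module.finrank ℂ V := by
    rw [Matrix.rank, LinearMap.finrank_range_of_inj hinj]
    simp
  have h2 := LinearMap.finrank_range_add_finrank_ker A.transpose.mulVecLin
  rw [hker] at h2
  have h3 : Module.finrank ℂ (LinearMap.range A.transpose.mulVecLin) = Module.finrank ℂ V := by
    refine Eq.trans ?_ h1
    exact Matrix.rank_transpose A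
  rw [h3] at h2
  simpa using h2

/-- critical points are nondegenerate for generic weights, and avoid a given hyperplane. -/
theorem param (ess : Ess a) (α : V →L[ℂ] ℂ) (β : ℂ) (hα : ∃ x, α x + β ≠ 0) :
    ∃ g : MvPolynomial ι ℂ, g ≠ 0 ∧ ∀ u, MvPolynomial.eval u g ≠ 0 → ∀ x ∈ Sol a b u,
      Nondeg a b u x ∧ α x + β ≠ 0 := by
  let B := Module.finBasis ℂ (V × RelS a)
  let A1 : ι → (V × RelS a →ₗ[ℂ] ℂ) := fun i => (a i).toLinearMap ∘ₗ LinearMap.fst ℂ V (RelS a)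
  let A2 : ι → (V × RelS a →ₗ[ℂ] ℂ) := fun i => LinearMap.proj i ∘ₗ (RelS a).subtype ∘ₗ LinearMap.snd ℂ V (RelS a)
  let f : ι → MvPolynomial (Fin (Module.finrank ℂ (V × RelS a))) ℂ := fun i =>
    (linP B (A1 i) + MvPolynomial.C (b i)) * linP B (A2 i)
  have hc : Fintype.card (Fin (Module.finrank ℂ (V × RelS a))) = Fintype.card ι := by
    rw [Fintype.card_fin, Module.finrank_prod, RelS_dim a ess]
  have hfe : ∀ x c i, MvPolynomial.eval (B.equivFun (x, c)) (f i) = (a i x + b i) * c.1 i := by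
    intro x c i
    simp only [f, map_mul, map_add, linP_eval, MvPolynomial.eval_C]
    rfl
  have hfd : ∀ x c v c' i, dual (B.equivFun (x, c)) (B.equivFun (v, c')) (f i) =
      TrivSqZeroExt.inl ((a i x + b i) * c.1 i) + TrivSqZeroExt.inr ((a i x + b i) * c'.1 i + a i v * c.1 i) := by
    intro x c v c' i
    have h : dual (B.equivFun (x, c)) (B.equivFun (v, c')) (MvPolynomial.C (b i)) = TrivSqZeroExt.inl (b i) :=
      AlgHom.commutes (dual _ _) _
    simp only [f, map_mul, map_add, linP_dual, h]
    have e1 : ∀ p, A1 i p = a i p.1 := fun p => rfl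
    have e2 : ∀ p, A2 i p = p.2.1 i := fun p => rfl
    simp only [e1, e2]
    ext
    · simp
    · simp
  let h := linP B (α.toLinearMap ∘ₗ LinearMap.fst ℂ V (RelS a)) + MvPolynomial.C β
  have hhe : ∀ x c, MvPolynomial.eval (B.equivFun (x, c)) h = α x + β := by
    intro x c
    simp only [h, map_add, linP_eval, MvPolynomial.eval_C]
    rfl
  have hh : h ≠ 0 := by
    obtain ⟨x, hx⟩ := hα
    intro h0
    apply hx
    rw [← hhe x 0, h0, map_zero]
  obtain ⟨g1, hg1, H1⟩ := B1 f hc h hh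
  obtain ⟨g2, hg2, H2⟩ := B2 f hc
  refine ⟨g1 * g2, mul_ne_zero hg1 hg2, fun u hu x hx => ?_⟩
  rw [map_mul, mul_ne_zero_iff] at hu
  obtain ⟨hx1, hx2⟩ := hx
  let c : RelS a := ⟨fun i => u i / (a i x + b i), fun w => by
    rw [← hx2 w]; exact Finset.sum_congr rfl fun i _ => by ring⟩
  have hu2 : (fun i => MvPolynomial.eval (B.equivFun (x, c)) (f i)) = u := by
    funext i
    rw [hfe]
    exact mul_div_cancel₀ _ (hx1 i)
  constructor
  · intro v hv
    let c' : RelS a := ⟨fun i => -(u i * a i v / (a i x + b i) ^ 2), fun w => by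
      rw [← neg_eq_zero, ← hv w, ← Finset.sum_neg_distrib]; exact Finset.sum_congr rfl fun i _ => by ring⟩
    have := H2 (B.equivFun (x, c)) (by rw [hu2]; exact hu.2) (B.equivFun (v, c')) (fun i => by
      rw [hfd, hfe]
      have h0 : (a i x + b i) * c'.1 i + a i v * c.1 i = 0 := by
        have := hx1 i
        simp only [c, c']
        field_simp
        ring
      rw [h0, TrivSqZeroExt.inr_zero, add_zero])
    have h0 : (v, c') = 0 := by simpa using this
    exact congrArg Prod.fst h0
  · intro h0
    refine hu.1 ?_
    rw [← hu2]
    exact H1 _ (by rw [hhe]; exact h0)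
end
end OT
end
end

section
open Filter Topology
open ScatteringPaper (eulerChar)

noncomputable section
namespace OT
set_option linter.unusedSectionVars false

def Good {V : Type} [NormedAddCommGroup V] [NormedSpace ℂ V] [FiniteDimensional ℂ V]
    {ι : Type} [Fintype ι] (a : ι → V →L[ℂ] ℂ) (b : ι → ℂ) : Prop :=
  FT (Xc a b) ∧ ∃ N : ℕ, eulerChar (Xc a b) = (-1) ^ (Module.finrank ℂ V) * (N : ℤ) ∧
    ∃ g : MvPolynomial ι ℂ, g ≠ 0 ∧ ∀ u, MvPolynomial.eval u g ≠ 0 →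
      (Sol a b u).Finite ∧ (Sol a b u).ncard = N ∧ ∀ x ∈ Sol a b u, Nondeg a b u x

def MainP (ι : Type) [Fintype ι] : Prop :=
  ∀ (V : Type) [NormedAddCommGroup V] [NormedSpace ℂ V] [FiniteDimensional ℂ V]
    (a : ι → V →L[ℂ] ℂ) (b : ι → ℂ), Ess a → Good a b

section
variable {V : Type} [NormedAddCommGroup V] [NormedSpace ℂ V] [FiniteDimensional ℂ V]
  {ι : Type} [Fintype ι]

/-- It suffices to know the count frequently. -/
lemma good_of (a : ι → V →L[ℂ] ℂ) (b : ι → ℂ) (ess : Ess a) (hFT : FT (Xc a b))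
    (h : ∀ g : MvPolynomial ι ℂ, g ≠ 0 → ∃ u, MvPolynomial.eval u g ≠ 0 ∧
      eulerChar (Xc a b) = (-1) ^ (Module.finrank ℂ V) * ((Sol a b u).ncard : ℤ)) : Good a b := by
  obtain ⟨g, hg, H⟩ := param a b ess 0 1 ⟨0, by simp⟩
  obtain ⟨N, g', hg', H'⟩ := const_count a b ess g hg fun u hu x hx => (H u hu x hx).1
  refine ⟨hFT, N, ?_, g', hg', H'⟩
  obtain ⟨u, hu, hu2⟩ := h g' hg'
  rw [hu2, (H' u hu).2.1]

lemma good_reindex {κ : Type} [Fintype κ] (j : κ → ι) (hj : Function.Injective j)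
    (a : ι → V →L[ℂ] ℂ) (b : ι → ℂ) (ess : Ess a) (a' : κ → V →L[ℂ] ℂ) (b' : κ → ℂ)
    (hX : Xc a b = Xc a' b') (hS : ∀ u, Sol a b u = Sol a' b' (u ∘ j)) (h : Good a' b') : Good a b := by
  obtain ⟨hFT, N, hN, g', hg', H⟩ := h
  refine good_of a b ess (by rw [hX]; exact hFT) fun g hg => ?_
  have hr : MvPolynomial.rename j g' ≠ 0 := by
    intro h
    exact hg' (MvPolynomial.rename_injective j hj (by rw [h, map_zero]))
  obtain ⟨u, hu⟩ := exists_nonroot (g * MvPolynomial.rename j g') (mul_ne_zero hg hr)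
  rw [map_mul, mul_ne_zero_iff, MvPolynomial.eval_rename] at hu
  refine ⟨u, hu.1, ?_⟩
  rw [hX, hS, (H _ hu.2).2.1, hN]

lemma dense_ne (g : MvPolynomial ι ℂ) (hg : g ≠ 0) (u0 : ι → ℂ) : ∃ᶠ u in 𝓝 u0, MvPolynomial.eval u g ≠ 0 := by
  obtain ⟨u1, hu1⟩ := exists_nonroot g hg
  have hfin := poly_line g u1 (u0 - u1) hu1
  have hc : Tendsto (fun z : ℂ => u1 + z • (u0 - u1)) (𝓝[≠] 1) (𝓝 u0) := by
    have : Tendsto (fun z : ℂ => u1 + z • (u0 - u1)) (𝓝 1) (𝓝 (u1 + (1 : ℂ) • (u0 - u1))) :=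
      Continuous.tendsto (by fun_prop) 1
    simp only [one_smul, add_sub_cancel] at this
    exact this.mono_left nhdsWithin_le_nhds
  refine hc.frequently (Eventually.frequently ?_)
  have h2 : ({z : ℂ | MvPolynomial.eval (u1 + z • (u0 - u1)) g = 0} \ {1})ᶜ ∈ 𝓝 (1 : ℂ) :=
    (hfin.subset Set.sdiff_subset).isClosed.isOpen_compl.mem_nhds (by simp)
  filter_upwards [nhdsWithin_le_nhds h2, self_mem_nhdsWithin] with z hz hz1 h
  exact hz ⟨h, hz1⟩

def PhiH (α : V →L[ℂ] ℂ) (β : ℂ) (e : V) (he : α e = 1) (p0 : V) (hp0 : α p0 + β = 0) : KerT α × ℂ ≃ₜ V where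
  toFun p := p0 + p.1 + p.2 • e
  invFun x := (⟨x - p0 - (α x + β) • e, by
    rw [LinearMap.mem_ker]
    simp only [ContinuousLinearMap.coe_coe, map_sub, map_smul, he, smul_eq_mul, mul_one]
    linear_combination -hp0⟩, α x + β)
  left_inv := by
    rintro ⟨y, t⟩
    have hy0 : α (y : V) = 0 := y.2
    have ht : α (p0 + y + t • e) + β = t := by
      simp only [map_add, map_smul, he, hy0, smul_eq_mul, mul_one]
      linear_combination hp0
    refine Prod.ext (Subtype.ext ?_) ht
    simp only [ht]
    abel
  right_inv := by
    intro x
    change p0 + (x - p0 - (α x + β) • e) + (α x + β) • e = x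
    abel
  continuous_toFun := by fun_prop
  continuous_invFun := by fun_prop

lemma PhiH_alpha (α : V →L[ℂ] ℂ) (β : ℂ) (e : V) (he : α e = 1) (p0 : V) (hp0 : α p0 + β = 0) (p : KerT α × ℂ) :
    α (PhiH α β e he p0 hp0 p) + β = p.2 := by
  have hy0 : α (p.1 : V) = 0 := p.1.2
  change α (p0 + p.1 + p.2 • e) + β = p.2
  simp only [map_add, map_smul, he, hy0, smul_eq_mul, mul_one]
  linear_combination hp0

lemma PhiH_a (α : V →L[ℂ] ℂ) (β : ℂ) (e : V) (he : α e = 1) (p0 : V) (hp0 : α p0 + β = 0) (p : KerT α × ℂ)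
    (a : V →L[ℂ] ℂ) (b : ℂ) :
    a (PhiH α β e he p0 hp0 p) + b = (a (p0 + p.1) + b) + p.2 * a e := by
  change a (p0 + p.1 + p.2 • e) + b = _
  simp only [map_add, map_smul, smul_eq_mul]
  ring

lemma finrank_ker (α : V →L[ℂ] ℂ) (e : V) (he : α e = 1) :
    Module.finrank ℂ V = Module.finrank ℂ (KerT α) + 1 := by
  have h : Module.finrank ℂ (LinearMap.range α.toLinearMap) + Module.finrank ℂ (KerT α) = Module.finrank ℂ V :=
    LinearMap.finrank_range_add_finrank_ker α.toLinearMap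
  have h2 : LinearMap.range α.toLinearMap = ⊤ := by
    rw [LinearMap.range_eq_top]
    intro z
    exact ⟨z • e, by simp [he]⟩
  rw [h2, finrank_top, Module.finrank_self] at h
  rw [← h, add_comm]

end

lemma main_empty : MainP PEmpty := by
  intro V _ _ _ a b ess
  have hV : ∀ v : V, v = 0 := fun v => ess v fun i => i.elim
  have : Subsingleton V := ⟨fun x y => by rw [hV x, hV y]⟩
  have hX : Xc a b = Set.univ := by ext x; simp [Xc]
  have hS : ∀ u, Sol a b u = {0} := by
    intro u
    ext x
    simp [Sol, hX, hV x]
  have : Unique (Xc a b) := ⟨⟨⟨0, by rw [hX]; trivial⟩⟩, fun x => Subtype.ext (Subsingleton.elim _ _)⟩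
  obtain ⟨h1, h2⟩ := FT_point (X := Xc a b)
  refine good_of a b ess h1 fun g hg => ?_
  obtain ⟨u, hu⟩ := exists_nonroot g hg
  refine ⟨u, hu, ?_⟩
  rw [h2, hS, Module.finrank_zero_of_subsingleton]
  simp

lemma main_equiv {ι κ : Type} [Fintype ι] [Fintype κ] (e : κ ≃ ι) (h : MainP κ) : MainP ι := by
  intro V _ _ _ a b ess
  refine good_reindex e e.injective a b ess (a ∘ e) (b ∘ e) ?_ ?_ (h V _ _ ?_)
  · ext x
    exact (e.forall_congr_right (q := fun i => a i x + b i ≠ 0)).symm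
  · intro u
    ext x
    refine and_congr ?_ (forall_congr' fun w => ?_)
    · exact (e.forall_congr_right (q := fun i => a i x + b i ≠ 0)).symm
    · rw [← e.sum_comp]; rfl
  · intro v hv
    refine ess v fun i => ?_
    simpa using hv (e.symm i)

end OT
end
end

section
open Filter Topology
open ScatteringPaper (eulerChar)

noncomputable section
namespace OT
set_option linter.unusedSectionVars false

section
variable {V : Type} [NormedAddCommGroup V] [NormedSpace ℂ V] [FiniteDimensional ℂ V]
  {ι : Type} [Fintype ι]

lemma opt_Xc (a : Option ι → V →L[ℂ] ℂ) (b : Option ι → ℂ) (x : V) :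
    x ∈ Xc a b ↔ (a none x + b none ≠ 0 ∧ x ∈ Xc (fun i => a (some i)) (fun i => b (some i))) := Option.forall

lemma rX_mem (a : ι → V →L[ℂ] ℂ) (b : ι → ℂ) (α : V →L[ℂ] ℂ) (p0 : V) (y : KerT α) :
    y ∈ Xc (ra a α) (rb a b p0) ↔ ∀ i, a i (p0 + y) + b i ≠ 0 := by
  simp only [Xc, Set.mem_ofPred_eq, ra_ell]

def kfun (a : ι → V →L[ℂ] ℂ) (b : ι → ℂ) (α : V →L[ℂ] ℂ) (p0 e : V) (y : KerT α) : ℝ :=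
  ∑ i, ‖a i e‖ / ‖a i (p0 + y) + b i‖

lemma kfun_nonneg (a : ι → V →L[ℂ] ℂ) (b : ι → ℂ) (α : V →L[ℂ] ℂ) (p0 e : V) (y : KerT α) :
    0 ≤ kfun a b α p0 e y := Finset.sum_nonneg fun i _ => by positivity

lemma kfun_cont (a : ι → V →L[ℂ] ℂ) (b : ι → ℂ) (α : V →L[ℂ] ℂ) (p0 e : V) :
    ContinuousOn (kfun a b α p0 e) (Xc (ra a α) (rb a b p0)) := by
  refine continuousOn_finsetSum _ fun i _ => ContinuousOn.div (by fun_prop) (by fun_prop) fun y hy => ?_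
  rw [rX_mem] at hy
  exact norm_ne_zero_iff.2 (hy i)

lemma kfun_lt (a : ι → V →L[ℂ] ℂ) (b : ι → ℂ) (α : V →L[ℂ] ℂ) (p0 e : V) (y : KerT α) (t : ℂ)
    (hy : y ∈ Xc (ra a α) (rb a b p0)) (h : kfun a b α p0 e y * ‖t‖ < 1) (i : ι) :
    (a i (p0 + y) + b i) + t * a i e ≠ 0 := by
  rw [rX_mem] at hy
  have h1 : ‖a i e‖ / ‖a i (p0 + y) + b i‖ ≤ kfun a b α p0 e y :=
    Finset.single_le_sum (f := fun i => ‖a i e‖ / ‖a i (p0 + (y : V)) + b i‖) (fun i _ => by positivity) (Finset.mem_univ i)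
  have h2 : 0 < ‖a i (p0 + y) + b i‖ := norm_pos_iff.2 (hy i)
  have h3 : ‖a i e‖ / ‖a i (p0 + y) + b i‖ * ‖t‖ < 1 :=
    lt_of_le_of_lt (mul_le_mul_of_nonneg_right h1 (norm_nonneg t)) h
  rw [div_mul_eq_mul_div, div_lt_one h2] at h3
  intro h0
  have h4 : a i (p0 + y) + b i = -(t * a i e) := by linear_combination h0
  rw [h4, norm_neg, norm_mul, mul_comm] at h3
  exact lt_irrefl _ h3

lemma ra_ess (a : Option ι → V →L[ℂ] ℂ) (ess : Ess a) : Ess (ra (fun i => a (some i)) (a none)) := by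
  intro v hv
  refine Subtype.ext (ess v fun o => ?_)
  cases o with
  | none => exact v.2
  | some i => exact hv i

end

lemma main_option (ι : Type) [Fintype ι] (ih : MainP ι) : MainP (Option ι) := by
  intro V _ _ _ a b ess
  set α := a none with hα
  set β := b none with hβ
  set a' : ι → V →L[ℂ] ℂ := fun i => a (some i) with ha'
  set b' : ι → ℂ := fun i => b (some i) with hb'
  by_cases hα0 : α = 0
  · by_cases hβ0 : β = 0
    · -- empty complement
      have hX : ∀ x, x ∉ Xc a b := by
        intro x hx
        refine hx none ?_
        rw [← hα, ← hβ, hα0, hβ0]; simp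
      have : IsEmpty (Xc a b) := ⟨fun x => hX x.1 x.2⟩
      obtain ⟨h1, h2⟩ := FT_empty (Xc a b)
      refine good_of a b ess h1 fun g hg => ?_
      obtain ⟨u, hu⟩ := exists_nonroot g hg
      refine ⟨u, hu, ?_⟩
      have hS : Sol a b u = ∅ := by
        ext x
        simp only [Set.mem_empty_iff_false, iff_false]
        exact fun hx => hX x hx.1
      rw [h2, hS]; simp
    · have hX : Xc a b = Xc a' b' := by
        ext x
        rw [opt_Xc]
        refine and_iff_right ?_
        rw [← hα, ← hβ, hα0]; simpa using hβ0
      refine good_reindex some (Option.some_injective ι) a b ess a' b' hX ?_ (ih V a' b' ?_)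
      · intro u
        ext x
        refine and_congr (by rw [hX]) (forall_congr' fun w => ?_)
        rw [Fintype.sum_option, ← hα, hα0]
        simp [ha', hb']
      · intro v hv
        refine ess v fun o => ?_
        cases o with
        | none => rw [← hα, hα0]; rfl
        | some i => exact hv i
  · obtain ⟨e0, he0⟩ : ∃ v, α v ≠ 0 := by
      by_contra! h
      exact hα0 (ContinuousLinearMap.ext h)
    by_cases hess' : Ess a'
    · -- deletion restriction
      let e : V := (α e0)⁻¹ • e0
      have he : α e = 1 := by simp [e, he0]
      let p0 : V := (-β) • e
      have hp0 : α p0 + β = 0 := by simp [p0, he]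
      obtain ⟨hF1, N1, hN1, g1, hg1, H1⟩ := ih V a' b' hess'
      obtain ⟨hF2, N2, hN2, g2, hg2, H2⟩ := ih (KerT α) (ra a' α) (rb a' b' p0) (ra_ess a ess)
      let Φ := PhiH α β e he p0 hp0
      have hΦα : ∀ p, α (Φ p) + β = p.2 := PhiH_alpha α β e he p0 hp0
      have hΦa : ∀ p i, a' i (Φ p) + b' i = (a' i (p0 + p.1) + b' i) + p.2 * a' i e := fun p i =>
        PhiH_a α β e he p0 hp0 p (a' i) (b' i)
      have hX'1 := FT_homeo (Φ.symm.sets (s := Xc a' b') (t := Φ ⁻¹' Xc a' b') (by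
        ext x; simp)) hF1
      have hdr := del_res (B := Xc (ra a' α) (rb a' b' p0)) (k := kfun a' b' α p0 e) (Xc_open _ _)
        (kfun_cont a' b' α p0 e) (kfun_nonneg a' b' α p0 e) hF2 (Φ ⁻¹' Xc a' b')
        ((Xc_open a' b').preimage Φ.continuous) (by
          rintro ⟨y, t⟩ ⟨hy, hk⟩ i
          rw [hΦa]
          exact kfun_lt a' b' α p0 e y t hy hk i) (by
          rintro ⟨y, t⟩ hp ht
          simp only at ht
          subst ht
          rw [rX_mem]
          intro i
          have := hp i
          rw [hΦa] at this
          simpa using this) hX'1.1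
      have hX := FT_homeo (Φ.sets (s := {p | p ∈ Φ ⁻¹' Xc a' b' ∧ p.2 ≠ 0}) (t := Xc a b) (by
        ext p
        rw [Set.mem_preimage, opt_Xc, ← hα, ← hβ, hΦα, and_comm]
        rfl)) hdr.1
      refine good_of a b ess hX.1 fun g hg => ?_
      obtain ⟨g3, hg3, H3⟩ := param a' b' hess' α β (by
        by_cases hb : β = 0
        · exact ⟨e, by rw [he, hb]; simp⟩
        · exact ⟨0, by simpa using hb⟩)
      obtain ⟨u0, hu0⟩ := exists_nonroot (g1 * g2 * g3 * sumPoly ι)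
        (mul_ne_zero (mul_ne_zero (mul_ne_zero hg1 hg2) hg3) sumPoly_ne)
      simp only [map_mul, mul_ne_zero_iff] at hu0
      obtain ⟨⟨⟨w1, w2⟩, w3⟩, w4⟩ := hu0
      have hdeg := degen a' b' α β e he hess' u0 (sumPoly_eval u0 w4) (H3 u0 w3) p0 hp0 (H2 u0 w2).2.2
      have hfreq := dense_ne (g * MvPolynomial.X none) (mul_ne_zero hg (MvPolynomial.X_ne_zero _))
        (fun o : Option ι => o.elim 0 u0)
      have hc : Tendsto (fun u : Option ι → ℂ => ((fun i => u (some i)), u none))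
          (𝓝 (fun o : Option ι => o.elim 0 u0)) (𝓝 (u0, (0 : ℂ))) :=
        Continuous.tendsto' (by fun_prop) _ _ rfl
      obtain ⟨u, hu1, hu2⟩ := (hfreq.and_eventually (hc.eventually hdeg)).exists
      rw [map_mul, mul_ne_zero_iff, MvPolynomial.eval_X] at hu1
      refine ⟨u, hu1.1, ?_⟩
      have hcount := hu2 hu1.2
      have e1 : (fun o : Option ι => o.elim α a') = a := by funext o; cases o <;> rfl
      have e2 : (fun o : Option ι => o.elim β b') = b := by funext o; cases o <;> rfl
      have e3 : (fun o : Option ι => o.elim (u none) (fun i => u (some i))) = u := by funext o; cases o <;> rfl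
      simp only [e1, e2, e3] at hcount
      rw [hcount, (H1 u0 w1).2.1, (H2 u0 w2).2.1, hX.2, hdr.2, hX'1.2, hN1, hN2, finrank_ker α e he]
      push_cast
      ring
    · -- nonessential deletion
      unfold Ess at hess'
      push Not at hess'
      obtain ⟨v, hv, hv0⟩ := hess'
      have hαv : α v ≠ 0 := by
        intro h
        refine hv0 (ess v fun o => ?_)
        cases o with
        | none => exact h
        | some i => exact hv i
      let e : V := (α v)⁻¹ • v
      have he : α e = 1 := by simp [e, hαv]
      have hae : ∀ i, a' i e = 0 := fun i => by simp [e, hv i]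
      let p0 : V := (-β) • e
      have hp0 : α p0 + β = 0 := by simp [p0, he]
      obtain ⟨hF2, -⟩ := ih (KerT α) (ra a' α) (rb a' b' p0) (ra_ess a ess)
      let Φ := PhiH α β e he p0 hp0
      have hΦα : ∀ p, α (Φ p) + β = p.2 := PhiH_alpha α β e he p0 hp0
      have hΦa : ∀ p i, a' i (Φ p) + b' i = (a' i (p0 + p.1) + b' i) + p.2 * a' i e := fun p i =>
        PhiH_a α β e he p0 hp0 p (a' i) (b' i)
      have hdr := NN_punct (B := Xc (ra a' α) (rb a' b' p0)) (k := fun _ => 0) (Xc_open _ _)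
        continuousOn_const (fun _ => le_rfl) hF2
      have hX := FT_homeo (Φ.sets (s := {p | p ∈ NN (Xc (ra a' α) (rb a' b' p0)) (fun _ => 0) ∧ p.2 ≠ 0}) (t := Xc a b) (by
        ext p
        rw [Set.mem_preimage, opt_Xc, ← hα, ← hβ, hΦα, and_comm]
        refine and_congr ?_ Iff.rfl
        simp only [NN, Set.mem_ofPred_eq, zero_mul, zero_lt_one, and_true]
        rw [rX_mem]
        refine forall_congr' fun i => ?_
        have := hΦa p i
        rw [hae, mul_zero, add_zero] at this
        rw [← this])) hdr.1
      refine good_of a b ess hX.1 fun g hg => ?_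
      obtain ⟨u, hu⟩ := exists_nonroot (g * MvPolynomial.X none) (mul_ne_zero hg (MvPolynomial.X_ne_zero _))
      rw [map_mul, mul_ne_zero_iff, MvPolynomial.eval_X] at hu
      refine ⟨u, hu.1, ?_⟩
      have hS : Sol a b u = ∅ := by
        ext x
        simp only [Set.mem_empty_iff_false, iff_false]
        rintro ⟨hx, hw⟩
        have := hw e
        rw [Fintype.sum_option] at this
        have h0 : ∀ i, u (some i) * a (some i) e / (a (some i) x + b (some i)) = 0 := fun i => by
          have : a (some i) e = 0 := hae i
          rw [this]; simp
        rw [Finset.sum_eq_zero fun i _ => h0 i, add_zero, ← hα, he, mul_one] at this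
        exact div_ne_zero hu.2 (hx none) this
      rw [hX.2, hdr.2, hS]; simp

theorem main (ι : Type) [Fintype ι] : MainP ι := by
  refine Fintype.induction_empty_option (P := fun ι _ => MainP ι) ?_ main_empty (fun ι _ => main_option ι) ι
  intro κ ι _ e h
  exact @main_equiv ι κ _ (Fintype.ofEquiv ι e.symm) e h

end OT
end
end

section
open ScatteringPaper

noncomputable section
namespace OT

/-- The linear part of the `i`-th form. -/
def lin {d n : ℕ} (L : Matrix (Fin (d+1)) (Fin (n+1)) ℂ) (i : Fin (n+1)) : (Fin d → ℂ) →L[ℂ] ℂ :=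
  ∑ j : Fin d, L j.succ i • ContinuousLinearMap.proj (R := ℂ) (φ := fun _ : Fin d => ℂ) j

lemma lin_apply {d n : ℕ} (L : Matrix (Fin (d+1)) (Fin (n+1)) ℂ) (i : Fin (n+1)) (x : Fin d → ℂ) :
    lin L i x = ∑ j : Fin d, x j * L j.succ i := by
  rw [lin, sum_apply]
  refine Finset.sum_congr rfl fun j _ => ?_
  simp [mul_comm]

lemma lin_single {d n : ℕ} (L : Matrix (Fin (d+1)) (Fin (n+1)) ℂ) (i : Fin (n+1)) (k : Fin d) :
    lin L i (Pi.single k 1) = L k.succ i := by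
  rw [lin_apply, Finset.sum_eq_single k]
  · simp
  · intro j _ hj
    simp [hj]
  · simp

lemma ell_eq {d n : ℕ} (L : Matrix (Fin (d+1)) (Fin (n+1)) ℂ) (i : Fin (n+1)) (x : Fin d → ℂ) :
    ell ℂ L x i = lin L i x + L 0 i := by
  rw [ell, lin_apply, add_comm]

lemma ess_lin {d n : ℕ} (L : Matrix (Fin (d+1)) (Fin (n+1)) ℂ) (h : IsEssential L) :
    Ess (lin L) := by
  obtain ⟨S, x₀, hS⟩ := h
  intro v hv
  have h0 : x₀ ∈ {x : Fin d → ℂ | ∀ i ∈ S, ell ℂ L x i = 0} := by rw [hS]; rfl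
  have h1 : x₀ + v ∈ {x : Fin d → ℂ | ∀ i ∈ S, ell ℂ L x i = 0} := by
    intro i hi
    have := h0 i hi
    rw [ell_eq] at this ⊢
    rw [map_add, hv i, add_zero, this]
  rw [hS] at h1
  simpa using h1

lemma compl_eq {d n : ℕ} (L : Matrix (Fin (d+1)) (Fin (n+1)) ℂ) :
    complementX L = Xc (lin L) (fun i => L 0 i) := by
  ext x
  exact forall_congr' fun i => by rw [ell_eq]

lemma sol_eq {d n : ℕ} (L : Matrix (Fin (d+1)) (Fin (n+1)) ℂ) (u : Fin (n+1) → ℂ) :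
    {x : Fin d → ℂ | IsSol L u x} = Sol (lin L) (fun i => L 0 i) u := by
  ext x
  change (_ ∧ _) ↔ (_ ∧ _)
  rw [compl_eq]
  refine and_congr Iff.rfl ⟨fun h w => ?_, fun h k => ?_⟩
  · have h2 : ∑ k, w k * ∑ i, u i * L k.succ i / ell ℂ L x i = 0 :=
      Finset.sum_eq_zero fun k _ => by rw [h k, mul_zero]
    rw [← h2]
    simp only [lin_apply L _ w, Finset.mul_sum, Finset.sum_div]
    rw [Finset.sum_comm]
    refine Finset.sum_congr rfl fun k _ => Finset.sum_congr rfl fun i _ => ?_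
    rw [ell_eq]
    ring
  · have := h (Pi.single k 1)
    simp only [lin_single] at this
    simpa only [ell_eq] using this

lemma det_ne {d n : ℕ} (L : Matrix (Fin (d+1)) (Fin (n+1)) ℂ) (u : Fin (n+1) → ℂ) (x : Fin d → ℂ)
    (h : Nondeg (lin L) (fun i => L 0 i) u x) :
    Matrix.det (Matrix.of fun k l : Fin d =>
          -∑ i : Fin (n+1), u i * L k.succ i * L l.succ i / (ell ℂ L x i) ^ 2) ≠ 0 := by
  intro hdet
  obtain ⟨v, hv, hM⟩ := Matrix.exists_mulVec_eq_zero_iff.2 hdet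
  refine hv (h v fun w => ?_)
  have hk : ∀ k : Fin d, ∑ l : Fin d, (-∑ i : Fin (n+1), u i * L k.succ i * L l.succ i / (ell ℂ L x i) ^ 2) * v l = 0 :=
    fun k => congrFun hM k
  have h2 : -∑ k : Fin d, w k * ∑ l : Fin d, (-∑ i : Fin (n+1), u i * L k.succ i * L l.succ i / (ell ℂ L x i) ^ 2) * v l = 0 := by
    rw [neg_eq_zero]
    exact Finset.sum_eq_zero fun k _ => by rw [hk k, mul_zero]
  rw [← h2]
  have h3 : ∀ i, u i * lin L i v * lin L i w / (lin L i x + L 0 i) ^ 2 =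
      ∑ k, ∑ l, w k * (u i * L k.succ i * L l.succ i / (ell ℂ L x i) ^ 2 * v l) := fun i => by
    rw [lin_apply L i v, lin_apply L i w, ell_eq, mul_assoc, mul_comm (∑ j, v j * _), Finset.sum_mul_sum,
      Finset.mul_sum, Finset.sum_div]
    refine Finset.sum_congr rfl fun k _ => ?_
    rw [Finset.mul_sum, Finset.sum_div]
    refine Finset.sum_congr rfl fun l _ => ?_
    ring
  simp only [h3, neg_mul, Finset.sum_neg_distrib, mul_neg, neg_neg]
  rw [Finset.sum_comm]
  refine Finset.sum_congr rfl fun k _ => ?_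
  rw [Finset.sum_comm, Finset.mul_sum]
  refine Finset.sum_congr rfl fun l _ => ?_
  rw [Finset.sum_mul, Finset.mul_sum]

theorem final {d n : ℕ} (L : Matrix (Fin (d+1)) (Fin (n+1)) ℂ)
    (hEss : IsEssential L) :
    Generically (fun u : Fin (n+1) → ℂ =>
      {x : Fin d → ℂ | IsSol L u x}.Finite ∧
      ({x : Fin d → ℂ | IsSol L u x}.ncard : ℤ) = (-1) ^ d * eulerChar ↥(complementX L) ∧
      ∀ x : Fin d → ℂ, IsSol L u x →
        Matrix.det (Matrix.of fun k l : Fin d =>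
          -∑ i : Fin (n+1), u i * L k.succ i * L l.succ i / (ell ℂ L x i) ^ 2) ≠ 0) := by
  obtain ⟨-, N, hN, g, hg, H⟩ := main (Fin (n+1)) (Fin d → ℂ) (lin L) (fun i => L 0 i) (ess_lin L hEss)
  refine ⟨g, hg, fun u hu => ?_⟩
  obtain ⟨h1, h2, h3⟩ := H u hu
  rw [sol_eq]
  refine ⟨h1, ?_, fun x hx => det_ne L u x (h3 x ?_)⟩
  · rw [compl_eq, hN, h2, Module.finrank_fin_fun, ← mul_assoc, ← mul_pow]
    simp
  · rw [← sol_eq]; exact hx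

end OT
end
end

namespace ScatteringPaper

/-- Orlik–Terao; Theorem 2.1.  For an essential arrangement `𝒜` and generic
`u ∈ ℂ^{n+1}`, the scattering equations have only isolated solutions in `X = ℂ^d ∖ 𝒜`; their
number is `(-1)^d ⋅ χ(X)`, and each solution is a nondegenerate critical point of `ℒ_u`
(the Hessian determinant is nonzero there). -/
theorem orlik_terao_solution_count
    {d n : ℕ} (L : Matrix (Fin (d+1)) (Fin (n+1)) ℂ)
    (hEss : IsEssential L) :
    Generically (fun u : Fin (n+1) → ℂ =>
      {x : Fin d → ℂ | IsSol L u x}.Finite ∧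
      ({x : Fin d → ℂ | IsSol L u x}.ncard : ℤ) = (-1) ^ d * eulerChar ↥(complementX L) ∧
      ∀ x : Fin d → ℂ, IsSol L u x →
        Matrix.det (Matrix.of fun k l : Fin d =>
          -∑ i : Fin (n+1), u i * L k.succ i * L l.succ i / (ell ℂ L x i) ^ 2) ≠ 0) := by
  exact OT.final L hEss

end ScatteringPaper
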